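/- arXiv:1310.1198 — 2 statements merged into one kernel-verified Lean document; each statement's English description precedes it below -/
import Mathlib

section
/- Let (Y, 𝒟, ν, G) be an MDS, let 𝐃 = {d_F : F ∈ 𝓕_G} ⊆ L¹(Y, 𝒟, ν) be a sub-additive G-invariant family with ν(𝐃) > −∞, and let {F_n : n ∈ ℕ} be a Følner sequence of G each of whose terms tiles G self-similarly (with tiling subgroups G_{F_n} and isomorphisms π_{F_n} : G → G_{F_n}), satisfying: (a) the Tempelman condition with some constant M > 0; (b) there is an infinite 𝒩 ⊆ ℕ such that for each m ∈ 𝒩 and each δ > 0, for all sufficiently large p there exist n_1, n_2 with F_m π_{F_m}(F_{n_1}) ⊇ F_p ⊇ F_m π_{F_m}(F_{n_2}) and (|F_{n_1}| − |F_{n_2}|)/|F_p| < δ. If in addition there exist r_1 < r_2 < ⋯ in 𝒩 and a sequence {t_n : n ∈ ℕ} ⊆ ℕ such that F_{r_{n+1}} = F_{r_n} π_{F_{r_n}}(F_{t_n}) for each n, then d_{F_n}/|F_n| converges in L¹(Y, 𝒟, ν) to the ν-a.e. limit function d. -/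
open MeasureTheory Filter Topology
open scoped symmDiff Pointwise ENNReal

/-- `F` is a Følner sequence of `G`. -/
def IsFolner {G : Type*} [Group G] [DecidableEq G] (F : ℕ → Finset G) : Prop :=
  (∀ n, (F n).Nonempty) ∧
    ∀ g : G, Tendsto (fun n => ((((F n).image (g * ·)) ∆ (F n)).card : ℝ) / ((F n).card : ℝ))
      atTop (𝓝 0)

/-- `F` satisfies the Tempelman condition with constant `M`. -/
def TempelmanWith {G : Type*} [Group G] [DecidableEq G] (F : ℕ → Finset G) (M : ℝ) : Prop :=
  ∀ n : ℕ, ((((Finset.range (n + 1)).biUnion fun k => (F k)⁻¹ * F n).card : ℝ))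
      ≤ M * ((F n).card : ℝ)

/-- `T` tiles `G` with set of tiling centers `C`. -/
def TilesWith {G : Type*} [Group G] (T : Finset G) (C : Set G) : Prop :=
  ∀ x : G, ∃! c : G, c ∈ C ∧ ∃ t ∈ T, x = t * c

/-- A non-empty finite subset `T` tiles `G` if some set of right translates partitions `G`. -/
def Tiles {G : Type*} [Group G] (T : Finset G) : Prop :=
  T.Nonempty ∧ ∃ C : Set G, TilesWith T C

/-- The points of `A` all of whose left translates by elements of `S` stay in `A`. -/
def Finset.innerCore {G : Type*} [Group G] [DecidableEq G] (S A : Finset G) : Finset G :=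
  A.filter fun h => ∀ k ∈ S, k * h ∈ A

lemma IsFolner.tendsto_card_innerCore {G : Type*} [Group G] [DecidableEq G] {F : ℕ → Finset G}
    (hF : IsFolner F) (S : Finset G) :
    Tendsto (fun n => ((S.innerCore (F n)).card : ℝ) / (F n).card) atTop (𝓝 1) := by
  have h0 : Tendsto (fun n => 1 - ∑ g ∈ S,
      ((((F n).image (g * ·)) ∆ (F n)).card : ℝ) / ((F n).card : ℝ)) atTop (𝓝 1) := by
    have := tendsto_const_nhds (x := (1 : ℝ)) (f := (atTop : Filter ℕ)) |>.sub
      (tendsto_finsetSum S fun g _ => hF.2 g)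
    simpa using this
  refine tendsto_of_tendsto_of_tendsto_of_le_of_le h0 tendsto_const_nhds (fun n => ?_)
    (fun n => ?_)
  · have hpos : (0 : ℝ) < (F n).card := by exact_mod_cast (hF.1 n).card_pos
    have hsub : F n ⊆ S.innerCore (F n) ∪
        S.biUnion fun g => (((F n).image (g * ·)) ∆ (F n)).image (g⁻¹ * ·) := by
      intro h hh
      by_cases hc : ∀ k ∈ S, k * h ∈ F n
      · exact Finset.mem_union_left _ (Finset.mem_filter.2 ⟨hh, hc⟩)
      · push Not at hc
        obtain ⟨k, hk, hkh⟩ := hc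
        refine Finset.mem_union_right _ (Finset.mem_biUnion.2 ⟨k, hk, ?_⟩)
        refine Finset.mem_image.2 ⟨k * h, Finset.mem_symmDiff.2 (Or.inl ⟨?_, hkh⟩), by simp⟩
        exact Finset.mem_image_of_mem _ hh
    have hcard : ((F n).card : ℝ) ≤ (S.innerCore (F n)).card +
        ∑ g ∈ S, ((((F n).image (g * ·)) ∆ (F n)).card : ℝ) := by
      have h1 := (Finset.card_le_card hsub).trans (Finset.card_union_le _ _)
      have h2 := Finset.card_biUnion_le (s := S)
        (t := fun g => (((F n).image (g * ·)) ∆ (F n)).image (g⁻¹ * ·))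
      have h3 : ∑ g ∈ S, ((((F n).image (g * ·)) ∆ (F n)).image (g⁻¹ * ·)).card ≤
          ∑ g ∈ S, (((F n).image (g * ·)) ∆ (F n)).card :=
        Finset.sum_le_sum fun g _ => Finset.card_image_le
      exact_mod_cast h1.trans (by omega)
    simp only
    rw [← Finset.sum_div, sub_le_iff_le_add, ← add_div, le_div_iff₀ hpos, one_mul]
    exact hcard
  · have hpos : (0 : ℝ) < (F n).card := by exact_mod_cast (hF.1 n).card_pos
    simp only
    rw [div_le_one hpos]
    exact_mod_cast Finset.card_filter_le _ _

lemma IsFolner.tendsto_card_atTop {G : Type*} [Group G] [Infinite G] [DecidableEq G]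
    {F : ℕ → Finset G} (hF : IsFolner F) :
    Tendsto (fun n => (F n).card) atTop atTop := by
  refine tendsto_atTop.2 fun K => ?_
  obtain ⟨S, rfl⟩ := Infinite.exists_subset_card_eq G K
  have h := (hF.tendsto_card_innerCore S).eventually (lt_mem_nhds (zero_lt_one))
  filter_upwards [h] with n hn
  have hne : (S.innerCore (F n)).Nonempty := by
    by_contra hcon
    rw [Finset.not_nonempty_iff_eq_empty] at hcon
    simp [hcon] at hn
  obtain ⟨x, hx⟩ := hne
  calc S.card = (S.image (· * x)).card :=
        (Finset.card_image_of_injective _ (mul_left_injective x)).symm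
    _ ≤ (F n).card := by
        refine Finset.card_le_card fun z hz => ?_
        obtain ⟨k, hk, rfl⟩ := Finset.mem_image.1 hz
        exact (Finset.mem_filter.1 hx).2 k hk

/-- A Vitali-type covering lemma for sequences satisfying the Tempelman condition. -/
lemma TempelmanWith.exists_disjoint_cover {G : Type*} [Group G] [DecidableEq G]
    {F : ℕ → Finset G} {M : ℝ} (hne : ∀ n, (F n).Nonempty) (hTemp : TempelmanWith F M)
    (n : G → ℕ) (B : Finset G) :
    ∃ S ⊆ B, (S : Set G).PairwiseDisjoint (fun h => (F (n h)).image (· * h)) ∧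
      (B.card : ℝ) ≤ M * ∑ h ∈ S, ((F (n h)).card : ℝ) := by
  induction B using Finset.strongInduction with
  | H B ih =>
    rcases B.eq_empty_or_nonempty with rfl | hB
    · exact ⟨∅, Finset.Subset.refl _, by simp, by simp⟩
    obtain ⟨h, hh, hmax⟩ := Finset.exists_max_image B n hB
    set D := B.filter fun h' => Disjoint ((F (n h')).image (· * h')) ((F (n h)).image (· * h))
      with hD
    have hDB : D ⊂ B := by
      refine Finset.filter_ssubset.2 ⟨h, hh, ?_⟩
      rw [disjoint_self, Finset.bot_eq_empty, Finset.image_eq_empty]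
      exact (hne (n h)).ne_empty
    obtain ⟨S, hSD, hdis, hcard⟩ := ih D hDB
    have hhS : h ∉ S := by
      intro hmem
      have := (Finset.mem_filter.1 (hSD hmem)).2
      rw [disjoint_self, Finset.bot_eq_empty, Finset.image_eq_empty] at this
      exact (hne (n h)).ne_empty this
    refine ⟨insert h S, Finset.insert_subset hh (hSD.trans hDB.1), ?_, ?_⟩
    · rw [Finset.coe_insert, Set.pairwiseDisjoint_insert]
      refine ⟨hdis, fun j hj _ => ?_⟩
      exact ((Finset.mem_filter.1 (hSD hj)).2).symm
    · rw [Finset.sum_insert hhS, mul_add]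
      have hsub : B ⊆ D ∪ (((Finset.range (n h + 1)).biUnion
          fun k => (F k)⁻¹ * F (n h)).image (· * h)) := by
        intro x hx
        by_cases hd : Disjoint ((F (n x)).image (· * x)) ((F (n h)).image (· * h))
        · exact Finset.mem_union_left _ (Finset.mem_filter.2 ⟨hx, hd⟩)
        · refine Finset.mem_union_right _ ?_
          rw [Finset.not_disjoint_iff] at hd
          obtain ⟨z, hz1, hz2⟩ := hd
          obtain ⟨a, ha, rfl⟩ := Finset.mem_image.1 hz1
          obtain ⟨b, hb, hab⟩ := Finset.mem_image.1 hz2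
          refine Finset.mem_image.2 ⟨a⁻¹ * b, Finset.mem_biUnion.2 ⟨n x, ?_, ?_⟩, ?_⟩
          · exact Finset.mem_range.2 (Nat.lt_succ_of_le (hmax x hx))
          · exact Finset.mul_mem_mul (Finset.inv_mem_inv ha) hb
          · rw [mul_assoc, hab]; simp
      have h1 : (B.card : ℝ) ≤ D.card + (((Finset.range (n h + 1)).biUnion
          fun k => (F k)⁻¹ * F (n h)).card : ℝ) := by
        have := (Finset.card_le_card hsub).trans (Finset.card_union_le _ _)
        exact_mod_cast this.trans (Nat.add_le_add_left Finset.card_image_le _)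
      have h2 := hTemp (n h)
      linarith

lemma superadditive_biUnion_le {G : Type*} [DecidableEq G] {φ : Finset G → ℝ}
    (h0 : ∀ E, 0 ≤ φ E) (hadd : ∀ E E', Disjoint E E' → φ E + φ E' ≤ φ (E ∪ E'))
    {ι : Type*} [DecidableEq ι] (S : Finset ι) (A : ι → Finset G)
    (hA : (S : Set ι).PairwiseDisjoint A) : ∑ i ∈ S, φ (A i) ≤ φ (S.biUnion A) := by
  induction S using Finset.induction_on with
  | empty => simpa using h0 ∅
  | insert a S ha ih =>
    rw [Finset.coe_insert, Set.pairwiseDisjoint_insert_of_notMem (by simpa using ha)] at hA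
    rw [Finset.sum_insert ha, Finset.biUnion_insert]
    refine le_trans (by linarith [ih hA.1]) (hadd _ _ ?_)
    rw [Finset.disjoint_biUnion_right]
    exact fun i hi => hA.2 i hi

lemma superadditive_mono {G : Type*} [DecidableEq G] {φ : Finset G → ℝ}
    (h0 : ∀ E, 0 ≤ φ E) (hadd : ∀ E E', Disjoint E E' → φ E + φ E' ≤ φ (E ∪ E'))
    {E E' : Finset G} (h : E ⊆ E') : φ E ≤ φ E' := by
  have := hadd E (E' \ E) Finset.disjoint_sdiff
  rw [Finset.union_sdiff_of_subset h] at this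
  linarith [h0 (E' \ E)]

/-- A non-negative super-additive process over the family of transformations `T`. -/
structure IsSuperadditiveProcess {G : Type*} [Group G] [DecidableEq G] {Y : Type*}
    [MeasurableSpace Y] (ν : Measure Y) (T : G → Y → Y) (s : Finset G → Y → ℝ) : Prop where
  integrable : ∀ E, Integrable (s E) ν
  nonneg : ∀ᵐ y ∂ν, ∀ E, 0 ≤ s E y
  invariant : ∀ᵐ y ∂ν, ∀ (E : Finset G) (g : G), s (E.image (· * g)) y = s E (T g y)
  superadd : ∀ᵐ y ∂ν, ∀ E E' : Finset G, Disjoint E E' → s E y + s E' y ≤ s (E ∪ E') y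

lemma MeasureTheory.MeasurePreserving.integral_comp_of_integrable {Y : Type*} [MeasurableSpace Y]
    {ν : Measure Y} {T : Y → Y} (hT : MeasurePreserving T ν ν) {f : Y → ℝ}
    (hf : Integrable f ν) : ∫ y, f (T y) ∂ν = ∫ y, f y ∂ν := by
  have h := integral_map (μ := ν) hT.measurable.aemeasurable (f := f)
    (by rw [hT.map_eq]; exact hf.aestronglyMeasurable)
  rw [hT.map_eq] at h
  exact h.symm

lemma MeasureTheory.MeasurePreserving.integrable_comp' {Y : Type*} [MeasurableSpace Y]
    {ν : Measure Y} {T : Y → Y} (hT : MeasurePreserving T ν ν) {f : Y → ℝ}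
    (hf : Integrable f ν) : Integrable (fun y => f (T y)) ν :=
  hT.integrable_comp_of_integrable hf

/-- The maximal inequality for non-negative super-additive processes. -/
lemma IsSuperadditiveProcess.maximal_inequality {G : Type*} [Group G] [DecidableEq G]
    {Y : Type*} [MeasurableSpace Y] {ν : Measure Y} [IsProbabilityMeasure ν] {T : G → Y → Y}
    (hT : ∀ g, MeasurePreserving (T g) ν ν) {s : Finset G → Y → ℝ}
    (hs : IsSuperadditiveProcess ν T s) {F : ℕ → Finset G} (hF : IsFolner F) {M : ℝ}
    (hM : 0 < M) (hTemp : TempelmanWith F M) {a c : ℝ} (ha : 0 < a)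
    (hc : ∀ n, ∫ y, s (F n) y ∂ν ≤ c * (F n).card) :
    ν {y | ∃ n, a * (F n).card < s (F n) y} ≤ ENNReal.ofReal (M * c / a) := by
  set E : ℕ → Set Y := fun N => {y | ∃ n ≤ N, a * (F n).card < s (F n) y} with hE
  have hunion : {y | ∃ n, a * (F n).card < s (F n) y} = ⋃ N, E N := by
    ext y
    simp only [hE, Set.mem_ofPred_eq, Set.mem_iUnion]
    exact ⟨fun ⟨n, hn⟩ => ⟨n, n, le_rfl, hn⟩, fun ⟨_, n, _, hn⟩ => ⟨n, hn⟩⟩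
  have hmono : Monotone E := fun N N' h y ⟨n, hn, hy⟩ => ⟨n, hn.trans h, hy⟩
  rw [hunion, hmono.measure_iUnion]
  refine iSup_le fun N => ?_
  have hnull : NullMeasurableSet (E N) ν := by
    have : E N = ⋃ n ∈ Set.Iic N, {y | a * (F n).card < s (F n) y} := by
      ext y; simp [hE]
    rw [this]
    refine NullMeasurableSet.biUnion (Set.to_countable _) fun n _ => ?_
    exact nullMeasurableSet_lt aemeasurable_const (hs.integrable _).aestronglyMeasurable.aemeasurable
  set K : Finset G := (Finset.range (N + 1)).biUnion F with hK
  have hind : Integrable ((E N).indicator fun _ => (1 : ℝ)) ν :=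
    (integrable_const 1).indicator₀ hnull
  have key : ∀ p, ν.real (E N) * (((K.innerCore (F p)).card : ℝ) / (F p).card) ≤ M * c / a := by
    intro p
    have hpos : (0 : ℝ) < (F p).card := by exact_mod_cast (hF.1 p).card_pos
    have hpt : ∀ᵐ y ∂ν, ∑ h ∈ K.innerCore (F p), (E N).indicator (fun _ => (1 : ℝ)) (T h y) ≤
        M / a * s (F p) y := by
      filter_upwards [hs.nonneg, hs.invariant, hs.superadd] with y h0 hinv hadd
      classical
      set B := (K.innerCore (F p)).filter fun h => T h y ∈ E N with hB
      have hsum : ∑ h ∈ K.innerCore (F p), (E N).indicator (fun _ => (1 : ℝ)) (T h y) = B.card := by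
        rw [hB, Finset.card_filter]
        push_cast
        exact Finset.sum_congr rfl fun h _ => by simp [Set.indicator_apply]
      rw [hsum]
      have hch : ∀ h, ∃ n, h ∈ B → n ≤ N ∧ a * (F n).card < s (F n) (T h y) := by
        intro h
        by_cases hh : h ∈ B
        · obtain ⟨n, hn⟩ := (Finset.mem_filter.1 hh).2
          exact ⟨n, fun _ => hn⟩
        · exact ⟨0, fun h' => absurd h' hh⟩
      choose n hn using hch
      obtain ⟨S, hSB, hdis, hcard⟩ := hTemp.exists_disjoint_cover hF.1 n B
      have h1 := superadditive_biUnion_le h0 hadd S _ hdis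
      have h2 : s (S.biUnion fun h => (F (n h)).image (· * h)) y ≤ s (F p) y := by
        refine superadditive_mono (φ := fun E => s E y) h0 hadd ?_
        refine Finset.biUnion_subset.2 fun h hh z hz => ?_
        obtain ⟨k, hk, rfl⟩ := Finset.mem_image.1 hz
        have hcore := (Finset.mem_filter.1 (hSB hh)).1
        refine (Finset.mem_filter.1 hcore).2 k ?_
        exact Finset.mem_biUnion.2
          ⟨n h, Finset.mem_range.2 (Nat.lt_succ_of_le (hn h (hSB hh)).1), hk⟩
      have h3 : ∑ h ∈ S, a * ((F (n h)).card : ℝ) ≤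
          ∑ h ∈ S, s ((F (n h)).image (· * h)) y := by
        refine Finset.sum_le_sum fun h hh => ?_
        rw [hinv]
        exact (hn h (hSB hh)).2.le
      rw [← Finset.mul_sum] at h3
      rw [div_mul_eq_mul_div, le_div_iff₀ ha]
      calc (B.card : ℝ) * a ≤ (M * ∑ h ∈ S, ((F (n h)).card : ℝ)) * a := by gcongr
        _ = M * (a * ∑ h ∈ S, ((F (n h)).card : ℝ)) := by ring
        _ ≤ M * s (F p) y := by gcongr; linarith
    have hint := integral_mono_ae
      (integrable_finsetSum _ fun h _ => (hT h).integrable_comp' hind)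
      ((hs.integrable (F p)).const_mul (M / a)) hpt
    rw [integral_finsetSum _ fun h _ => (hT h).integrable_comp' hind,
      Finset.sum_congr rfl fun h _ => (hT h).integral_comp_of_integrable hind,
      integral_const_mul, integral_indicator₀ hnull] at hint
    simp only [integral_const, smul_eq_mul, mul_one, Finset.sum_const, nsmul_eq_mul,
      measureReal_restrict_apply_univ] at hint
    rw [← mul_div_assoc, div_le_iff₀ hpos]
    calc ν.real (E N) * ((K.innerCore (F p)).card : ℝ)
        = ((K.innerCore (F p)).card : ℝ) * ν.real (E N) := mul_comm _ _
      _ ≤ M / a * ∫ y, s (F p) y ∂ν := hint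
      _ ≤ M / a * (c * (F p).card) := by gcongr; exact hc p
      _ = M * c / a * (F p).card := by ring
  have hlim := le_of_tendsto ((hF.tendsto_card_innerCore K).const_mul (ν.real (E N)))
    (Eventually.of_forall key)
  rw [mul_one] at hlim
  rw [← ofReal_measureReal]
  exact ENNReal.ofReal_le_ofReal hlim

/-- A sequence of integrable functions that is Cauchy both almost everywhere and in `L¹`. -/
structure IsL1AeCauchy {Y : Type*} [MeasurableSpace Y] (ν : Measure Y) (X : ℕ → Y → ℝ) :
    Prop where
  integrable : ∀ n, Integrable (X n) ν
  ae : ∀ᵐ y ∂ν, CauchySeq fun n => X n y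
  l1 : ∀ ε : ℝ, 0 < ε → ∃ N, ∀ n ≥ N, ∀ m ≥ N, ∫ y, |X n y - X m y| ∂ν ≤ ε

namespace IsL1AeCauchy

variable {Y : Type*} [MeasurableSpace Y] {ν : Measure Y} {X Z : ℕ → Y → ℝ}

lemma exists_limit (h : IsL1AeCauchy ν X) :
    ∃ x : Y → ℝ, Integrable x ν ∧ (∀ᵐ y ∂ν, Tendsto (fun n => X n y) atTop (𝓝 (x y))) ∧
      Tendsto (fun n => ∫ y, |X n y - x y| ∂ν) atTop (𝓝 0) := by
  set x : Y → ℝ := fun y => limUnder atTop fun n => X n y with hx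
  have hlim : ∀ᵐ y ∂ν, Tendsto (fun n => X n y) atTop (𝓝 (x y)) := by
    filter_upwards [h.ae] with y hy using hy.tendsto_limUnder
  have hxm : AEStronglyMeasurable x ν :=
    aestronglyMeasurable_of_tendsto_ae atTop (fun n => (h.integrable n).aestronglyMeasurable) hlim
  have hbound : ∀ ε : ℝ, 0 < ε → ∃ N, ∀ n ≥ N, eLpNorm (X n - x) 1 ν ≤ ENNReal.ofReal ε := by
    intro ε hε
    obtain ⟨N, hN⟩ := h.l1 ε hε
    refine ⟨N, fun n hn => ?_⟩
    refine (Lp.eLpNorm_lim_le_liminf_eLpNorm (f := fun m => X n - X m)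
      (fun m => ((h.integrable n).sub (h.integrable m)).aestronglyMeasurable) _ ?_).trans ?_
    · filter_upwards [hlim] with y hy using tendsto_const_nhds.sub hy
    · refine liminf_le_of_frequently_le' (Eventually.frequently ?_)
      filter_upwards [eventually_ge_atTop N] with m hm
      rw [eLpNorm_one_eq_lintegral_enorm,
        ← ofReal_integral_norm_eq_lintegral_enorm ((h.integrable n).sub (h.integrable m))]
      exact ENNReal.ofReal_le_ofReal (hN n hn m hm)
  have hxint : Integrable x ν := by
    obtain ⟨N, hN⟩ := hbound 1 one_pos
    have h1 : Integrable (X N - x) ν :=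
      memLp_one_iff_integrable.1 ⟨(h.integrable N).aestronglyMeasurable.sub hxm,
        (hN N le_rfl).trans_lt ENNReal.ofReal_lt_top⟩
    have h2 := (h.integrable N).sub h1
    rwa [sub_sub_cancel] at h2
  refine ⟨x, hxint, hlim, ?_⟩
  rw [Metric.tendsto_atTop]
  intro ε hε
  obtain ⟨N, hN⟩ := hbound (ε / 2) (by positivity)
  refine ⟨N, fun n hn => ?_⟩
  have h1 := hN n hn
  rw [eLpNorm_one_eq_lintegral_enorm,
    ← ofReal_integral_norm_eq_lintegral_enorm ((h.integrable n).sub hxint),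
    ENNReal.ofReal_le_ofReal_iff (by positivity)] at h1
  simp only [Real.norm_eq_abs, Pi.sub_apply] at h1
  rw [Real.dist_eq, sub_zero, abs_of_nonneg (integral_nonneg fun y => abs_nonneg _)]
  linarith

lemma congr_ae (h : IsL1AeCauchy ν X) (hXZ : ∀ n, X n =ᵐ[ν] Z n) : IsL1AeCauchy ν Z where
  integrable n := (h.integrable n).congr (hXZ n)
  ae := by
    filter_upwards [h.ae, ae_all_iff.2 hXZ] with y hy hy'
    simpa only [← hy'] using hy
  l1 ε hε := by
    obtain ⟨N, hN⟩ := h.l1 ε hε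
    refine ⟨N, fun n hn m hm => ?_⟩
    rw [← integral_congr_ae (f := fun y => |X n y - X m y|)]
    · exact hN n hn m hm
    · filter_upwards [hXZ n, hXZ m] with y h1 h2
      rw [h1, h2]

lemma add (hX : IsL1AeCauchy ν X) (hZ : IsL1AeCauchy ν Z) :
    IsL1AeCauchy ν fun n y => X n y + Z n y where
  integrable n := (hX.integrable n).add (hZ.integrable n)
  ae := by
    filter_upwards [hX.ae, hZ.ae] with y h1 h2 using h1.add h2
  l1 ε hε := by
    obtain ⟨N, hN⟩ := hX.l1 (ε / 2) (by positivity)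
    obtain ⟨N', hN'⟩ := hZ.l1 (ε / 2) (by positivity)
    refine ⟨max N N', fun n hn m hm => ?_⟩
    have h1 := hN n (le_of_max_le_left hn) m (le_of_max_le_left hm)
    have h2 := hN' n (le_of_max_le_right hn) m (le_of_max_le_right hm)
    have i1 := ((hX.integrable n).sub (hX.integrable m)).abs
    have i2 := ((hZ.integrable n).sub (hZ.integrable m)).abs
    calc ∫ y, |X n y + Z n y - (X m y + Z m y)| ∂ν
        ≤ ∫ y, (|X n y - X m y| + |Z n y - Z m y|) ∂ν := by
          refine integral_mono_of_nonneg (Eventually.of_forall fun y => abs_nonneg _)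
            (i1.add i2) (Eventually.of_forall fun y => ?_)
          simp only
          rw [add_sub_add_comm]
          exact abs_add_le _ _
      _ = ∫ y, |X n y - X m y| ∂ν + ∫ y, |Z n y - Z m y| ∂ν := integral_add i1 i2
      _ ≤ ε := by linarith

lemma const_mul (hX : IsL1AeCauchy ν X) (c : ℝ) : IsL1AeCauchy ν fun n y => c * X n y where
  integrable n := (hX.integrable n).const_mul c
  ae := by
    filter_upwards [hX.ae] with y h1
    obtain ⟨x, hx⟩ := cauchySeq_tendsto_of_complete h1
    exact (hx.const_mul c).cauchySeq
  l1 ε hε := by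
    obtain ⟨N, hN⟩ := hX.l1 (ε / (|c| + 1)) (by positivity)
    refine ⟨N, fun n hn m hm => ?_⟩
    have h1 := hN n hn m hm
    simp only [← mul_sub, abs_mul]
    rw [integral_const_mul]
    calc |c| * ∫ y, |X n y - X m y| ∂ν ≤ (|c| + 1) * (ε / (|c| + 1)) := by
          gcongr
          linarith
      _ = ε := by field_simp

lemma const {f : Y → ℝ} (hf : Integrable f ν) : IsL1AeCauchy ν fun _ => f where
  integrable _ := hf
  ae := Eventually.of_forall fun y => cauchySeq_const (f y)
  l1 ε hε := ⟨0, fun n _ m _ => by simpa using hε.le⟩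

lemma of_abs_le [IsProbabilityMeasure ν] (hX : ∀ n, Integrable (X n) ν) {c : ℕ → ℝ}
    (hc : Tendsto c atTop (𝓝 0)) (hXc : ∀ n y, |X n y| ≤ c n) : IsL1AeCauchy ν X where
  integrable := hX
  ae := Eventually.of_forall fun y =>
    (squeeze_zero_norm (fun n => hXc n y) hc).cauchySeq
  l1 ε hε := by
    obtain ⟨N, hN⟩ := (hc.eventually (gt_mem_nhds (half_pos hε))).exists_forall_of_atTop
    refine ⟨N, fun n hn m hm => ?_⟩
    calc ∫ y, |X n y - X m y| ∂ν ≤ ∫ _, ε ∂ν := by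
          refine integral_mono ((hX n).sub (hX m)).abs (integrable_const _) fun y => ?_
          have := abs_sub (X n y) (X m y)
          have h1 := hXc n y
          have h2 := hXc m y
          have h3 := hN n hn
          have h4 := hN m hm
          simp only
          linarith
      _ = ε := by simp

/-- A Banach-principle type closure property. -/
lemma of_approx [IsProbabilityMeasure ν] (hX : ∀ n, Integrable (X n) ν)
    (h : ∀ ε : ℝ, 0 < ε → ∃ Z : ℕ → Y → ℝ, IsL1AeCauchy ν Z ∧
      ν {y | ¬ ∀ᶠ n in atTop, |X n y - Z n y| ≤ ε} ≤ ENNReal.ofReal ε ∧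
      ∀ᶠ n in atTop, ∫ y, |X n y - Z n y| ∂ν ≤ ε) : IsL1AeCauchy ν X where
  integrable := hX
  ae := by
    have hpos : ∀ k : ℕ, (0 : ℝ) < (1 / 2) ^ k := fun k => by positivity
    choose Z hZ hae hl1 using fun k : ℕ => h _ (hpos k)
    have hfin : ∑' k, ν {y | ¬ ∀ᶠ n in atTop, |X n y - Z k n y| ≤ (1 / 2) ^ k} ≠ ⊤ :=
      ne_top_of_le_ne_top (summable_geometric_two.tsum_ofReal_ne_top)
        (ENNReal.tsum_le_tsum hae)
    filter_upwards [ae_eventually_notMem hfin, ae_all_iff.2 fun k => (hZ k).ae] with y h1 h2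
    rw [Metric.cauchySeq_iff]
    intro ε hε
    have h3 : ∀ᶠ k : ℕ in atTop, ((1 : ℝ) / 2) ^ k < ε / 3 :=
      (tendsto_pow_atTop_nhds_zero_of_lt_one (by norm_num) (by norm_num)).eventually
        (gt_mem_nhds (by positivity))
    obtain ⟨k, hk1, hk2⟩ := (h1.and h3).exists
    simp only [not_not] at hk1
    obtain ⟨N1, hN1⟩ := hk1.exists_forall_of_atTop
    obtain ⟨N2, hN2⟩ := Metric.cauchySeq_iff.1 (h2 k) (ε / 3) (by positivity)
    refine ⟨max N1 N2, fun m hm n hn => ?_⟩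
    have e1 := abs_le.1 (hN1 m (le_of_max_le_left hm))
    have e2 := abs_le.1 (hN1 n (le_of_max_le_left hn))
    have e3 := hN2 m (le_of_max_le_right hm) n (le_of_max_le_right hn)
    rw [Real.dist_eq, abs_lt] at e3 ⊢
    constructor <;> linarith [e1.1, e1.2, e2.1, e2.2, e3.1, e3.2]
  l1 ε hε := by
    obtain ⟨Z, hZ, -, hl1⟩ := h (ε / 3) (by positivity)
    obtain ⟨N1, hN1⟩ := hl1.exists_forall_of_atTop
    obtain ⟨N2, hN2⟩ := hZ.l1 (ε / 3) (by positivity)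
    refine ⟨max N1 N2, fun n hn m hm => ?_⟩
    have e1 := hN1 m (le_of_max_le_left hm)
    have e2 := hN1 n (le_of_max_le_left hn)
    have e3 := hN2 n (le_of_max_le_right hn) m (le_of_max_le_right hm)
    have i1 := ((hX n).sub (hZ.integrable n)).abs
    have i2 := ((hZ.integrable n).sub (hZ.integrable m)).abs
    have i3 := ((hX m).sub (hZ.integrable m)).abs
    calc ∫ y, |X n y - X m y| ∂ν
        ≤ ∫ y, (|X n y - Z n y| + |Z n y - Z m y| + |X m y - Z m y|) ∂ν := by
          refine integral_mono_of_nonneg (Eventually.of_forall fun y => abs_nonneg _)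
            ((i1.add i2).add i3) (Eventually.of_forall fun y => ?_)
          simp only
          rw [abs_sub_comm (X m y)]
          have h1 := abs_sub_le (X n y) (Z n y) (X m y)
          have h2 := abs_sub_le (Z n y) (Z m y) (X m y)
          linarith
      _ = ∫ y, |X n y - Z n y| ∂ν + ∫ y, |Z n y - Z m y| ∂ν + ∫ y, |X m y - Z m y| ∂ν := by
          rw [integral_add, integral_add] <;> first | assumption | exact i1.add i2
      _ ≤ ε := by linarith

end IsL1AeCauchy

/-- The average of `f` along the finite set `A` of transformations. -/
noncomputable def ergodicAverage {G Y : Type*} (T : G → Y → Y) (A : Finset G) (f : Y → ℝ)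
    (y : Y) : ℝ :=
  (∑ g ∈ A, f (T g y)) / A.card

section ErgodicAverage

variable {G Y : Type*} {T : G → Y → Y}

lemma ergodicAverage_add (A : Finset G) (f f' : Y → ℝ) (y : Y) :
    ergodicAverage T A (f + f') y = ergodicAverage T A f y + ergodicAverage T A f' y := by
  simp [ergodicAverage, Finset.sum_add_distrib, add_div]

lemma ergodicAverage_const_mul (A : Finset G) (c : ℝ) (f : Y → ℝ) (y : Y) :
    ergodicAverage T A (c • f) y = c * ergodicAverage T A f y := by
  simp [ergodicAverage, ← Finset.mul_sum, mul_div_assoc]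

lemma abs_ergodicAverage_sub_le (A : Finset G) (f f' : Y → ℝ) (y : Y) :
    |ergodicAverage T A f y - ergodicAverage T A f' y| ≤
      ergodicAverage T A (fun y => |f y - f' y|) y := by
  simp only [ergodicAverage]
  rw [← sub_div, ← Finset.sum_sub_distrib, abs_div, Nat.abs_cast]
  gcongr
  exact Finset.abs_sum_le_sum_abs _ _

variable [MeasurableSpace Y] {ν : Measure Y}

lemma integrable_sum_comp (hT : ∀ g, MeasurePreserving (T g) ν ν) (A : Finset G) {f : Y → ℝ}
    (hf : Integrable f ν) : Integrable (fun y => ∑ g ∈ A, f (T g y)) ν :=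
  integrable_finsetSum _ fun g _ => (hT g).integrable_comp' hf

lemma integral_sum_comp (hT : ∀ g, MeasurePreserving (T g) ν ν) (A : Finset G) {f : Y → ℝ}
    (hf : Integrable f ν) : ∫ y, ∑ g ∈ A, f (T g y) ∂ν = A.card * ∫ y, f y ∂ν := by
  rw [integral_finsetSum _ fun g _ => (hT g).integrable_comp' hf,
    Finset.sum_congr rfl fun g _ => (hT g).integral_comp_of_integrable hf]
  simp

lemma integrable_ergodicAverage (hT : ∀ g, MeasurePreserving (T g) ν ν) (A : Finset G)
    {f : Y → ℝ} (hf : Integrable f ν) : Integrable (ergodicAverage T A f) ν :=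
  (integrable_sum_comp hT A hf).div_const _

lemma ergodicAverage_congr_ae (hT : ∀ g, MeasurePreserving (T g) ν ν) (A : Finset G)
    {f f' : Y → ℝ} (hf : f =ᵐ[ν] f') : ergodicAverage T A f =ᵐ[ν] ergodicAverage T A f' := by
  have h : ∀ᵐ y ∂ν, ∀ g ∈ A, f (T g y) = f' (T g y) :=
    (Finset.eventually_all A).2 fun g _ => (hT g).quasiMeasurePreserving.ae hf
  filter_upwards [h] with y hy
  rw [ergodicAverage, ergodicAverage, Finset.sum_congr rfl hy]

variable [Group G] [DecidableEq G]

lemma isSuperadditiveProcess_sum (hT : ∀ g, MeasurePreserving (T g) ν ν)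
    (hmul : ∀ g h y, T (g * h) y = T g (T h y)) {f : Y → ℝ} (hf : Integrable f ν)
    (h0 : ∀ y, 0 ≤ f y) : IsSuperadditiveProcess ν T fun A y => ∑ g ∈ A, f (T g y) where
  integrable A := integrable_sum_comp hT A hf
  nonneg := Eventually.of_forall fun y A => Finset.sum_nonneg fun g _ => h0 _
  invariant := Eventually.of_forall fun y A g => by
    rw [Finset.sum_image fun a _ b _ h => mul_left_injective g h]
    exact Finset.sum_congr rfl fun h _ => by rw [hmul]
  superadd := Eventually.of_forall fun y A A' h => (Finset.sum_union h).ge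

variable [IsProbabilityMeasure ν]

lemma isL1AeCauchy_ergodicAverage_of_approx (hT : ∀ g, MeasurePreserving (T g) ν ν)
    (hmul : ∀ g h y, T (g * h) y = T g (T h y)) {F : ℕ → Finset G} (hF : IsFolner F) {M : ℝ}
    (hM : 0 < M) (hTemp : TempelmanWith F M) {f : Y → ℝ} (hf : Integrable f ν)
    (h : ∀ ε : ℝ, 0 < ε → ∃ f', Integrable f' ν ∧ ∫ y, |f y - f' y| ∂ν ≤ ε ∧
      IsL1AeCauchy ν fun n => ergodicAverage T (F n) f') :
    IsL1AeCauchy ν fun n => ergodicAverage T (F n) f := by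
  refine IsL1AeCauchy.of_approx (fun n => integrable_ergodicAverage hT _ hf) fun ε hε => ?_
  obtain ⟨f', hf', hff', hC⟩ := h (min (ε * ε / M) ε) (by positivity)
  refine ⟨_, hC, ?_, Eventually.of_forall fun n => ?_⟩
  · have hi : Integrable (fun y => |f y - f' y|) ν := (hf.sub hf').abs
    have hmax := (isSuperadditiveProcess_sum hT hmul hi fun y => abs_nonneg _).maximal_inequality
      hT hF hM hTemp hε (c := ε * ε / M) fun n => by
        rw [integral_sum_comp hT _ hi, mul_comm]
        gcongr
        exact hff'.trans (min_le_left _ _)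
    have he : M * (ε * ε / M) / ε = ε := by field_simp
    rw [he] at hmax
    refine (measure_mono fun y hy => ?_).trans hmax
    simp only [Set.mem_ofPred_eq] at hy ⊢
    by_contra hcon
    push Not at hcon
    refine hy (Eventually.of_forall fun n => ?_)
    have hpos : (0 : ℝ) < (F n).card := by exact_mod_cast (hF.1 n).card_pos
    refine (abs_ergodicAverage_sub_le _ _ _ _).trans ?_
    rw [ergodicAverage, div_le_iff₀ hpos]
    exact hcon n
  · have hi : Integrable (fun y => |f y - f' y|) ν := (hf.sub hf').abs
    have hpos : (0 : ℝ) < (F n).card := by exact_mod_cast (hF.1 n).card_pos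
    calc ∫ y, |ergodicAverage T (F n) f y - ergodicAverage T (F n) f' y| ∂ν
        ≤ ∫ y, ergodicAverage T (F n) (fun y => |f y - f' y|) y ∂ν :=
          integral_mono_of_nonneg (Eventually.of_forall fun y => abs_nonneg _)
            (integrable_ergodicAverage hT _ hi)
            (Eventually.of_forall fun y => abs_ergodicAverage_sub_le _ _ _ _)
      _ = ∫ y, |f y - f' y| ∂ν := by
          simp only [ergodicAverage]
          rw [integral_div, integral_sum_comp hT _ hi]
          field_simp
      _ ≤ ε := hff'.trans (min_le_right _ _)

/-- The square-integrable functions whose ergodic averages converge. -/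
noncomputable def convergentSubmodule (hT : ∀ g, MeasurePreserving (T g) ν ν)
    (F : ℕ → Finset G) : Submodule ℝ (Lp ℝ 2 ν) where
  carrier := {φ | IsL1AeCauchy ν fun n => ergodicAverage T (F n) φ}
  add_mem' {φ ψ} hφ hψ := by
    refine (hφ.add hψ).congr_ae fun n => ?_
    filter_upwards [ergodicAverage_congr_ae hT (F n) (Lp.coeFn_add φ ψ)] with y hy
    rw [hy, ergodicAverage_add]
  zero_mem' := by
    refine (IsL1AeCauchy.const (f := fun _ => (0 : ℝ)) (integrable_const 0)).congr_ae fun n => ?_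
    filter_upwards [ergodicAverage_congr_ae hT (F n) (Lp.coeFn_zero ℝ 2 ν)] with y hy
    rw [hy]
    simp [ergodicAverage]
  smul_mem' c φ hφ := by
    refine (hφ.const_mul c).congr_ae fun n => ?_
    filter_upwards [ergodicAverage_congr_ae hT (F n) (Lp.coeFn_smul c φ)] with y hy
    rw [hy, ergodicAverage_const_mul]

lemma isL1AeCauchy_ergodicAverage_coboundary (hT : ∀ g, MeasurePreserving (T g) ν ν)
    (hmul : ∀ g h y, T (g * h) y = T g (T h y)) {F : ℕ → Finset G} (hF : IsFolner F)
    {B : Set Y} (hB : MeasurableSet B) (g : G) :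
    IsL1AeCauchy ν fun n => ergodicAverage T (F n)
      ((T g ⁻¹' B).indicator (fun _ => (1 : ℝ)) - B.indicator fun _ => 1) := by
  have hi : ∀ S : Set Y, MeasurableSet S → Integrable (S.indicator fun _ => (1 : ℝ)) ν :=
    fun S hS => (integrable_const 1).indicator hS
  refine IsL1AeCauchy.of_abs_le (fun n => integrable_ergodicAverage hT _
    ((hi _ ((hT g).measurable hB)).sub (hi _ hB))) (hF.2 g) fun n y => ?_
  set u : G → ℝ := fun h => B.indicator (fun _ => (1 : ℝ)) (T h y) with hu
  have hu1 : ∀ h, |u h| ≤ 1 := fun h => by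
    by_cases hh : T h y ∈ B <;> simp [hu, hh]
  have hsum : ∑ h ∈ F n, ((T g ⁻¹' B).indicator (fun _ => 1) - B.indicator fun _ => 1 : Y → ℝ)
      (T h y) = ∑ h ∈ (F n).image (g * ·) \ F n, u h - ∑ h ∈ F n \ (F n).image (g * ·), u h := by
    rw [Finset.sum_sdiff_sub_sum_sdiff, Finset.sum_image fun a _ b _ h => mul_right_injective g h,
      ← Finset.sum_sub_distrib]
    refine Finset.sum_congr rfl fun h _ => ?_
    simp only [hu, hmul, Pi.sub_apply]
    rfl
  have hb : ∀ S : Finset G, |∑ h ∈ S, u h| ≤ S.card := fun S =>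
    (Finset.abs_sum_le_sum_abs _ _).trans
      ((Finset.sum_le_sum fun h _ => hu1 h).trans (by simp))
  rw [ergodicAverage, hsum, abs_div, Nat.abs_cast]
  gcongr
  refine (abs_sub _ _).trans ((add_le_add (hb _) (hb _)).trans ?_)
  have : ((F n).image (g * ·) ∆ F n).card =
      ((F n).image (g * ·) \ F n).card + (F n \ (F n).image (g * ·)).card :=
    Finset.card_union_of_disjoint disjoint_sdiff_sdiff
  rw [this]
  push_cast
  exact le_rfl

lemma orthogonal_convergentSubmodule (hT : ∀ g, MeasurePreserving (T g) ν ν)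
    (hone : ∀ y, T 1 y = y) (hmul : ∀ g h y, T (g * h) y = T g (T h y)) {F : ℕ → Finset G}
    (hF : IsFolner F) : (convergentSubmodule hT F)ᗮ = ⊥ := by
  rw [Submodule.eq_bot_iff]
  intro φ hφ
  have hφi : Integrable φ ν := (Lp.memLp φ).integrable (by norm_num)
  have hinv : ∀ g, (fun y => φ (T g y)) =ᵐ[ν] φ := by
    intro g
    refine Integrable.ae_eq_of_forall_setIntegral_eq _ _ ((hT g).integrable_comp' hφi) hφi
      fun B hB _ => ?_
    have hB' := (hT g⁻¹).measurable hB
    have hmem : indicatorConstLp 2 hB' (measure_ne_top ν _) (1 : ℝ) -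
        indicatorConstLp 2 hB (measure_ne_top ν _) (1 : ℝ) ∈ convergentSubmodule hT F := by
      refine (isL1AeCauchy_ergodicAverage_coboundary hT hmul hF hB g⁻¹).congr_ae fun n => ?_
      refine ergodicAverage_congr_ae hT _ ?_
      refine EventuallyEq.symm ((Lp.coeFn_sub _ _).trans ?_)
      exact indicatorConstLp_coeFn.sub indicatorConstLp_coeFn
    have h0 := (Submodule.mem_orthogonal _ _).1 hφ _ hmem
    rw [inner_sub_left, L2.inner_indicatorConstLp_one, L2.inner_indicatorConstLp_one,
      sub_eq_zero] at h0
    rw [← h0]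
    have h1 := setIntegral_map (μ := ν) (g := T g⁻¹) (f := fun y => φ (T g y)) hB
      (by rw [(hT g⁻¹).map_eq]; exact ((hT g).integrable_comp' hφi).aestronglyMeasurable)
      (hT g⁻¹).measurable.aemeasurable
    rw [(hT g⁻¹).map_eq] at h1
    rw [h1]
    simp only [← hmul, mul_inv_cancel, hone]
  have hmem : φ ∈ convergentSubmodule hT F := by
    refine (IsL1AeCauchy.const hφi).congr_ae fun n => ?_
    filter_upwards [(Finset.eventually_all (F n)).2 fun g _ => hinv g] with y hy
    have hpos : (0 : ℝ) < (F n).card := by exact_mod_cast (hF.1 n).card_pos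
    rw [ergodicAverage, Finset.sum_congr rfl hy]
    simp only [Finset.sum_const, nsmul_eq_mul]
    field_simp
  exact inner_self_eq_zero.1 ((Submodule.mem_orthogonal _ _).1 hφ _ hmem)

/-- The pointwise and mean ergodic theorem along Følner sequences satisfying the Tempelman
condition. -/
lemma isL1AeCauchy_ergodicAverage (hT : ∀ g, MeasurePreserving (T g) ν ν)
    (hone : ∀ y, T 1 y = y) (hmul : ∀ g h y, T (g * h) y = T g (T h y)) {F : ℕ → Finset G}
    (hF : IsFolner F) {M : ℝ} (hM : 0 < M) (hTemp : TempelmanWith F M) {f : Y → ℝ}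
    (hf : Integrable f ν) : IsL1AeCauchy ν fun n => ergodicAverage T (F n) f := by
  refine isL1AeCauchy_ergodicAverage_of_approx hT hmul hF hM hTemp hf fun ε hε => ?_
  have hdense : ∀ φ : Lp ℝ 2 ν, φ ∈ closure (convergentSubmodule hT F : Set (Lp ℝ 2 ν)) := by
    intro φ
    have h := Submodule.topologicalClosure_eq_top_iff.2
      (orthogonal_convergentSubmodule hT hone hmul hF)
    rw [← Submodule.topologicalClosure_coe, h]
    trivial
  obtain ⟨f', hff', hf', hC⟩ := MemLp.induction_dense (p := 1) (μ := ν) (by norm_num)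
    (fun f' => Integrable f' ν ∧ IsL1AeCauchy ν fun n => ergodicAverage T (F n) f')
    (fun c B hB _ ε hε => by
      obtain ⟨δ, hδ, hδε⟩ : ∃ δ : ℝ, 0 < δ ∧ ENNReal.ofReal δ ≤ ε := by
        rcases eq_or_ne ε ⊤ with rfl | htop
        · exact ⟨1, one_pos, le_top⟩
        · exact ⟨ε.toReal, ENNReal.toReal_pos hε htop, ENNReal.ofReal_toReal_le⟩
      obtain ⟨w, hw, hd⟩ := Metric.mem_closure_iff.1
        (hdense (indicatorConstLp 2 hB (measure_ne_top ν _) c)) δ hδ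
      refine ⟨w, ?_, (Lp.memLp w).integrable (by norm_num), hw⟩
      rw [dist_comm, Lp.dist_def] at hd
      refine le_trans ?_ hδε
      have hcongr : (⇑w - B.indicator fun _ => c) =ᵐ[ν]
          ⇑w - ⇑(indicatorConstLp 2 hB (measure_ne_top ν B) c) :=
        (EventuallyEq.refl _ _).sub indicatorConstLp_coeFn.symm
      have hm := (Lp.memLp w).sub (Lp.memLp (indicatorConstLp 2 hB (measure_ne_top ν B) c))
      rw [eLpNorm_congr_ae hcongr]
      refine (eLpNorm_le_eLpNorm_of_exponent_le (by norm_num : (1 : ℝ≥0∞) ≤ 2) hm.1).trans ?_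
      exact (ENNReal.le_ofReal_iff_toReal_le hm.2.ne hδ.le).2 hd.le)
    (fun f₁ f₂ h₁ h₂ => ⟨h₁.1.add h₂.1, (h₁.2.add h₂.2).congr_ae fun n =>
      Eventually.of_forall fun y => (ergodicAverage_add _ _ _ _).symm⟩)
    (fun f' h => h.1.aestronglyMeasurable) (memLp_one_iff_integrable.2 hf)
    (ε := ENNReal.ofReal ε) (by simpa using hε)
  refine ⟨f', hf', ?_, hC⟩
  rw [eLpNorm_one_eq_lintegral_enorm, ← ofReal_integral_norm_eq_lintegral_enorm (hf.sub hf'),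
    ENNReal.ofReal_le_ofReal_iff hε.le] at hff'
  exact hff'

end ErgodicAverage

lemma tendsto_atTop_of_card {G ι : Type*} {F : ℕ → Finset G} {l : Filter ι} {n : ι → ℕ}
    (h : Tendsto (fun p => (F (n p)).card) l atTop) : Tendsto n l atTop := by
  refine tendsto_atTop.2 fun K => ?_
  filter_upwards [h.eventually (eventually_gt_atTop ((Finset.range K).sup fun k => (F k).card))]
    with p hp
  by_contra! hlt
  exact absurd (Finset.le_sup (f := fun k => (F k).card) (Finset.mem_range.2 hlt)) (not_le.2 hp)

section Tiling

variable {G : Type*} [Group G] [DecidableEq G]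

lemma TilesWith.disjoint {A : Finset G} {C : Set G} (hA : TilesWith A C) {c c' : G} (hc : c ∈ C)
    (hc' : c' ∈ C) (hne : c ≠ c') : Disjoint (A.image (· * c)) (A.image (· * c')) := by
  rw [Finset.disjoint_left]
  intro x hx hx'
  obtain ⟨a, ha, rfl⟩ := Finset.mem_image.1 hx
  obtain ⟨a', ha', haa⟩ := Finset.mem_image.1 hx'
  exact hne ((hA _).unique ⟨hc, a, ha, rfl⟩ ⟨hc', a', ha', haa.symm⟩)

variable {A : Finset G} {H : Subgroup G} (π : G ≃* H)

lemma mul_image_eq_biUnion (E : Finset G) : A * (E.image fun x => (π x : G)) =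
    E.biUnion fun g => A.image (· * (π g : G)) := by
  ext x
  simp only [Finset.mem_mul, Finset.mem_biUnion, Finset.mem_image, exists_exists_and_eq_and]
  exact ⟨fun ⟨a, ha, g, hg, h⟩ => ⟨g, hg, a, ha, h⟩, fun ⟨g, hg, a, ha, h⟩ => ⟨a, ha, g, hg, h⟩⟩

lemma mul_image_mul_right (E : Finset G) (g : G) :
    A * ((E.image (· * g)).image fun x => (π x : G)) =
      (A * (E.image fun x => (π x : G))).image (· * (π g : G)) := by
  ext x
  simp only [Finset.mem_mul, Finset.mem_image]
  constructor
  · rintro ⟨a, ha, _, ⟨_, ⟨e, he, rfl⟩, rfl⟩, rfl⟩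
    exact ⟨a * π e, ⟨a, ha, π e, ⟨e, he, rfl⟩, rfl⟩, by simp [mul_assoc]⟩
  · rintro ⟨_, ⟨a, ha, _, ⟨e, he, rfl⟩, rfl⟩, rfl⟩
    exact ⟨a, ha, π (e * g), ⟨e * g, ⟨e, he, rfl⟩, rfl⟩, by simp [mul_assoc]⟩

lemma TilesWith.pairwiseDisjoint (hA : TilesWith A (H : Set G)) (S : Set G) :
    S.PairwiseDisjoint fun g => A.image (· * (π g : G)) := fun g _ g' _ hne =>
  hA.disjoint (π g).2 (π g').2 fun h => hne (π.injective (Subtype.ext h))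

lemma TilesWith.card_mul_image (hA : TilesWith A (H : Set G)) (E : Finset G) :
    (A * (E.image fun x => (π x : G))).card = A.card * E.card := by
  rw [mul_image_eq_biUnion, Finset.card_biUnion fun g _ g' _ hne =>
    hA.pairwiseDisjoint π Set.univ (Set.mem_univ g) (Set.mem_univ g') hne,
    Finset.sum_congr rfl fun g _ => Finset.card_image_of_injective _ (mul_left_injective _)]
  simp [mul_comm]

lemma TilesWith.disjoint_mul_image (hA : TilesWith A (H : Set G)) {E E' : Finset G}
    (h : Disjoint E E') :
    Disjoint (A * (E.image fun x => (π x : G))) (A * (E'.image fun x => (π x : G))) := by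
  simp only [mul_image_eq_biUnion, Finset.disjoint_biUnion_left, Finset.disjoint_biUnion_right]
  intro g' hg' g hg
  exact hA.pairwiseDisjoint π Set.univ (Set.mem_univ g) (Set.mem_univ g')
    fun heq => Finset.disjoint_left.1 h hg (heq ▸ hg')

lemma TilesWith.mul_image (hA : TilesWith A (H : Set G)) {B : Finset G} {C : Set G}
    (hB : TilesWith B C) :
    TilesWith (A * (B.image fun x => (π x : G))) ((fun x => (π x : G)) '' C) := by
  intro x
  obtain ⟨c, ⟨hc, a, ha, hx⟩, huniq⟩ := hA x
  set g := π.symm ⟨c, hc⟩ with hg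
  have hπg : (π g : G) = c := by simp [hg]
  obtain ⟨k, ⟨hk, b, hb, hgk⟩, huniq'⟩ := hB g
  refine ⟨π k, ⟨⟨k, hk, rfl⟩, a * π b, ?_, ?_⟩, ?_⟩
  · exact Finset.mul_mem_mul ha (Finset.mem_image_of_mem _ hb)
  · rw [hx, ← hπg, hgk]
    simp [mul_assoc]
  · rintro _ ⟨⟨k', hk', rfl⟩, z, hz, hxz⟩
    obtain ⟨a', ha', w, hw, rfl⟩ := Finset.mem_mul.1 hz
    obtain ⟨b', hb', rfl⟩ := Finset.mem_image.1 hw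
    have h1 : ((π (b' * k') : H) : G) = c :=
      huniq _ ⟨(π (b' * k')).2, a', ha', by simp [hxz, mul_assoc]⟩
    have h2 : b' * k' = g := π.injective (Subtype.ext (h1.trans hπg.symm))
    have h3 := huniq' k' ⟨hk', b', hb', h2.symm⟩
    simp only [h3]

variable {F : ℕ → Finset G}

lemma exists_approximating_indices [Infinite G] (hF : IsFolner F) {m : ℕ}
    (hA : TilesWith (F m) (H : Set G))
    (happrox : ∀ δ : ℝ, 0 < δ → ∀ᶠ p in atTop, ∃ n₁ n₂ : ℕ,
      F p ⊆ F m * ((F n₁).image fun x => (π x : G)) ∧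
      F m * ((F n₂).image fun x => (π x : G)) ⊆ F p ∧
      (((F n₁).card : ℝ) - ((F n₂).card : ℝ)) / ((F p).card : ℝ) < δ) :
    ∃ n₁ n₂ : ℕ → ℕ, Tendsto n₁ atTop atTop ∧ Tendsto n₂ atTop atTop ∧
      (∀ᶠ p in atTop, F p ⊆ F m * ((F (n₁ p)).image fun x => (π x : G)) ∧
        F m * ((F (n₂ p)).image fun x => (π x : G)) ⊆ F p) ∧
      Tendsto (fun p => ((F m).card * (F (n₁ p)).card : ℝ) / (F p).card) atTop (𝓝 1) ∧
      Tendsto (fun p => ((F m).card * (F (n₂ p)).card : ℝ) / (F p).card) atTop (𝓝 1) := by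
  have hpos : ∀ p, (0 : ℝ) < (F p).card := fun p => by exact_mod_cast (hF.1 p).card_pos
  have hch : ∀ p, ∃ a : ℕ × ℕ, ∀ b : ℕ × ℕ,
      (F p ⊆ F m * ((F b.1).image fun x => (π x : G)) ∧
        F m * ((F b.2).image fun x => (π x : G)) ⊆ F p) →
      (F p ⊆ F m * ((F a.1).image fun x => (π x : G)) ∧
        F m * ((F a.2).image fun x => (π x : G)) ⊆ F p) ∧
      ((F a.1).card - (F a.2).card : ℝ) ≤ (F b.1).card - (F b.2).card := by
    intro p
    set S : Set (ℕ × ℕ) := {b | F p ⊆ F m * ((F b.1).image fun x => (π x : G)) ∧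
        F m * ((F b.2).image fun x => (π x : G)) ⊆ F p} with hS
    by_cases hne : S.Nonempty
    · obtain ⟨a, ha, hmin⟩ := (measure fun b : ℕ × ℕ => (F b.1).card - (F b.2).card).wf.has_min
        S hne
      refine ⟨a, fun b hb => ⟨ha, ?_⟩⟩
      have h1 : (F a.1).card - (F a.2).card ≤ (F b.1).card - (F b.2).card :=
        not_lt.1 (hmin b hb)
      have h2 : (F b.2).card ≤ (F b.1).card := by
        have := Finset.card_le_card (hb.2.trans hb.1)
        rw [hA.card_mul_image, hA.card_mul_image] at this
        exact Nat.le_of_mul_le_mul_left this (hF.1 m).card_pos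
      have h3 : (F a.1).card + (F b.2).card ≤ (F b.1).card + (F a.2).card := by omega
      have h4 : ((F a.1).card + (F b.2).card : ℝ) ≤ (F b.1).card + (F a.2).card := by
        exact_mod_cast h3
      linarith
    · exact ⟨0, fun b hb => absurd ⟨b, hb⟩ hne⟩
  choose a ha using hch
  have hev : ∀ δ : ℝ, 0 < δ → ∀ᶠ p in atTop,
      (F p ⊆ F m * ((F (a p).1).image fun x => (π x : G)) ∧
        F m * ((F (a p).2).image fun x => (π x : G)) ⊆ F p) ∧
      ((F (a p).1).card - (F (a p).2).card : ℝ) / (F p).card < δ := by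
    intro δ hδ
    filter_upwards [happrox δ hδ] with p ⟨n₁, n₂, h1, h2, h3⟩
    obtain ⟨h4, h5⟩ := ha p (n₁, n₂) ⟨h1, h2⟩
    exact ⟨h4, lt_of_le_of_lt (by gcongr) h3⟩
  have hcard : ∀ᶠ p in atTop, ((F p).card : ℝ) ≤ (F m).card * (F (a p).1).card ∧
      ((F m).card * (F (a p).2).card : ℝ) ≤ (F p).card := by
    filter_upwards [hev 1 one_pos] with p hp
    have h1 := Finset.card_le_card hp.1.1
    have h2 := Finset.card_le_card hp.1.2
    rw [hA.card_mul_image] at h1 h2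
    exact_mod_cast And.intro h1 h2
  have hw1 : Tendsto (fun p => ((F m).card * (F (a p).1).card : ℝ) / (F p).card) atTop (𝓝 1) := by
    rw [tendsto_order]
    refine ⟨fun b hb => ?_, fun b hb => ?_⟩
    · filter_upwards [hcard] with p hp
      exact hb.trans_le ((one_le_div (hpos p)).2 hp.1)
    · filter_upwards [hcard, hev ((b - 1) / (F m).card)
        (div_pos (by linarith) (hpos m))] with p hp hp'
      have h1 := hp'.2
      rw [div_lt_div_iff₀ (hpos p) (hpos m)] at h1
      rw [div_lt_iff₀ (hpos p)]
      linarith [hp.2]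
  have hw2 : Tendsto (fun p => ((F m).card * (F (a p).2).card : ℝ) / (F p).card) atTop (𝓝 1) := by
    rw [tendsto_order]
    refine ⟨fun b hb => ?_, fun b hb => ?_⟩
    · filter_upwards [hcard, hev ((1 - b) / (F m).card)
        (div_pos (by linarith) (hpos m))] with p hp hp'
      have h1 := hp'.2
      rw [div_lt_div_iff₀ (hpos p) (hpos m)] at h1
      rw [lt_div_iff₀ (hpos p)]
      linarith [hp.1]
    · filter_upwards [hcard] with p hp
      exact lt_of_le_of_lt ((div_le_one (hpos p)).2 hp.2) hb
  have hlarge : ∀ n : ℕ → ℕ,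
      Tendsto (fun p => ((F m).card * (F (n p)).card : ℝ) / (F p).card) atTop (𝓝 1) →
      Tendsto n atTop atTop := by
    intro n hn
    refine tendsto_atTop_of_card (F := F) ?_
    have h1 := (hn.pos_mul_atTop one_pos
      (tendsto_natCast_atTop_atTop.comp hF.tendsto_card_atTop)).const_mul_atTop
      (inv_pos.2 (hpos m))
    refine (tendsto_natCast_atTop_iff (R := ℝ)).1 (h1.congr fun p => ?_)
    have := (hpos p).ne'
    have := (hpos m).ne'
    simp only [Function.comp]
    field_simp
  exact ⟨_, _, hlarge _ hw1, hlarge _ hw2, (hev 1 one_pos).mono fun p hp => hp.1, hw1, hw2⟩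

end Tiling

namespace IsSuperadditiveProcess

variable {G : Type*} [Group G] [DecidableEq G] {Y : Type*} [MeasurableSpace Y] {ν : Measure Y}
  {T : G → Y → Y} {s : Finset G → Y → ℝ}

lemma card_innerCore_mul_integral_le (hT : ∀ g, MeasurePreserving (T g) ν ν)
    (hs : IsSuperadditiveProcess ν T s) {A : Finset G} {C : Set G} (hA : TilesWith A C)
    (B : Finset G) : ((A * A⁻¹).innerCore B).card * ∫ y, s A y ∂ν ≤
      A.card * ∫ y, s B y ∂ν := by
  classical
  set D : Finset G := (A⁻¹ * B).filter fun c => c ∈ C ∧ ∀ t ∈ A, t * c ∈ B with hD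
  have hcover : (A * A⁻¹).innerCore B ⊆ D.biUnion fun c => A.image (· * c) := by
    intro x hx
    obtain ⟨hxB, hx'⟩ := Finset.mem_filter.1 hx
    obtain ⟨c, ⟨hc, a, ha, rfl⟩, -⟩ := hA x
    refine Finset.mem_biUnion.2 ⟨c, Finset.mem_filter.2 ⟨?_, hc, fun t ht => ?_⟩,
      Finset.mem_image.2 ⟨a, ha, rfl⟩⟩
    · exact Finset.mem_mul.2 ⟨a⁻¹, Finset.inv_mem_inv ha, a * c, hxB, by simp⟩
    · have := hx' (t * a⁻¹) (Finset.mul_mem_mul ht (Finset.inv_mem_inv ha))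
      simpa [mul_assoc] using this
  have hcard : ((A * A⁻¹).innerCore B).card ≤ D.card * A.card := by
    refine (Finset.card_le_card hcover).trans (Finset.card_biUnion_le.trans ?_)
    exact (Finset.sum_le_sum fun c _ => Finset.card_image_le).trans (by simp)
  have hint : D.card * ∫ y, s A y ∂ν ≤ ∫ y, s B y ∂ν := by
    rw [← integral_sum_comp hT D (hs.integrable A)]
    refine integral_mono_ae (integrable_sum_comp hT D (hs.integrable A)) (hs.integrable B) ?_
    filter_upwards [hs.nonneg, hs.invariant, hs.superadd] with y h0 hinv hadd
    simp only [← hinv]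
    refine (superadditive_biUnion_le h0 hadd D (fun c => A.image (· * c)) ?_).trans ?_
    · exact fun c hc c' hc' hne => hA.disjoint (Finset.mem_filter.1 hc).2.1
        (Finset.mem_filter.1 hc').2.1 hne
    · refine superadditive_mono (φ := fun E => s E y) h0 hadd ?_
      refine Finset.biUnion_subset.2 fun c hc x hx => ?_
      obtain ⟨a, ha, rfl⟩ := Finset.mem_image.1 hx
      exact (Finset.mem_filter.1 hc).2.2 a ha
  have h0 : 0 ≤ ∫ y, s A y ∂ν := integral_nonneg_of_ae (hs.nonneg.mono fun y hy => hy A)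
  calc (((A * A⁻¹).innerCore B).card : ℝ) * ∫ y, s A y ∂ν
      ≤ (D.card * A.card : ℝ) * ∫ y, s A y ∂ν := by
        gcongr
        exact_mod_cast hcard
    _ = A.card * (D.card * ∫ y, s A y ∂ν) := by ring
    _ ≤ A.card * ∫ y, s B y ∂ν := by gcongr

lemma eventually_lt_integral_div_card (hT : ∀ g, MeasurePreserving (T g) ν ν)
    (hs : IsSuperadditiveProcess ν T s) {F : ℕ → Finset G} (hF : IsFolner F) {A : Finset G}
    (hA : Tiles A) {b : ℝ} (hb : b < (∫ y, s A y ∂ν) / A.card) :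
    ∀ᶠ n in atTop, b < (∫ y, s (F n) y ∂ν) / (F n).card := by
  obtain ⟨hne, C, hC⟩ := hA
  have hApos : (0 : ℝ) < A.card := by exact_mod_cast hne.card_pos
  have hlim := (hF.tendsto_card_innerCore (A * A⁻¹)).mul_const ((∫ y, s A y ∂ν) / A.card)
  rw [one_mul] at hlim
  filter_upwards [hlim.eventually (lt_mem_nhds hb)] with n hn
  have hpos : (0 : ℝ) < (F n).card := by exact_mod_cast (hF.1 n).card_pos
  refine hn.trans_le ?_
  rw [div_mul_div_comm, div_le_div_iff₀ (by positivity) hpos]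
  nlinarith [hs.card_innerCore_mul_integral_le hT hC (F n)]

/-- The excess of a super-additive process over the additive process generated by a tile. -/
lemma induced (hT : ∀ g, MeasurePreserving (T g) ν ν)
    (hmul : ∀ g h y, T (g * h) y = T g (T h y)) (hs : IsSuperadditiveProcess ν T s)
    {A : Finset G} {H : Subgroup G} (π : G ≃* H) (hA : TilesWith A (H : Set G)) :
    IsSuperadditiveProcess ν (fun g => T (π g)) fun E y =>
      s (A * (E.image fun x => (π x : G))) y - ∑ g ∈ E, s A (T (π g) y) where
  integrable E := (hs.integrable _).sub
    (integrable_sum_comp (T := fun g => T (π g)) (fun g => hT _) E (hs.integrable A))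
  nonneg := by
    filter_upwards [hs.nonneg, hs.invariant, hs.superadd] with y h0 hinv hadd E
    rw [sub_nonneg, mul_image_eq_biUnion]
    simp only [← hinv]
    exact superadditive_biUnion_le h0 hadd E _ (hA.pairwiseDisjoint π _)
  invariant := by
    filter_upwards [hs.invariant] with y hinv E g
    rw [mul_image_mul_right, hinv, Finset.sum_image fun a _ b _ h => mul_left_injective g h]
    simp [hmul]
  superadd := by
    filter_upwards [hs.superadd] with y hadd E E' h
    rw [Finset.sum_union h, Finset.image_union, Finset.mul_union]
    linarith [hadd _ _ (hA.disjoint_mul_image π h)]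

/-- Convergence of normalised non-negative super-additive processes. -/
lemma isL1AeCauchy [Infinite G] [IsProbabilityMeasure ν] (hT : ∀ g, MeasurePreserving (T g) ν ν)
    (hone : ∀ y, T 1 y = y) (hmul : ∀ g h y, T (g * h) y = T g (T h y))
    (hs : IsSuperadditiveProcess ν T s) {F : ℕ → Finset G} (hF : IsFolner F)
    {H : ℕ → Subgroup G} (π : ∀ n, G ≃* H n) (htile : ∀ n, TilesWith (F n) (H n : Set G))
    {M : ℝ} (hM : 0 < M) (hTemp : TempelmanWith F M) {𝒩 : Set ℕ} (h𝒩 : 𝒩.Infinite)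
    (happrox : ∀ m ∈ 𝒩, ∀ δ : ℝ, 0 < δ → ∀ᶠ p in atTop, ∃ n₁ n₂ : ℕ,
      F p ⊆ F m * ((F n₁).image fun x => ((π m x : G))) ∧
      F m * ((F n₂).image fun x => ((π m x : G))) ⊆ F p ∧
      (((F n₁).card : ℝ) - ((F n₂).card : ℝ)) / ((F p).card : ℝ) < δ)
    {K : ℝ} (hK : ∀ A, Tiles A → (∫ y, s A y ∂ν) / A.card ≤ K) :
    IsL1AeCauchy ν fun n y => s (F n) y / (F n).card := by
  have hpos : ∀ p, (0 : ℝ) < (F p).card := fun p => by exact_mod_cast (hF.1 p).card_pos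
  set R : Set ℝ := (fun A : Finset G => (∫ y, s A y ∂ν) / A.card) '' {A | Tiles A} with hR
  set σ := sSup R with hσdef
  have hRne : R.Nonempty := ⟨_, F 0, ⟨hF.1 0, _, htile 0⟩, rfl⟩
  have hRb : BddAbove R := ⟨K, by rintro _ ⟨A, hA, rfl⟩; exact hK A hA⟩
  have hσ : ∀ A, Tiles A → (∫ y, s A y ∂ν) / A.card ≤ σ := fun A hA => le_csSup hRb ⟨A, hA, rfl⟩
  refine IsL1AeCauchy.of_approx (fun n => (hs.integrable _).div_const _) fun ε hε => ?_
  set e : ℝ := min (ε * ε / (2 * M)) (ε / 4) with he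
  have hepos : 0 < e := by positivity
  obtain ⟨m, hm𝒩, hmσ⟩ : ∃ m ∈ 𝒩, σ - e < (∫ y, s (F m) y ∂ν) / (F m).card := by
    obtain ⟨_, ⟨A, hA, rfl⟩, hAσ⟩ := exists_lt_of_lt_csSup hRne (sub_lt_self σ hepos)
    obtain ⟨m, hm1, hm2⟩ := ((Nat.frequently_atTop_iff_infinite.2 h𝒩).and_eventually
      (hs.eventually_lt_integral_div_card hT hF hA hAσ)).exists
    exact ⟨m, hm1, hm2⟩
  set I := (∫ y, s (F m) y ∂ν) / (F m).card with hI
  obtain ⟨n₁, n₂, hn1, hn2, hsub, hw1, hw2⟩ :=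
    exists_approximating_indices (π m) hF (htile m) (happrox m hm𝒩)
  set T' : G → Y → Y := fun g => T (π m g) with hT'def
  have hT' : ∀ g, MeasurePreserving (T' g) ν ν := fun g => hT _
  have hind := hs.induced hT hmul (π m) (htile m)
  set Z : ℕ → Y → ℝ := fun n y => ((F m).card : ℝ)⁻¹ * ergodicAverage T' (F n) (s (F m)) y with hZ
  have hZC : IsL1AeCauchy ν Z :=
    (isL1AeCauchy_ergodicAverage hT' (fun y => by simp [hT'def, hone])
      (fun g h y => by simp [hT'def, hmul]) hF hM hTemp (hs.integrable _)).const_mul _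
  have hZsum : ∀ n y, ∑ g ∈ F n, s (F m) (T (π m g) y) = (F m).card * (F n).card * Z n y := by
    intro n y
    have := (hpos m).ne'
    have := (hpos n).ne'
    simp only [hZ, ergodicAverage, hT'def]
    field_simp
  have hZint : ∀ n, ∫ y, Z n y ∂ν = I := by
    intro n
    have := (hpos m).ne'
    have := (hpos n).ne'
    simp only [hZ, ergodicAverage, hI]
    rw [integral_const_mul, integral_div, integral_sum_comp hT' _ (hs.integrable _)]
    field_simp
  have hlow : ∀ᵐ y ∂ν, ∀ p, F m * ((F (n₂ p)).image fun x => (π m x : G)) ⊆ F p →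
      ((F m).card * (F (n₂ p)).card : ℝ) / (F p).card * Z (n₂ p) y ≤
        s (F p) y / (F p).card := by
    filter_upwards [hind.nonneg, hs.nonneg, hs.superadd] with y hq h0 hadd p hp
    have h1 := hq (F (n₂ p))
    rw [hZsum] at h1
    have h2 := superadditive_mono (φ := fun E => s E y) h0 hadd hp
    rw [div_mul_eq_mul_div]
    gcongr
    linarith
  refine ⟨Z, hZC, ?_, ?_⟩
  · have hmax := hind.maximal_inequality hT' hF hM hTemp (a := ε / 2 * (F m).card)
      (c := e * (F m).card) (mul_pos (by positivity) (hpos m)) fun n => by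
        rw [integral_sub (hs.integrable _) (integrable_sum_comp hT' _ (hs.integrable _)),
          integral_sum_comp hT' _ (hs.integrable _)]
        have h1 := hσ _ ⟨(hF.1 m).mul ((hF.1 n).image _), _, (htile m).mul_image (π m) (htile n)⟩
        rw [(htile m).card_mul_image] at h1
        push_cast at h1
        rw [div_le_iff₀ (mul_pos (hpos m) (hpos n))] at h1
        have h2 := (lt_div_iff₀ (hpos m)).1 hmσ
        nlinarith [mul_lt_mul_of_pos_right h2 (hpos n)]
    have hle : M * (e * (F m).card) / (ε / 2 * (F m).card) ≤ ε := by
      have := (hpos m)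
      rw [div_le_iff₀ (by positivity)]
      have h1 : e * (2 * M) ≤ ε * ε := by
        rw [← le_div_iff₀ (by positivity)]
        exact min_le_left _ _
      nlinarith
    refine (measure_mono_ae ?_).trans (hmax.trans (ENNReal.ofReal_le_ofReal hle))
    filter_upwards [hlow, hZC.ae, hs.nonneg, hs.superadd] with y hlow hC h0 hadd hbad
    by_contra hcon
    have hcon' : ∀ n, s (F m * ((F n).image fun x => (π m x : G))) y ≤
        (F m).card * (F n).card * (ε / 2 + Z n y) := by
      intro n
      have h1 : ¬ (ε / 2 * (F m).card * (F n).card < _) := fun h => hcon ⟨n, h⟩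
      rw [not_lt, hZsum] at h1
      linarith
    obtain ⟨z, hz⟩ := cauchySeq_tendsto_of_complete hC
    have hup := (hw1.mul (tendsto_const_nhds (x := ε / 2) |>.add (hz.comp hn1))).sub hz
    have hdn := (hw2.mul (hz.comp hn2)).sub hz
    refine hbad ?_
    filter_upwards [hup.eventually (gt_mem_nhds (by linarith : 1 * (ε / 2 + z) - z < ε)),
      hdn.eventually (lt_mem_nhds (by linarith : -ε < 1 * z - z)), hsub] with p h1 h2 h3
    have h4 := hlow p h3.2
    have h5 : s (F p) y / (F p).card ≤
        ((F m).card * (F (n₁ p)).card : ℝ) / (F p).card * (ε / 2 + Z (n₁ p) y) := by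
      rw [div_mul_eq_mul_div]
      gcongr
      exact (superadditive_mono (φ := fun E => s E y) h0 hadd h3.1).trans (hcon' _)
    simp only [Function.comp] at h1 h2
    rw [abs_le]
    constructor <;> linarith
  · obtain ⟨N, hN⟩ := hZC.l1 (ε / 2) (by positivity)
    have hlim : Tendsto (fun p => σ - ((F m).card * (F (n₂ p)).card : ℝ) / (F p).card * I +
        |((F m).card * (F (n₂ p)).card : ℝ) / (F p).card - 1| * I) atTop
        (𝓝 (σ - 1 * I + |1 - 1| * I)) :=
      (tendsto_const_nhds.sub (hw2.mul_const I)).add ((hw2.sub_const 1).abs.mul_const I)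
    have he4 : e ≤ ε / 4 := min_le_right _ _
    filter_upwards [hlim.eventually (gt_mem_nhds
      (by simp; linarith : σ - 1 * I + |1 - 1| * I < ε / 2)), hsub, eventually_ge_atTop N,
      hn2.eventually_ge_atTop N] with p h1 h2 h3 h4
    set w := ((F m).card * (F (n₂ p)).card : ℝ) / (F p).card with hw
    have hXi : Integrable (fun y => s (F p) y / (F p).card) ν := (hs.integrable _).div_const _
    have i1 : Integrable (fun y => s (F p) y / (F p).card - w * Z (n₂ p) y) ν :=
      hXi.sub ((hZC.integrable _).const_mul _)
    have i2 : Integrable (fun y => |w - 1| * Z (n₂ p) y) ν := (hZC.integrable _).const_mul _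
    have i12 : Integrable (fun y => s (F p) y / (F p).card - w * Z (n₂ p) y +
      |w - 1| * Z (n₂ p) y) ν := i1.add i2
    have i3 : Integrable (fun y => |Z (n₂ p) y - Z p y|) ν :=
      ((hZC.integrable (n₂ p)).sub (hZC.integrable p)).abs
    have hXσ : ∫ y, s (F p) y / (F p).card ∂ν ≤ σ := by
      rw [integral_div]
      exact hσ _ ⟨hF.1 p, _, htile p⟩
    have e1 : ∫ y, w * Z (n₂ p) y ∂ν = w * I :=
      (integral_const_mul _ _).trans (by rw [hZint])
    have e2 : ∫ y, |w - 1| * Z (n₂ p) y ∂ν = |w - 1| * I :=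
      (integral_const_mul _ _).trans (by rw [hZint])
    calc ∫ y, |s (F p) y / (F p).card - Z p y| ∂ν
        ≤ ∫ y, (s (F p) y / (F p).card - w * Z (n₂ p) y + |w - 1| * Z (n₂ p) y +
            |Z (n₂ p) y - Z p y|) ∂ν := by
          refine integral_mono_of_nonneg (Eventually.of_forall fun y => abs_nonneg _)
            (i12.add i3) ?_
          have hnn : ∀ᵐ y ∂ν, ∀ g ∈ F (n₂ p), 0 ≤ s (F m) (T' g y) :=
            (Finset.eventually_all _).2 fun g _ => (hT' g).quasiMeasurePreserving.ae
              (hs.nonneg.mono fun y hy => hy (F m))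
          filter_upwards [hlow, hnn] with y hy hy'
          have hZ0 : 0 ≤ Z (n₂ p) y :=
            mul_nonneg (by positivity) (div_nonneg (Finset.sum_nonneg hy') (by positivity))
          have h5 := hy p h2.2
          have h6 := le_abs_self (w - 1)
          have h7 := neg_abs_le (w - 1)
          have h8 := le_abs_self (Z (n₂ p) y - Z p y)
          have h9 := neg_abs_le (Z (n₂ p) y - Z p y)
          rw [abs_le]
          constructor <;> nlinarith [mul_nonneg (sub_nonneg.2 h6) hZ0,
            mul_nonneg (sub_nonneg.2 h7) hZ0]
      _ = (∫ y, s (F p) y / (F p).card ∂ν - w * I + |w - 1| * I) +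
            ∫ y, |Z (n₂ p) y - Z p y| ∂ν := by
          rw [integral_add i12 i3, integral_add i1 i2,
            integral_sub hXi ((hZC.integrable _).const_mul _), e1, e2]
      _ ≤ ε := by linarith [hN _ h4 _ h3]

end IsSuperadditiveProcess

/-- Theorem 5.3(4) of the paper: under the hypotheses of the pointwise sub-additive ergodic
theorem, if additionally there exist `r_1 < r_2 < ⋯` in `𝒩` and `{t_n} ⊆ ℕ` with
`F_{r_{n+1}} = F_{r_n} π_{F_{r_n}}(F_{t_n})` for each `n`, then `d_{F_n}/|F_n|` converges in
`L¹(ν)` to the a.e. limit function `d`. -/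
theorem L1_convergence_subadditive_ergodic
    {G : Type*} [Group G] [Countable G] [Infinite G] [DecidableEq G]
    {Y : Type*} [MeasurableSpace Y] [MulAction G Y]
    (ν : Measure Y) [IsProbabilityMeasure ν]
    (hact : ∀ g : G, MeasurePreserving (fun y => g • y) ν ν)
    (d : Finset G → Y → ℝ)
    (hint : ∀ F : Finset G, F.Nonempty → Integrable (d F) ν)
    (hinv : ∀ F : Finset G, F.Nonempty → ∀ g : G,
      ∀ᵐ y ∂ν, d (F.image (· * g)) y = d F (g • y))
    (hsub : ∀ E F : Finset G, E.Nonempty → F.Nonempty → Disjoint E F →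
      ∀ᵐ y ∂ν, d (E ∪ F) y ≤ d E y + d F y)
    (hνD : ⊥ < ⨅ T ∈ {T : Finset G | Tiles T},
      (((T.card : ℝ)⁻¹ * ∫ y, d T y ∂ν : ℝ) : EReal))
    (F : ℕ → Finset G) (hF : IsFolner F)
    (H : ℕ → Subgroup G) (π : ∀ n, G ≃* H n)
    (htile : ∀ n, TilesWith (F n) ((H n : Set G)))
    (M : ℝ) (hM : 0 < M) (hTemp : TempelmanWith F M)
    (𝒩 : Set ℕ) (h𝒩 : 𝒩.Infinite)
    (happrox : ∀ m ∈ 𝒩, ∀ δ : ℝ, 0 < δ → ∀ᶠ p in atTop, ∃ n₁ n₂ : ℕ,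
      F p ⊆ F m * ((F n₁).image fun x => ((π m x : G))) ∧
      F m * ((F n₂).image fun x => ((π m x : G))) ⊆ F p ∧
      (((F n₁).card : ℝ) - ((F n₂).card : ℝ)) / ((F p).card : ℝ) < δ)
    (r : ℕ → ℕ) (hr : StrictMono r) (hr𝒩 : ∀ n, r n ∈ 𝒩) (t : ℕ → ℕ)
    (hrt : ∀ n, F (r (n + 1)) = F (r n) * ((F (t n)).image fun x => ((π (r n) x : G)))) :
    ∃ dlim : Y → ℝ, Integrable dlim ν ∧
      (∀ᵐ y ∂ν, Tendsto (fun n => d (F n) y / ((F n).card : ℝ)) atTop (𝓝 (dlim y))) ∧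
      Tendsto (fun n => ∫ y, |d (F n) y / ((F n).card : ℝ) - dlim y| ∂ν) atTop (𝓝 0) := by
  have hmul : ∀ (g h : G) (y : Y), (g * h) • y = g • h • y := fun g h y => mul_smul g h y
  have hsingle : ∀ᵐ y ∂ν, ∀ g : G, d {g} y = d {1} (g • y) := by
    filter_upwards [ae_all_iff.2 (hinv {1} (Finset.singleton_nonempty 1))] with y hy g
    simpa using hy g
  have hsub' : ∀ᵐ y ∂ν, ∀ E E' : Finset G, E.Nonempty → E'.Nonempty → Disjoint E E' →
      d (E ∪ E') y ≤ d E y + d E' y := by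
    simp only [ae_all_iff, Filter.eventually_imp_distrib_left]
    exact hsub
  have hinv' : ∀ᵐ y ∂ν, ∀ (E : Finset G) (g : G), E.Nonempty →
      d (E.image (· * g)) y = d E (g • y) := by
    simp only [ae_all_iff, Filter.eventually_imp_distrib_left]
    exact fun E g hE => hinv E hE g
  have hd1 := hint {1} (Finset.singleton_nonempty 1)
  set s : Finset G → Y → ℝ := fun E y =>
    if E.Nonempty then ∑ g ∈ E, d {1} (g • y) - d E y else 0 with hs
  have hs_ne : ∀ E : Finset G, E.Nonempty → s E = fun y => ∑ g ∈ E, d {1} (g • y) - d E y :=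
    fun E hE => by simp [hs, hE]
  have hs_empty : s ∅ = fun _ => 0 := by simp [hs]
  have hproc : IsSuperadditiveProcess ν (fun (g : G) (y : Y) => g • y) s := by
    refine ⟨fun E => ?_, ?_, ?_, ?_⟩
    · rcases E.eq_empty_or_nonempty with rfl | hE
      · rw [hs_empty]
        exact integrable_const 0
      · rw [hs_ne E hE]
        exact (integrable_sum_comp hact E hd1).sub (hint E hE)
    · filter_upwards [hsingle, hsub'] with y h1 h2 E
      rcases E.eq_empty_or_nonempty with rfl | hE
      · simp [hs_empty]
      · simp only [hs_ne E hE, sub_nonneg]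
        induction hE using Finset.Nonempty.cons_induction with
        | singleton a => simp [h1]
        | cons a E ha hE ih =>
          rw [Finset.sum_cons, Finset.cons_eq_insert, Finset.insert_eq, ← h1]
          refine (h2 _ _ (Finset.singleton_nonempty a) hE (by simpa using ha)).trans ?_
          linarith
    · filter_upwards [hinv'] with y h1 E g
      rcases E.eq_empty_or_nonempty with rfl | hE
      · simp [hs_empty]
      · simp only [hs_ne E hE, hs_ne _ (hE.image (· * g))]
        rw [h1 E g hE, Finset.sum_image fun a _ b _ h => mul_left_injective g h]
        simp only [hmul]
    · filter_upwards [hsub'] with y h2 E E' h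
      rcases E.eq_empty_or_nonempty with rfl | hE
      · simp [hs_empty]
      rcases E'.eq_empty_or_nonempty with rfl | hE'
      · simp [hs_empty]
      simp only [hs_ne E hE, hs_ne E' hE', hs_ne _ (hE.mono Finset.subset_union_left)]
      rw [Finset.sum_union h]
      linarith [h2 E E' hE hE' h]
  obtain ⟨c, -, hc⟩ := EReal.lt_iff_exists_real_btwn.1 hνD
  have hK : ∀ A, Tiles A → (∫ y, s A y ∂ν) / A.card ≤ ∫ y, d {1} y ∂ν - c := by
    intro A hA
    have hpos : (0 : ℝ) < A.card := by exact_mod_cast hA.1.card_pos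
    have h1 : c ≤ (A.card : ℝ)⁻¹ * ∫ y, d A y ∂ν := by
      exact_mod_cast hc.le.trans (iInf₂_le A hA)
    rw [hs_ne A hA.1, integral_sub (integrable_sum_comp hact A hd1) (hint A hA.1),
      integral_sum_comp hact A hd1, sub_div, mul_div_cancel_left₀ _ hpos.ne',
      div_eq_inv_mul (∫ y, d A y ∂ν)]
    linarith
  have hconv := hproc.isL1AeCauchy hact (fun y => one_smul G y) hmul hF π htile hM hTemp h𝒩
    happrox hK
  have hadd := isL1AeCauchy_ergodicAverage hact (fun y => one_smul G y) hmul hF hM hTemp hd1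
  refine ((hadd.add (hconv.const_mul (-1))).congr_ae fun n => ?_).exists_limit
  refine Eventually.of_forall fun y => ?_
  simp only [hs_ne _ (hF.1 n), ergodicAverage]
  ring
end

section
/- Let (Y, 𝒟, ν, G) be an MDS, let 𝐃 = {d_F : F ∈ 𝓕_G} ⊆ L¹(Y, 𝒟, ν) be a sub-additive G-invariant family with ν(𝐃) = −∞, and let {F_n : n ∈ ℕ} be a Følner sequence of G each of whose terms tiles G self-similarly (with tiling subgroups G_{F_n} and isomorphisms π_{F_n} : G → G_{F_n}), satisfying: (a) the Tempelman condition with some constant M > 0; (b) there is an infinite 𝒩 ⊆ ℕ such that for each m ∈ 𝒩 and each δ > 0, for all sufficiently large p there exist n_1, n_2 with F_m π_{F_m}(F_{n_1}) ⊇ F_p ⊇ F_m π_{F_m}(F_{n_2}) and (|F_{n_1}| − |F_{n_2}|)/|F_p| < δ. Then there exists a measurable function d : Y → [−∞, ∞) such that lim_{n→∞} d_{F_n}(y)/|F_n| = d(y) for ν-a.e. y ∈ Y and ∫_Y d dν = −∞; moreover, if 𝐃 is G-bi-invariant, or 𝐃 is strongly sub-additive, or for every N ∈ ℕ there exist p,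 m ∈ 𝒩 with p, m ≥ N and G_{F_m} G_{F_p} = G, then d is G-invariant. -/
open MeasureTheory Filter Topology
open scoped symmDiff Pointwise ENNReal

/-- The positive part of an extended real, as an extended non-negative real. -/
noncomputable def erealPosPart (x : EReal) : ℝ≥0∞ :=
  if x = ⊤ then ⊤ else ENNReal.ofReal x.toReal

/-- Integral of an `EReal`-valued function, with values in `EReal`. -/
noncomputable def erealIntegral {Y : Type*} [MeasurableSpace Y] (ν : Measure Y)
    (f : Y → EReal) : EReal :=
  ((∫⁻ y, erealPosPart (f y) ∂ν : ℝ≥0∞) : EReal)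
    - ((∫⁻ y, erealPosPart (-(f y)) ∂ν : ℝ≥0∞) : EReal)

namespace FolnerErgodic

section Combinatorics

variable {G : Type*} [Group G] [DecidableEq G]

/-- The `K`-interior of `E`: those `g ∈ E` with `K g ⊆ E`. -/
def interior (K E : Finset G) : Finset G := E.filter fun g => ∀ k ∈ K, k * g ∈ E

lemma mem_interior {K E : Finset G} {g : G} :
    g ∈ interior K E ↔ g ∈ E ∧ ∀ k ∈ K, k * g ∈ E := by
  simp [interior]

lemma interior_subset (K E : Finset G) : interior K E ⊆ E := Finset.filter_subset _ _

lemma card_sdiff_interior_le (K E : Finset G) :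
    (E \ interior K E).card ≤ ∑ k ∈ K, ((E.image (k * ·)) ∆ E).card := by
  classical
  have h1 : E \ interior K E ⊆ K.biUnion fun k => E.filter fun g => k * g ∉ E := by
    intro g hg
    simp only [Finset.mem_sdiff, mem_interior, not_and, not_forall] at hg
    obtain ⟨k, hk, hkg⟩ := hg.2 hg.1
    simp only [Finset.mem_biUnion, Finset.mem_filter]
    exact ⟨k, hk, hg.1, hkg⟩
  refine (Finset.card_le_card h1).trans (Finset.card_biUnion_le.trans ?_)
  refine Finset.sum_le_sum fun k _ => ?_
  refine Finset.card_le_card_of_injOn (k * ·) ?_ ?_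
  · intro g hg
    replace hg := Finset.mem_filter.1 (Finset.mem_coe.1 hg)
    simp only [Finset.mem_coe, Finset.mem_symmDiff, Finset.mem_image]
    exact Or.inl ⟨⟨g, hg.1, rfl⟩, hg.2⟩
  · intro a _ b _ h
    exact mul_left_cancel h

lemma tendsto_sdiff_interior {F : ℕ → Finset G} (hF : IsFolner F) (K : Finset G) :
    Tendsto (fun n => ((F n \ interior K (F n)).card : ℝ) / (F n).card) atTop (𝓝 0) := by
  have h : Tendsto (fun n => ∑ k ∈ K, ((((F n).image (k * ·)) ∆ (F n)).card : ℝ) / (F n).card)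
      atTop (𝓝 0) := by
    simpa using tendsto_finsetSum K fun k _ => hF.2 k
  refine squeeze_zero (fun n => by positivity) (fun n => ?_) h
  rw [← Finset.sum_div]
  gcongr
  exact_mod_cast card_sdiff_interior_le K (F n)

lemma card_pos' {F : ℕ → Finset G} (hF : IsFolner F) (n : ℕ) : (0 : ℝ) < (F n).card := by
  exact_mod_cast (hF.1 n).card_pos

lemma tendsto_interior {F : ℕ → Finset G} (hF : IsFolner F) (K : Finset G) :
    Tendsto (fun n => ((interior K (F n)).card : ℝ) / (F n).card) atTop (𝓝 1) := by
  have h := (tendsto_sdiff_interior hF K).const_sub 1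
  rw [sub_zero] at h
  refine h.congr fun n => ?_
  have h0 := card_pos' hF n
  have h1 := Finset.card_sdiff_add_card_eq_card (interior_subset K (F n))
  have h2 : ((F n \ interior K (F n)).card : ℝ) + (interior K (F n)).card = (F n).card := by
    exact_mod_cast h1
  field_simp
  linarith

lemma tendsto_card [Infinite G] {F : ℕ → Finset G} (hF : IsFolner F) :
    Tendsto (fun n => (F n).card) atTop atTop := by
  refine tendsto_atTop.2 fun b => ?_
  obtain ⟨S, hS⟩ := Infinite.exists_subset_card_eq G b
  have h := (tendsto_interior hF S).eventually (lt_mem_nhds (show (0 : ℝ) < 1 by norm_num))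
  filter_upwards [h] with n hn
  have : (interior S (F n)).Nonempty := by
    rw [Finset.nonempty_iff_ne_empty]
    intro h0
    simp [h0] at hn
  obtain ⟨g, hg⟩ := this
  rw [mem_interior] at hg
  rw [← hS, ← Finset.card_image_of_injective S (mul_left_injective g)]
  refine Finset.card_le_card fun x hx => ?_
  obtain ⟨k, hk, rfl⟩ := Finset.mem_image.1 hx
  exact hg.2 k hk

omit [Group G] [DecidableEq G] in
lemma tendsto_atTop_of_card {F : ℕ → Finset G} {k : ℕ → ℕ}
    (h : Tendsto (fun p => (F (k p)).card) atTop atTop) : Tendsto k atTop atTop := by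
  refine tendsto_atTop.2 fun b => ?_
  filter_upwards [h.eventually_gt_atTop (∑ i ∈ Finset.range b, (F i).card)] with p hp
  by_contra hlt
  have := Finset.single_le_sum (f := fun i => (F i).card) (fun i _ => Nat.zero_le _)
    (Finset.mem_range.2 (not_le.1 hlt))
  omega

/-- A Vitali-type covering lemma for right translates of a Tempelman sequence. -/
lemma exists_disjoint_cover {F : ℕ → Finset G} (hne : ∀ n, (F n).Nonempty) {M : ℝ}
    (hM : TempelmanWith F M) (k : G → ℕ) (A : Finset G) :
    ∃ B ⊆ A, (B : Set G).PairwiseDisjoint (fun b => (F (k b)).image (· * b)) ∧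
      (A.card : ℝ) ≤ M * ∑ b ∈ B, ((F (k b)).card : ℝ) := by
  classical
  induction hn : A.card using Nat.strong_induction_on generalizing A with
  | _ n ih =>
  rcases A.eq_empty_or_nonempty with rfl | hA
  · exact ⟨∅, by simp, by simp, by simp at hn; simp [← hn]⟩
  obtain ⟨a, ha, hmax⟩ := A.exists_max_image k hA
  set U := (Finset.range (k a + 1)).biUnion fun j => (F j)⁻¹ * F (k a) with hU
  set V := U.image (· * a) with hV
  have hVcard : (V.card : ℝ) ≤ M * (F (k a)).card := by
    refine le_trans ?_ (hM (k a))
    exact_mod_cast Finset.card_image_le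
  have haV : a ∈ V := by
    obtain ⟨f, hf⟩ := hne (k a)
    refine Finset.mem_image.2 ⟨1, ?_, by simp⟩
    refine Finset.mem_biUnion.2 ⟨k a, by simp, ?_⟩
    exact Finset.mem_mul.2 ⟨f⁻¹, Finset.inv_mem_inv hf, f, hf, by simp⟩
  have hlt : (A \ V).card < n := by
    rw [← hn]
    refine Finset.card_lt_card ⟨Finset.sdiff_subset, fun h => ?_⟩
    exact (Finset.mem_sdiff.1 (h ha)).2 haV
  obtain ⟨B, hB, hdis, hcard⟩ := ih _ hlt (A \ V) rfl
  have haB : a ∉ B := fun h => (Finset.mem_sdiff.1 (hB h)).2 haV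
  refine ⟨insert a B, ?_, ?_, ?_⟩
  · exact Finset.insert_subset ha (hB.trans Finset.sdiff_subset)
  · rw [Finset.coe_insert]
    refine hdis.insert fun b hb _ => ?_
    rw [Finset.disjoint_left]
    intro x hx hx'
    obtain ⟨f, hf, rfl⟩ := Finset.mem_image.1 hx
    obtain ⟨f', hf', he⟩ := Finset.mem_image.1 hx'
    have hb' := Finset.mem_sdiff.1 (hB hb)
    refine hb'.2 (Finset.mem_image.2 ⟨f'⁻¹ * f, ?_, ?_⟩)
    · refine Finset.mem_biUnion.2 ⟨k b, ?_, ?_⟩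
      · exact Finset.mem_range.2 (Nat.lt_succ_of_le (hmax b hb'.1))
      · exact Finset.mul_mem_mul (Finset.inv_mem_inv hf') hf
    · rw [mul_assoc, ← he, inv_mul_cancel_left]
  · rw [Finset.sum_insert haB, mul_add]
    have h1 : A.card ≤ V.card + (A \ V).card := by
      have := Finset.card_le_card_sdiff_add_card (s := A) (t := V)
      omega
    have h2 : (A.card : ℝ) ≤ V.card + (A \ V).card := by exact_mod_cast h1
    rw [← hn]
    linarith

/-- A tile multiplied by an embedded image of a tile is again a tile. -/
lemma _root_.TilesWith.mul_image_s17 {K E : Finset G} {φ : G →* G} (hφ : Function.Injective φ)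
    (hK : TilesWith K (Set.range φ)) {C : Set G} (hE : TilesWith E C) :
    TilesWith (K * E.image φ) (φ '' C) := by
  intro x
  obtain ⟨c, ⟨⟨e, rfl⟩, t, ht, hx⟩, huniq⟩ := hK x
  obtain ⟨c', ⟨hc', t', ht', he⟩, huniq'⟩ := hE e
  refine ⟨φ c', ⟨⟨c', hc', rfl⟩, t * φ t', ?_, ?_⟩, ?_⟩
  · exact Finset.mul_mem_mul ht (Finset.mem_image_of_mem _ ht')
  · rw [hx, he, map_mul, mul_assoc]
  · rintro z ⟨⟨c₂, hc₂, rfl⟩, q, hq, hxq⟩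
    obtain ⟨t₂, ht₂, u, hu, rfl⟩ := Finset.mem_mul.1 hq
    obtain ⟨s, hs, rfl⟩ := Finset.mem_image.1 hu
    have h1 : φ (s * c₂) = φ e :=
      huniq _ ⟨⟨_, rfl⟩, t₂, ht₂, by rw [hxq, map_mul, mul_assoc]⟩
    rw [huniq' c₂ ⟨hc₂, s, hs, (hφ h1).symm⟩]

omit [DecidableEq G] in
/-- In a tiling, distinct translates are disjoint. -/
lemma _root_.TilesWith.eq_of_mul_eq {T : Finset G} {C : Set G} (h : TilesWith T C) {t t' c c' : G}
    (ht : t ∈ T) (ht' : t' ∈ T) (hc : c ∈ C) (hc' : c' ∈ C) (e : t * c = t' * c') : c = c' :=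
  (h (t * c)).unique ⟨hc, t, ht, rfl⟩ ⟨hc', t', ht', e⟩

lemma _root_.TilesWith.card_mul {K E : Finset G} {φ : G →* G} (hφ : Function.Injective φ)
    (hK : TilesWith K (Set.range φ)) : (K * E.image φ).card = K.card * E.card := by
  have : (K * E.image φ).card = K.card * (E.image φ).card := by
    rw [Finset.card_mul_iff]
    rintro ⟨a, b⟩ hab ⟨a', b'⟩ hab' h
    simp only [Set.mem_prod, Finset.mem_coe, Finset.mem_image] at hab hab'
    obtain ⟨ha, e, he, rfl⟩ := hab
    obtain ⟨ha', e', he', rfl⟩ := hab'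
    simp only at h
    have := hK.eq_of_mul_eq ha ha' ⟨e, rfl⟩ ⟨e', rfl⟩ h
    rw [this] at h ⊢
    rw [mul_right_cancel h]
  rw [this, Finset.card_image_of_injective _ hφ]

/-- The translates of a tile contained in a large set almost fill it. -/
lemma _root_.TilesWith.exists_centers {T : Finset G} {C : Set G} (h : TilesWith T C) (E : Finset G) :
    ∃ D : Finset G, ↑D ⊆ C ∧ (D : Set G).PairwiseDisjoint (fun c => T.image (· * c)) ∧
      (∀ c ∈ D, T.image (· * c) ⊆ E) ∧
      (interior (T * T⁻¹) E).card ≤ T.card * D.card := by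
  classical
  set D := (T⁻¹ * E).filter fun c => c ∈ C ∧ T.image (· * c) ⊆ E with hD
  have hDC : ↑D ⊆ C := fun c hc => (Finset.mem_filter.1 hc).2.1
  refine ⟨D, hDC, ?_, fun c hc => (Finset.mem_filter.1 hc).2.2, ?_⟩
  · intro c hc c' hc' hne
    refine Finset.disjoint_left.2 fun x hx hx' => hne ?_
    obtain ⟨t, ht, rfl⟩ := Finset.mem_image.1 hx
    obtain ⟨t', ht', he⟩ := Finset.mem_image.1 hx'
    exact h.eq_of_mul_eq ht ht' (hDC hc) (hDC hc') he.symm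
  · refine (Finset.card_le_card ?_).trans Finset.card_mul_le
    intro x hx
    rw [mem_interior] at hx
    obtain ⟨c, ⟨hc, t, ht, rfl⟩, -⟩ := h x
    refine Finset.mul_mem_mul ht (Finset.mem_filter.2 ⟨?_, hc, ?_⟩)
    · exact Finset.mem_mul.2 ⟨t⁻¹, Finset.inv_mem_inv ht, _, hx.1, by simp⟩
    · intro z hz
      obtain ⟨t', ht', rfl⟩ := Finset.mem_image.1 hz
      have := hx.2 (t' * t⁻¹) (Finset.mul_mem_mul ht' (Finset.inv_mem_inv ht))
      simpa [mul_assoc] using this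

/-- Sequences of inner and outer approximations extracted from the approximation hypothesis. -/
lemma exists_approx_seq [Infinite G] {F : ℕ → Finset G} (hF : IsFolner F) {K : Finset G}
    (hK0 : K.Nonempty) {φ : G →* G} (hφ : Function.Injective φ)
    (hK : TilesWith K (Set.range φ))
    (h : ∀ δ : ℝ, 0 < δ → ∀ᶠ p in atTop, ∃ n₁ n₂ : ℕ, F p ⊆ K * (F n₁).image φ ∧
      K * (F n₂).image φ ⊆ F p ∧
      (((F n₁).card : ℝ) - ((F n₂).card : ℝ)) / ((F p).card : ℝ) < δ) :
    ∃ k₁ k₂ : ℕ → ℕ,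
      (∀ᶠ p in atTop, F p ⊆ K * (F (k₁ p)).image φ ∧ K * (F (k₂ p)).image φ ⊆ F p) ∧
      Tendsto (fun p => ((F (k₁ p)).card : ℝ) / (F p).card) atTop (𝓝 (K.card : ℝ)⁻¹) ∧
      Tendsto (fun p => ((F (k₂ p)).card : ℝ) / (F p).card) atTop (𝓝 (K.card : ℝ)⁻¹) ∧
      Tendsto k₁ atTop atTop ∧ Tendsto k₂ atTop atTop := by
  have hKpos : (0 : ℝ) < K.card := by exact_mod_cast hK0.card_pos
  have hmin : ∀ p, ∃ q : ℕ × ℕ,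
      (∃ q' : ℕ × ℕ, F p ⊆ K * (F q'.1).image φ ∧ K * (F q'.2).image φ ⊆ F p) →
      (F p ⊆ K * (F q.1).image φ ∧ K * (F q.2).image φ ⊆ F p) ∧
      ∀ q' : ℕ × ℕ, F p ⊆ K * (F q'.1).image φ → K * (F q'.2).image φ ⊆ F p →
        (F q.1).card + (F q'.2).card ≤ (F q'.1).card + (F q.2).card := by
    intro p
    by_cases hex : ∃ q' : ℕ × ℕ, F p ⊆ K * (F q'.1).image φ ∧ K * (F q'.2).image φ ⊆ F p
    · set S := {q : ℕ × ℕ | F p ⊆ K * (F q.1).image φ ∧ K * (F q.2).image φ ⊆ F p} with hS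
      have hwf := (measure fun q : ℕ × ℕ => (F q.1).card - (F q.2).card).wf
      refine ⟨hwf.min S hex, fun _ => ⟨hwf.min_mem S hex, fun q' h1 h2 => ?_⟩⟩
      have hm := hwf.not_lt_min S (x := q') ⟨h1, h2⟩
      have hmem := hwf.min_mem S hex
      have hle : ∀ q ∈ S, (F q.2).card ≤ (F q.1).card := by
        intro q hq
        have := Finset.card_le_card (hq.2.trans hq.1)
        rw [hK.card_mul hφ, hK.card_mul hφ] at this
        exact Nat.le_of_mul_le_mul_left this hK0.card_pos
      have e1 := hle _ hmem
      have e2 := hle q' ⟨h1, h2⟩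
      have hm' : ¬ ((F q'.1).card - (F q'.2).card <
        (F (hwf.min S hex).1).card - (F (hwf.min S hex).2).card) := hm
      omega
    · exact ⟨(0, 0), fun h => absurd h hex⟩
  choose q hq using hmin
  have hex : ∀ᶠ p in atTop, ∃ q' : ℕ × ℕ,
      F p ⊆ K * (F q'.1).image φ ∧ K * (F q'.2).image φ ⊆ F p := by
    filter_upwards [h 1 one_pos] with p ⟨n₁, n₂, h1, h2, _⟩
    exact ⟨(n₁, n₂), h1, h2⟩
  have hinc : ∀ᶠ p in atTop, F p ⊆ K * (F (q p).1).image φ ∧ K * (F (q p).2).image φ ⊆ F p := by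
    filter_upwards [hex] with p hp using (hq p hp).1
  have hb1 : ∀ᶠ p in atTop, (K.card : ℝ)⁻¹ ≤ ((F (q p).1).card : ℝ) / (F p).card := by
    filter_upwards [hinc] with p hp
    have := Finset.card_le_card hp.1
    rw [hK.card_mul hφ] at this
    have h0 := card_pos' hF p
    have : ((F p).card : ℝ) ≤ K.card * (F (q p).1).card := by exact_mod_cast this
    rw [le_div_iff₀ h0, inv_mul_le_iff₀ hKpos]
    exact this
  have hb2 : ∀ᶠ p in atTop, ((F (q p).2).card : ℝ) / (F p).card ≤ (K.card : ℝ)⁻¹ := by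
    filter_upwards [hinc] with p hp
    have := Finset.card_le_card hp.2
    rw [hK.card_mul hφ] at this
    have h0 := card_pos' hF p
    have : (K.card * (F (q p).2).card : ℝ) ≤ (F p).card := by exact_mod_cast this
    rw [div_le_iff₀ h0, le_inv_mul_iff₀ hKpos]
    exact this
  have hdiff : ∀ δ : ℝ, 0 < δ → ∀ᶠ p in atTop,
      ((F (q p).1).card : ℝ) / (F p).card - ((F (q p).2).card : ℝ) / (F p).card < δ := by
    intro δ hδ
    filter_upwards [h δ hδ, hex] with p ⟨n₁, n₂, h1, h2, h3⟩ hp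
    have h4 := (hq p hp).2 (n₁, n₂) h1 h2
    have h0 := card_pos' hF p
    rw [← sub_div]
    refine lt_of_le_of_lt ?_ h3
    have : ((F (q p).1).card : ℝ) + (F n₂).card ≤ (F n₁).card + (F (q p).2).card := by
      exact_mod_cast h4
    exact div_le_div_of_nonneg_right (by linarith) h0.le
  have t1 : Tendsto (fun p => ((F (q p).1).card : ℝ) / (F p).card) atTop
      (𝓝 (K.card : ℝ)⁻¹) := by
    rw [Metric.tendsto_atTop']
    intro ε hε
    obtain ⟨N, hN⟩ := (hb1.and (hb2.and (hdiff ε hε))).exists_forall_of_atTop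
    refine ⟨N, fun p hp => ?_⟩
    obtain ⟨a, b, c⟩ := hN p hp.le
    rw [Real.dist_eq, abs_lt]
    constructor <;> linarith
  have t2 : Tendsto (fun p => ((F (q p).2).card : ℝ) / (F p).card) atTop
      (𝓝 (K.card : ℝ)⁻¹) := by
    rw [Metric.tendsto_atTop']
    intro ε hε
    obtain ⟨N, hN⟩ := (hb1.and (hb2.and (hdiff ε hε))).exists_forall_of_atTop
    refine ⟨N, fun p hp => ?_⟩
    obtain ⟨a, b, c⟩ := hN p hp.le
    rw [Real.dist_eq, abs_lt]
    constructor <;> linarith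
  have key : ∀ k : ℕ → ℕ, Tendsto (fun p => ((F (k p)).card : ℝ) / (F p).card) atTop
      (𝓝 (K.card : ℝ)⁻¹) → Tendsto k atTop atTop := by
    intro k hk
    have hc : Tendsto (fun p => ((F p).card : ℝ)) atTop atTop :=
      tendsto_natCast_atTop_atTop.comp (tendsto_card hF)
    have := hk.pos_mul_atTop (inv_pos.2 hKpos) hc
    refine tendsto_atTop_of_card (F := F) ?_
    rw [← tendsto_natCast_atTop_iff (R := ℝ)]
    refine this.congr fun p => ?_
    have h0 := card_pos' hF p
    field_simp
  exact ⟨fun p => (q p).1, fun p => (q p).2, hinc, t1, t2, key _ t1, key _ t2⟩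

end Combinatorics

section Families

variable {G : Type*} [Group G] {Y : Type*} [MeasurableSpace Y]

/-- A measure preserving action of `G`, given as a family of maps. -/
structure MPAction (ν : Measure Y) (T : G → Y → Y) : Prop where
  mp : ∀ g, MeasurePreserving (T g) ν ν
  one : ∀ y, T 1 y = y
  mul : ∀ g h y, T (g * h) y = T g (T h y)

lemma MPAction.comp {ν : Measure Y} {T : G → Y → Y} (hT : MPAction ν T) (φ : G →* G) :
    MPAction ν fun g => T (φ g) where
  mp g := hT.mp _
  one y := by simp [hT.one]
  mul g h y := by simp [hT.mul]

lemma integrable_comp {ν : Measure Y} {T : G → Y → Y} (hT : MPAction ν T) {f : Y → ℝ}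
    (hf : Integrable f ν) (g : G) : Integrable (fun y => f (T g y)) ν :=
  (hT.mp g).integrable_comp_of_integrable hf

lemma integral_comp {ν : Measure Y} {T : G → Y → Y} (hT : MPAction ν T) {f : Y → ℝ}
    (hf : AEStronglyMeasurable f ν) (g : G) : ∫ y, f (T g y) ∂ν = ∫ y, f y ∂ν := by
  have h := hT.mp g
  have h2 := integral_map (φ := T g) (μ := ν) h.measurable.aemeasurable (f := f)
    (by rw [h.map_eq]; exact hf)
  rw [h.map_eq] at h2
  exact h2.symm

lemma ae_all_translates [Countable G] {ν : Measure Y} {T : G → Y → Y} (hT : MPAction ν T)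
    {P : Y → Prop} (h : ∀ᵐ y ∂ν, P y) : ∀ᵐ y ∂ν, ∀ g, P (T g y) :=
  ae_all_iff.2 fun g => (hT.mp g).quasiMeasurePreserving.ae h

variable [DecidableEq G]

/-- At the point `y`, the family `s` is non-negative, super-additive and equivariant. -/
structure SuperAt (T : G → Y → Y) (s : Finset G → Y → ℝ) (y : Y) : Prop where
  nonneg : ∀ E, 0 ≤ s E y
  super : ∀ E E', Disjoint E E' → s E y + s E' y ≤ s (E ∪ E') y
  equivariant : ∀ E g, s (E.image (· * g)) y = s E (T g y)

/-- A non-negative integrable equivariant super-additive family. -/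
structure SuperFamily (ν : Measure Y) (T : G → Y → Y) (s : Finset G → Y → ℝ) : Prop where
  integrable : ∀ E, Integrable (s E) ν
  superAt : ∀ᵐ y ∂ν, SuperAt T s y

namespace SuperAt

variable {T : G → Y → Y} {s : Finset G → Y → ℝ} {y : Y}

omit [MeasurableSpace Y] in
lemma mono (h : SuperAt T s y) {E E' : Finset G} (hE : E ⊆ E') : s E y ≤ s E' y := by
  have h1 := h.super E (E' \ E) Finset.disjoint_sdiff
  rw [Finset.union_sdiff_of_subset hE] at h1
  linarith [h.nonneg (E' \ E)]

omit [MeasurableSpace Y] in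
lemma sum_le (h : SuperAt T s y) {ι : Type*} (I : Finset ι) (e : ι → Finset G) (E : Finset G)
    (hd : (I : Set ι).PairwiseDisjoint e) (hE : ∀ i ∈ I, e i ⊆ E) :
    ∑ i ∈ I, s (e i) y ≤ s E y := by
  classical
  refine le_trans ?_ (h.mono (Finset.biUnion_subset.2 hE))
  clear hE
  induction I using Finset.induction_on with
  | empty => simpa using h.nonneg ∅
  | insert a I ha ih =>
    rw [Finset.coe_insert, Set.pairwiseDisjoint_insert] at hd
    rw [Finset.sum_insert ha, Finset.biUnion_insert]
    have hdis : Disjoint (e a) (I.biUnion e) := by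
      rw [Finset.disjoint_biUnion_right]
      intro i hi
      exact hd.2 i hi fun h => ha (h ▸ hi)
    linarith [h.super _ _ hdis, ih hd.1]

omit [MeasurableSpace Y] in
lemma sum_le_of_tile (h : SuperAt T s y) {E A : Finset G} {K : Finset G}
    (hd : (A : Set G).PairwiseDisjoint fun c => K.image (· * c))
    (hA : ∀ c ∈ A, K.image (· * c) ⊆ E) : ∑ c ∈ A, s K (T c y) ≤ s E y := by
  simp only [← h.equivariant]
  exact h.sum_le A _ E hd hA

end SuperAt

/-- Truncation of a family at level `L` per element. -/
noncomputable def trunc (L : ℝ) (s : Finset G → Y → ℝ) (E : Finset G) (y : Y) : ℝ :=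
  min (s E y) (L * E.card)

omit [Group G] [MeasurableSpace Y] [DecidableEq G] in
lemma trunc_le (L : ℝ) (s : Finset G → Y → ℝ) (E : Finset G) (y : Y) :
    trunc L s E y ≤ L * E.card := min_le_right _ _

omit [MeasurableSpace Y] in
lemma SuperAt.trunc {T : G → Y → Y} {s : Finset G → Y → ℝ} {y : Y} (h : SuperAt T s y) {L : ℝ}
    (hL : 0 ≤ L) : SuperAt T (trunc L s) y where
  nonneg E := le_min (h.nonneg E) (by positivity)
  super E E' hd := by
    refine le_min ?_ ?_
    · refine le_trans ?_ (h.super E E' hd)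
      exact add_le_add (min_le_left _ _) (min_le_left _ _)
    · rw [Finset.card_union_of_disjoint hd]
      push_cast
      rw [mul_add]
      exact add_le_add (min_le_right _ _) (min_le_right _ _)
  equivariant E g := by
    simp only [FolnerErgodic.trunc]
    rw [h.equivariant, Finset.card_image_of_injective _ (mul_left_injective g)]

lemma SuperFamily.trunc {ν : Measure Y} [IsFiniteMeasure ν] {T : G → Y → Y}
    {s : Finset G → Y → ℝ} (h : SuperFamily ν T s) {L : ℝ} (hL : 0 ≤ L) :
    SuperFamily ν T (trunc L s) where
  integrable E := (h.integrable E).inf (integrable_const _)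
  superAt := h.superAt.mono fun _ hy => hy.trunc hL

/-- The defect of super-additivity of `s` along translates of the tile `K`. -/
noncomputable def defect (T : G → Y → Y) (s : Finset G → Y → ℝ) (K : Finset G) (φ : G →* G)
    (E : Finset G) (y : Y) : ℝ :=
  s (K * E.image φ) y - ∑ h ∈ E, s K (T (φ h) y)

lemma _root_.TilesWith.pairwiseDisjoint_s17 {K : Finset G} {φ : G →* G}
    (hK : TilesWith K (Set.range φ)) (E : Finset G) :
    ((E.image φ : Finset G) : Set G).PairwiseDisjoint fun c => K.image (· * c) := by
  intro c hc c' hc' hne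
  refine Finset.disjoint_left.2 fun x hx hx' => hne ?_
  obtain ⟨t, ht, rfl⟩ := Finset.mem_image.1 hx
  obtain ⟨t', ht', he⟩ := Finset.mem_image.1 hx'
  obtain ⟨e, -, rfl⟩ := Finset.mem_image.1 (Finset.mem_coe.1 hc)
  obtain ⟨e', -, rfl⟩ := Finset.mem_image.1 (Finset.mem_coe.1 hc')
  exact hK.eq_of_mul_eq ht ht' ⟨e, rfl⟩ ⟨e', rfl⟩ he.symm

lemma image_mul_subset_mul {K E : Finset G} {c : G} (hc : c ∈ E) :
    K.image (· * c) ⊆ K * E := by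
  intro x hx
  obtain ⟨t, ht, rfl⟩ := Finset.mem_image.1 hx
  exact Finset.mul_mem_mul ht hc

omit [MeasurableSpace Y] in
lemma SuperAt.sum_tile_le {T : G → Y → Y} {s : Finset G → Y → ℝ} {y : Y} (h : SuperAt T s y)
    {K : Finset G} {φ : G →* G} (hφ : Function.Injective φ) (hK : TilesWith K (Set.range φ))
    (E : Finset G) : ∑ g ∈ E, s K (T (φ g) y) ≤ s (K * E.image φ) y := by
  rw [← Finset.sum_image (f := fun c => s K (T c y)) fun a _ b _ hab => hφ hab]
  exact h.sum_le_of_tile (hK.pairwiseDisjoint_s17 E) fun c hc => image_mul_subset_mul hc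

lemma SuperAt.defect {ν : Measure Y} {T : G → Y → Y} (hT : MPAction ν T)
    {s : Finset G → Y → ℝ} {y : Y} (h : SuperAt T s y)
    {K : Finset G} {φ : G →* G} (hφ : Function.Injective φ) (hK : TilesWith K (Set.range φ)) :
    SuperAt (fun g => T (φ g)) (defect T s K φ) y where
  nonneg E := sub_nonneg.2 (h.sum_tile_le hφ hK E)
  super E E' hd := by
    have hdis : Disjoint (K * E.image φ) (K * E'.image φ) := by
      refine Finset.disjoint_left.2 fun x hx hx' => ?_
      obtain ⟨t, ht, u, hu, rfl⟩ := Finset.mem_mul.1 hx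
      obtain ⟨t', ht', u', hu', he⟩ := Finset.mem_mul.1 hx'
      obtain ⟨e, hee, rfl⟩ := Finset.mem_image.1 hu
      obtain ⟨e', hee', rfl⟩ := Finset.mem_image.1 hu'
      have := hφ (hK.eq_of_mul_eq ht ht' ⟨e, rfl⟩ ⟨e', rfl⟩ he.symm)
      exact Finset.disjoint_left.1 hd hee (this ▸ hee')
    have h1 := h.super _ _ hdis
    simp only [FolnerErgodic.defect]
    rw [Finset.sum_union hd, Finset.image_union, Finset.mul_union]
    linarith
  equivariant E g := by
    simp only [FolnerErgodic.defect]
    rw [← h.equivariant, Finset.sum_image (f := fun x => s K (T (φ x) y))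
      fun a _ b _ hab => mul_right_cancel hab]
    congr 2
    · ext x
      simp only [Finset.mem_mul, Finset.mem_image]
      constructor
      · rintro ⟨k, hk, _, ⟨_, ⟨e, he, rfl⟩, rfl⟩, rfl⟩
        exact ⟨k * φ e, ⟨k, hk, _, ⟨e, he, rfl⟩, rfl⟩, by simp [mul_assoc]⟩
      · rintro ⟨_, ⟨k, hk, _, ⟨e, he, rfl⟩, rfl⟩, rfl⟩
        exact ⟨k, hk, _, ⟨_, ⟨e, he, rfl⟩, rfl⟩, by simp [mul_assoc]⟩
    · funext x
      rw [map_mul, hT.mul]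

lemma SuperFamily.defect {ν : Measure Y} {T : G → Y → Y} (hT : MPAction ν T)
    {s : Finset G → Y → ℝ} (h : SuperFamily ν T s)
    {K : Finset G} {φ : G →* G} (hφ : Function.Injective φ) (hK : TilesWith K (Set.range φ)) :
    SuperFamily ν (fun g => T (φ g)) (defect T s K φ) where
  integrable _ := (h.integrable _).sub
    (integrable_finsetSum _ fun _ _ => integrable_comp hT (h.integrable K) _)
  superAt := h.superAt.mono fun _ hy => hy.defect hT hφ hK

lemma integral_defect {ν : Measure Y} {T : G → Y → Y} (hT : MPAction ν T)
    {s : Finset G → Y → ℝ} (h : SuperFamily ν T s) (K : Finset G) (φ : G →* G) (E : Finset G) :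
    ∫ y, defect T s K φ E y ∂ν = ∫ y, s (K * E.image φ) y ∂ν - E.card * ∫ y, s K y ∂ν := by
  unfold FolnerErgodic.defect
  rw [integral_sub (h.integrable _)
    (integrable_finsetSum _ fun g _ => integrable_comp hT (h.integrable K) _),
    integral_finsetSum _ fun g _ => integrable_comp hT (h.integrable K) _]
  congr 1
  rw [Finset.sum_congr rfl fun g _ => integral_comp hT (h.integrable K).aestronglyMeasurable _]
  simp

/-- The maximal inequality for super-additive families along a Tempelman Følner sequence. -/
theorem maximal_inequality {ν : Measure Y} [IsProbabilityMeasure ν]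
    {T : G → Y → Y} (hT : MPAction ν T) {s : Finset G → Y → ℝ} (h : SuperFamily ν T s)
    {F : ℕ → Finset G} (hF : IsFolner F) {M : ℝ} (hM : 0 < M) (hTemp : TempelmanWith F M)
    {γ : ℝ} (hγ : ∀ n, ∫ y, s (F n) y ∂ν ≤ γ * (F n).card) {c : ℝ} (hc : 0 < c) :
    ν.real {y | ∃ k, c * (F k).card < s (F k) y} ≤ M * γ / c := by
  classical
  set B : ℕ → Set Y := fun N => {y | ∃ k ≤ N, c * (F k).card < s (F k) y} with hB
  have hBN : ∀ N, ν.real (B N) ≤ M * γ / c := by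
    intro N
    have hBmeas : NullMeasurableSet (B N) ν := by
      have : B N = ⋃ k ∈ Set.Iic N, {y | c * (F k).card < s (F k) y} := by
        ext y; simp [hB]
      rw [this]
      refine NullMeasurableSet.biUnion (Set.to_countable _) fun k _ => ?_
      exact nullMeasurableSet_lt aemeasurable_const (h.integrable _).aestronglyMeasurable.aemeasurable
    set K := (Finset.range (N + 1)).biUnion F with hK
    have hKle : ∀ k ≤ N, F k ⊆ K := fun k hk =>
      Finset.subset_biUnion_of_mem F (Finset.mem_range.2 (Nat.lt_succ_of_le hk))
    have hpt : ∀ n, ∀ᵐ y ∂ν, ∑ g ∈ interior K (F n),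
        c / M * (B N).indicator (fun _ => (1 : ℝ)) (T g y) ≤ s (F n) y := by
      intro n
      filter_upwards [h.superAt] with y hy
      set A := (interior K (F n)).filter fun g => T g y ∈ B N with hA
      have hk : ∀ g, ∃ k, g ∈ A → k ≤ N ∧ c * (F k).card < s (F k) (T g y) := by
        intro g
        by_cases hg : g ∈ A
        · obtain ⟨k, hk⟩ := (Finset.mem_filter.1 hg).2
          exact ⟨k, fun _ => hk⟩
        · exact ⟨0, fun h => absurd h hg⟩
      choose k hk using hk
      obtain ⟨D, hDA, hdis, hcard⟩ := exists_disjoint_cover hF.1 hTemp k A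
      have h1 : ∑ g ∈ D, s ((F (k g)).image (· * g)) y ≤ s (F n) y := by
        refine hy.sum_le D _ _ hdis fun g hg => ?_
        intro x hx
        obtain ⟨t, ht, rfl⟩ := Finset.mem_image.1 hx
        have h2 := (Finset.mem_filter.1 (hDA hg)).1
        exact (mem_interior.1 h2).2 t (hKle _ (hk g (hDA hg)).1 ht)
      have h2 : ∑ g ∈ D, c * ((F (k g)).card : ℝ) ≤ ∑ g ∈ D, s ((F (k g)).image (· * g)) y := by
        refine Finset.sum_le_sum fun g hg => ?_
        rw [hy.equivariant]
        exact (hk g (hDA hg)).2.le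
      have h3 : ∑ g ∈ interior K (F n), c / M * (B N).indicator (fun _ => (1 : ℝ)) (T g y)
          = c / M * A.card := by
        rw [← Finset.mul_sum]
        congr 1
        simp only [Set.indicator_apply, hA]
        rw [Finset.sum_boole]
      rw [h3]
      rw [← Finset.mul_sum] at h2
      calc c / M * (A.card : ℝ) ≤ c / M * (M * ∑ b ∈ D, ((F (k b)).card : ℝ)) := by gcongr
        _ = c * ∑ b ∈ D, ((F (k b)).card : ℝ) := by rw [← mul_assoc, div_mul_cancel₀ _ hM.ne']
        _ ≤ _ := h2.trans h1
    have hind : Integrable ((B N).indicator (fun _ => (1 : ℝ))) ν :=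
      (integrable_const (1 : ℝ)).indicator₀ hBmeas
    have hint : ∀ n, (interior K (F n)).card * (c / M * ν.real (B N)) ≤ γ * (F n).card := by
      intro n
      refine le_trans ?_ (hγ n)
      have hI : ∀ g ∈ interior K (F n),
          Integrable (fun y => c / M * (B N).indicator (fun _ => (1 : ℝ)) (T g y)) ν :=
        fun g _ => (integrable_comp hT hind g).const_mul _
      have := integral_mono_ae (integrable_finsetSum _ hI) (h.integrable (F n)) (hpt n)
      rw [integral_finsetSum _ hI] at this
      refine le_trans (le_of_eq ?_) this
      have he : ∀ g, ∫ y, c / M * (B N).indicator (fun _ => (1 : ℝ)) (T g y) ∂ν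
          = c / M * ν.real (B N) := by
        intro g
        rw [integral_const_mul, integral_comp hT hind.aestronglyMeasurable g,
          integral_indicator₀ hBmeas, setIntegral_const, smul_eq_mul, mul_one]
      rw [Finset.sum_congr rfl fun g _ => he g, Finset.sum_const, nsmul_eq_mul]
    have hlim : Tendsto (fun n => ((interior K (F n)).card : ℝ) / (F n).card
        * (c / M * ν.real (B N))) atTop (𝓝 (1 * (c / M * ν.real (B N)))) :=
      (tendsto_interior hF K).mul_const _
    have hle : 1 * (c / M * ν.real (B N)) ≤ γ := by
      refine le_of_tendsto' hlim fun n => ?_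
      have h0 := card_pos' hF n
      rw [div_mul_eq_mul_div, div_le_iff₀ h0]
      exact hint n
    rw [le_div_iff₀ hc]
    rw [one_mul, div_mul_eq_mul_div, div_le_iff₀ hM] at hle
    linarith
  have hmono : Monotone B := fun a b hab y ⟨k, hk, hky⟩ => ⟨k, hk.trans hab, hky⟩
  have hU : {y | ∃ k, c * (F k).card < s (F k) y} = ⋃ N, B N := by
    ext y
    simp only [hB, Set.mem_iUnion]
    exact ⟨fun ⟨k, hk⟩ => ⟨k, k, le_rfl, hk⟩, fun ⟨_, k, _, hk⟩ => ⟨k, hk⟩⟩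
  rw [hU]
  have ht := tendsto_measure_iUnion_atTop (μ := ν) hmono
  have ht' := (ENNReal.tendsto_toReal (measure_ne_top ν _)).comp ht
  exact le_of_tendsto' ht' hBN

end Families

section Pointwise

variable {G : Type*} [Group G] {Y : Type*} [MeasurableSpace Y]

/-- The σ-algebra of measurable sets invariant under all the maps `T g`. -/
@[reducible]
def invSigma (T : G → Y → Y) : MeasurableSpace Y := ⨅ g, MeasurableSpace.invariants (T g)

omit [Group G] in
lemma measurableSet_invSigma [Nonempty G] {T : G → Y → Y} {s : Set Y} :
    MeasurableSet[invSigma T] s ↔ MeasurableSet s ∧ ∀ g, T g ⁻¹' s = s := by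
  rw [invSigma, MeasurableSpace.measurableSet_iInf]
  simp only [MeasurableSpace.measurableSet_invariants]
  exact ⟨fun h => ⟨(h (Classical.arbitrary G)).1, fun g => (h g).2⟩, fun h g => ⟨h.1, h.2 g⟩⟩

lemma invSigma_le (T : G → Y → Y) : invSigma T ≤ ‹MeasurableSpace Y› :=
  fun _ hs => (measurableSet_invSigma.1 hs).1

lemma condExp_invSigma_apply (ν : Measure Y) (T : G → Y → Y) (f : Y → ℝ) (g : G) (y : Y) :
    (ν[f | invSigma T]) (T g y) = (ν[f | invSigma T]) y := by
  have h : Measurable[invSigma T] (ν[f | invSigma T]) := stronglyMeasurable_condExp.measurable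
  have h1 := (measurableSet_invSigma.1 (h (measurableSet_singleton ((ν[f | invSigma T]) y)))).2 g
  have h2 : y ∈ T g ⁻¹' ((ν[f | invSigma T]) ⁻¹' {(ν[f | invSigma T]) y}) := by
    rw [h1]; rfl
  exact h2

lemma measurable_condExp_invSigma (ν : Measure Y) (T : G → Y → Y) (f : Y → ℝ) :
    Measurable (ν[f | invSigma T]) :=
  (stronglyMeasurable_condExp.mono (invSigma_le T)).measurable

/-- Ergodic averages of `f` along `F`. -/
noncomputable def avg (T : G → Y → Y) (F : ℕ → Finset G) (f : Y → ℝ) (n : ℕ) (y : Y) : ℝ :=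
  (∑ h ∈ F n, f (T h y)) / (F n).card

/-- The ergodic averages of `f` converge a.e. to its conditional expectation. -/
def ConvAvg (ν : Measure Y) (T : G → Y → Y) (F : ℕ → Finset G) (f : Y → ℝ) : Prop :=
  ∀ᵐ y ∂ν, Tendsto (fun n => avg T F f n y) atTop (𝓝 ((ν[f | invSigma T]) y))

variable {ν : Measure Y} [IsProbabilityMeasure ν] {T : G → Y → Y} {F : ℕ → Finset G}

omit [Group G] [IsProbabilityMeasure ν] in
lemma ConvAvg.add {f f' : Y → ℝ} (hf : Integrable f ν) (hf' : Integrable f' ν)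
    (h : ConvAvg ν T F f) (h' : ConvAvg ν T F f') : ConvAvg ν T F (f + f') := by
  filter_upwards [h, h', condExp_add hf hf' (invSigma T)] with y h1 h2 h3
  rw [h3]
  refine (h1.add h2).congr fun n => ?_
  simp [avg, Finset.sum_add_distrib, add_div]

omit [Group G] [IsProbabilityMeasure ν] in
lemma ConvAvg.const_smul {f : Y → ℝ} (h : ConvAvg ν T F f) (c : ℝ) :
    ConvAvg ν T F (c • f) := by
  filter_upwards [h, condExp_smul c f (invSigma T)] with y h1 h3
  rw [h3]
  refine (h1.const_mul c).congr fun n => ?_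
  simp [avg, ← Finset.mul_sum, mul_div_assoc]

omit [IsProbabilityMeasure ν] in
lemma ConvAvg.congr [Countable G] (hT : MPAction ν T) {f f' : Y → ℝ} (h : ConvAvg ν T F f)
    (he : f =ᵐ[ν] f') : ConvAvg ν T F f' := by
  filter_upwards [h, ae_all_translates hT he, condExp_congr_ae (m := invSigma T) he]
    with y h1 h2 h3
  rw [← h3]
  refine h1.congr fun n => ?_
  simp only [avg]
  congr 1
  exact Finset.sum_congr rfl fun g _ => h2 g

lemma condExp_comp (hT : MPAction ν T) {f : Y → ℝ} (hf : Integrable f ν) (g : G) :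
    ν[fun y => f (T g y) | invSigma T] =ᵐ[ν] ν[f | invSigma T] := by
  refine (ae_eq_condExp_of_forall_setIntegral_eq (invSigma_le T) (integrable_comp hT hf g)
    (fun _ _ _ => integrable_condExp.integrableOn) ?_
    stronglyMeasurable_condExp.aestronglyMeasurable).symm
  intro s hs _
  rw [setIntegral_condExp (invSigma_le T) hf hs]
  obtain ⟨hs', hinv⟩ := measurableSet_invSigma.1 hs
  rw [← integral_indicator hs', ← integral_indicator hs',
    ← integral_comp hT (hf.indicator hs').aestronglyMeasurable g]
  refine integral_congr_ae (Eventually.of_forall fun y => ?_)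
  have h1 : T g y ∈ s ↔ y ∈ s := by
    conv_rhs => rw [← hinv g]
    rfl
  by_cases hy : y ∈ s
  · simp [hy, h1.2 hy]
  · have h2 : T g y ∉ s := fun h => hy (h1.1 h)
    simp [hy, h2]

lemma ConvAvg.of_invariant [Countable G] (hT : MPAction ν T) (hF : ∀ n, (F n).Nonempty)
    {f : Y → ℝ} (hf : Integrable f ν)
    (h : ∀ g, (fun y => f (T g y)) =ᵐ[ν] f) : ConvAvg ν T F f := by
  set f₁ := hf.aestronglyMeasurable.mk f with hf₁
  have hf₁m : Measurable f₁ := hf.aestronglyMeasurable.stronglyMeasurable_mk.measurable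
  have he : f =ᵐ[ν] f₁ := hf.aestronglyMeasurable.ae_eq_mk
  set f₂ : Y → ℝ := fun y => ⨆ g, f₁ (T g y) with hf₂
  have hf₂m : Measurable f₂ := Measurable.iSup fun g => hf₁m.comp (hT.mp g).measurable
  have hf₂inv : ∀ g y, f₂ (T g y) = f₂ y := by
    intro g y
    change (⨆ k, f₁ (T k (T g y))) = ⨆ k, f₁ (T k y)
    simp_rw [← hT.mul]
    exact (Equiv.mulRight g).iSup_comp (g := fun k => f₁ (T k y))
  have he₂ : f =ᵐ[ν] f₂ := by
    filter_upwards [ae_all_translates hT he, ae_all_iff.2 h] with y h1 h2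
    have : ∀ g, f₁ (T g y) = f y := fun g => (h1 g).symm.trans (h2 g)
    simp [hf₂, this]
  have hf₂m' : StronglyMeasurable[invSigma T] f₂ := by
    refine Measurable.stronglyMeasurable fun s hs => ?_
    refine measurableSet_invSigma.2 ⟨hf₂m hs, fun g => ?_⟩
    ext y
    simp [hf₂inv]
  have hce : ν[f | invSigma T] =ᵐ[ν] f :=
    condExp_of_aestronglyMeasurable' (invSigma_le T) ⟨f₂, hf₂m', he₂⟩ hf
  filter_upwards [hce, ae_all_iff.2 h] with y h1 h2
  rw [h1]
  refine tendsto_const_nhds.congr fun n => ?_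
  have h0 : ((F n).card : ℝ) ≠ 0 := by exact_mod_cast (hF n).card_pos.ne'
  simp only [avg]
  rw [Finset.sum_congr rfl fun g _ => h2 g]
  simp [h0]

lemma condExp_coboundary (hT : MPAction ν T) {f : Y → ℝ} (hf : Integrable f ν) (g : G) :
    ν[fun y => f (T g y) - f y | invSigma T] =ᵐ[ν] 0 := by
  filter_upwards [condExp_comp hT hf g, condExp_sub (integrable_comp hT hf g) hf (invSigma T)]
    with y h1 h2
  have h3 : (ν[fun y => f (T g y) - f y | invSigma T]) y = _ := h2
  rw [h3]
  simp [h1]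

omit [IsProbabilityMeasure ν] in
lemma integral_abs_eq {f : Y → ℝ} (hf : Integrable f ν) :
    ∫ y, |f y| ∂ν = (eLpNorm f 1 ν).toReal := by
  rw [toReal_eLpNorm hf.aestronglyMeasurable, lpNorm_one_eq_integral_norm hf.aestronglyMeasurable]
  rfl

omit [IsProbabilityMeasure ν] in
lemma exists_bounded_approx {f : Y → ℝ} (hf : Integrable f ν) {ε : ℝ} (hε : 0 < ε) :
    ∃ φ : Y → ℝ, Integrable φ ν ∧ (∃ C, ∀ y, |φ y| ≤ C) ∧ ∫ y, |f y - φ y| ∂ν ≤ ε := by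
  obtain ⟨φ, hφ, hφi⟩ := (memLp_one_iff_integrable.2 hf).exists_simpleFunc_eLpNorm_sub_lt
    ENNReal.one_ne_top (ε := ENNReal.ofReal ε) (by simp [hε])
  have hφi' : Integrable φ ν := memLp_one_iff_integrable.1 hφi
  refine ⟨φ, hφi', φ.exists_forall_norm_le, ?_⟩
  refine (integral_abs_eq (hf.sub hφi')).trans_le ?_
  exact ENNReal.toReal_le_of_le_ofReal hε.le hφ.le

variable [DecidableEq G]

omit [Group G] in
lemma abs_sum_sub_sum_le (A B : Finset G) (u : G → ℝ) {C : ℝ} (hu : ∀ g, |u g| ≤ C) :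
    |∑ g ∈ A, u g - ∑ g ∈ B, u g| ≤ C * (A ∆ B).card := by
  have h1 : ∑ g ∈ A, u g - ∑ g ∈ B, u g = ∑ g ∈ A \ B, u g - ∑ g ∈ B \ A, u g := by
    rw [← Finset.sum_sdiff (Finset.inter_subset_left : A ∩ B ⊆ A),
      ← Finset.sum_sdiff (Finset.inter_subset_right : A ∩ B ⊆ B)]
    simp
  have h2 : ∀ D : Finset G, |∑ g ∈ D, u g| ≤ C * D.card := fun D => by
    refine (Finset.abs_sum_le_sum_abs _ _).trans ?_
    refine (Finset.sum_le_sum fun g _ => hu g).trans ?_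
    simp [mul_comm]
  have h3 : (A ∆ B).card = (A \ B).card + (B \ A).card := by
    rw [symmDiff_def, Finset.sup_eq_union, Finset.card_union_of_disjoint disjoint_sdiff_sdiff]
  rw [h1, h3]
  push_cast
  have := abs_sub (∑ g ∈ A \ B, u g) (∑ g ∈ B \ A, u g)
  linarith [h2 (A \ B), h2 (B \ A)]

lemma ConvAvg.coboundary_of_bounded (hT : MPAction ν T) (hF : IsFolner F) {f : Y → ℝ}
    (hf : Integrable f ν) {C : ℝ} (hC : ∀ y, |f y| ≤ C) (g : G) :
    ConvAvg ν T F (fun y => f (T g y) - f y) := by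
  filter_upwards [condExp_coboundary hT hf g] with y hy
  rw [hy]
  have h := (hF.2 g).const_mul C
  rw [mul_zero] at h
  refine squeeze_zero_norm (fun n => ?_) h
  have h0 := card_pos' hF n
  rw [Real.norm_eq_abs, avg, abs_div, abs_of_pos h0, mul_div_assoc']
  refine div_le_div_of_nonneg_right ?_ h0.le
  have h1 : ∑ h ∈ F n, (f (T g (T h y)) - f (T h y))
      = ∑ h ∈ (F n).image (g * ·), f (T h y) - ∑ h ∈ F n, f (T h y) := by
    rw [Finset.sum_image (f := fun x => f (T x y)) fun a _ b _ hab => mul_left_cancel hab,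
      Finset.sum_sub_distrib]
    simp only [hT.mul]
  rw [h1]
  exact abs_sum_sub_sum_le _ _ (fun h => f (T h y)) fun _ => hC _

omit [IsProbabilityMeasure ν] in
lemma additive_superFamily [Countable G] (hT : MPAction ν T) {f : Y → ℝ} (hf : Integrable f ν)
    (h0 : ∀ y, 0 ≤ f y) : SuperFamily ν T fun E y => ∑ h ∈ E, f (T h y) where
  integrable E := integrable_finsetSum _ fun g _ => integrable_comp hT hf g
  superAt := Eventually.of_forall fun y =>
    { nonneg := fun E => Finset.sum_nonneg fun g _ => h0 _
      super := fun E E' hd => (Finset.sum_union hd).ge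
      equivariant := fun E g => by
        rw [Finset.sum_image (f := fun x => f (T x y)) fun a _ b _ hab => mul_right_cancel hab]
        simp only [hT.mul] }

lemma maximal_avg [Countable G] (hT : MPAction ν T) (hF : IsFolner F) {M : ℝ} (hM : 0 < M)
    (hTemp : TempelmanWith F M) {f : Y → ℝ} (hf : Integrable f ν) (h0 : ∀ y, 0 ≤ f y)
    {c : ℝ} (hc : 0 < c) :
    ν.real {y | ∃ n, c < avg T F f n y} ≤ M * (∫ y, f y ∂ν) / c := by
  have h := maximal_inequality hT (additive_superFamily hT hf h0) hF hM hTemp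
    (γ := ∫ y, f y ∂ν) (fun n => ?_) hc
  · refine le_trans (le_of_eq ?_) h
    congr 1
    ext y
    refine exists_congr fun n => ?_
    rw [avg, lt_div_iff₀ (card_pos' hF n)]
  · rw [integral_finsetSum _ fun g _ => integrable_comp hT hf g,
      Finset.sum_congr rfl fun g _ => integral_comp hT hf.aestronglyMeasurable g]
    simp [mul_comm]

lemma ConvAvg.of_approx [Countable G] (hT : MPAction ν T) (hF : IsFolner F) {M : ℝ}
    (hM : 0 < M) (hTemp : TempelmanWith F M) {f : Y → ℝ} (hf : Integrable f ν)
    (h : ∀ ε : ℝ, 0 < ε → ∃ f' : Y → ℝ, Integrable f' ν ∧ ConvAvg ν T F f' ∧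
      ∫ y, |f y - f' y| ∂ν ≤ ε) : ConvAvg ν T F f := by
  have key : ∀ η : ℝ, 0 < η → ∀ᵐ y ∂ν, ∀ᶠ n in atTop,
      |avg T F f n y - (ν[f | invSigma T]) y| ≤ 3 * η := by
    intro η hη
    set Z := {y | ¬ ∀ᶠ n in atTop, |avg T F f n y - (ν[f | invSigma T]) y| ≤ 3 * η} with hZ
    have hle : ∀ ε : ℝ, 0 < ε → ν.real Z ≤ (M + 1) / η * ε := by
      intro ε hε
      obtain ⟨f', hf', hconv, hε'⟩ := h ε hε
      have habs : Integrable (fun y => |f y - f' y|) ν := (hf.sub hf').abs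
      set A := {y | ∃ n, η < avg T F (fun y => |f y - f' y|) n y} with hA
      set B := {y | η ≤ |(ν[f - f' | invSigma T]) y|} with hB
      have hsub : Z ≤ᵐ[ν] (A ∪ B : Set Y) := by
        filter_upwards [hconv, condExp_sub hf hf' (invSigma T)] with y h1 h2 hy
        by_contra hnot
        apply hy
        change ¬ (y ∈ A ∪ B) at hnot
        simp only [hA, hB, Set.mem_union, not_or, Set.mem_ofPred_eq, not_exists, not_lt,
          not_le] at hnot
        obtain ⟨h3, h4⟩ := hnot
        rw [h2] at h4
        filter_upwards [Metric.tendsto_nhds.1 h1 η hη] with n hn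
        rw [Real.dist_eq] at hn
        have h5 : |avg T F f n y - avg T F f' n y| ≤ η := by
          refine le_trans ?_ (h3 n)
          have h0 := card_pos' hF n
          simp only [avg]
          rw [← sub_div, abs_div, abs_of_pos h0, ← Finset.sum_sub_distrib]
          exact div_le_div_of_nonneg_right (Finset.abs_sum_le_sum_abs _ _) h0.le
        simp only [Pi.sub_apply] at h4
        rw [abs_lt] at h4 hn
        rw [abs_le] at h5 ⊢
        constructor <;> linarith
      have hAle : ν.real A ≤ M * ε / η := by
        refine (maximal_avg hT hF hM hTemp habs (fun _ => abs_nonneg _) hη).trans ?_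
        gcongr
      have hBle : ν.real B ≤ ε / η := by
        rw [le_div_iff₀ hη, mul_comm]
        refine (mul_meas_ge_le_integral_of_nonneg (Eventually.of_forall fun _ => abs_nonneg _)
          integrable_condExp.abs η).trans ?_
        exact (integral_abs_condExp_le _).trans hε'
      have h1 : ν.real Z ≤ ν.real (A ∪ B) :=
        ENNReal.toReal_mono (measure_ne_top _ _) (measure_mono_ae hsub)
      have h2 := measureReal_union_le (μ := ν) A B
      have h3 : (M + 1) / η * ε = M * ε / η + ε / η := by ring
      linarith
    have hZ0 : ν.real Z = 0 := by
      refine le_antisymm (le_of_forall_pos_le_add fun ε hε => ?_) measureReal_nonneg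
      have hc : 0 < (M + 1) / η := by positivity
      have := hle (ε / ((M + 1) / η)) (by positivity)
      rw [mul_div_cancel₀ _ hc.ne'] at this
      linarith
    rwa [measureReal_eq_zero_iff] at hZ0
  have key' : ∀ᵐ y ∂ν, ∀ k : ℕ, ∀ᶠ n in atTop,
      |avg T F f n y - (ν[f | invSigma T]) y| ≤ 3 * (1 / ((k : ℝ) + 1)) :=
    ae_all_iff.2 fun k => key _ Nat.one_div_pos_of_nat
  filter_upwards [key'] with y hy
  rw [Metric.tendsto_nhds]
  intro ε hε
  obtain ⟨k, hk⟩ := exists_nat_one_div_lt (show 0 < ε / 3 by positivity)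
  filter_upwards [hy k] with n hn
  rw [Real.dist_eq]
  linarith

lemma ConvAvg.coboundary [Countable G] (hT : MPAction ν T) (hF : IsFolner F) {M : ℝ}
    (hM : 0 < M) (hTemp : TempelmanWith F M) {f : Y → ℝ} (hf : Integrable f ν) (g : G) :
    ConvAvg ν T F (fun y => f (T g y) - f y) := by
  refine ConvAvg.of_approx hT hF hM hTemp ((integrable_comp hT hf g).sub hf) fun ε hε => ?_
  obtain ⟨φ, hφi', ⟨C, hC⟩, h1⟩ := exists_bounded_approx hf (half_pos hε)
  refine ⟨fun y => φ (T g y) - φ y, (integrable_comp hT hφi' g).sub hφi',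
    ConvAvg.coboundary_of_bounded hT hF hφi' hC g, ?_⟩
  have hd : Integrable (f - φ) ν := hf.sub hφi'
  change ∫ y, |(f - φ) y| ∂ν ≤ ε / 2 at h1
  calc ∫ y, |f (T g y) - f y - (φ (T g y) - φ y)| ∂ν
      ≤ ∫ y, (|(f - φ) (T g y)| + |(f - φ) y|) ∂ν := by
        refine integral_mono (((integrable_comp hT hf g).sub hf).sub
          ((integrable_comp hT hφi' g).sub hφi')).abs
          ((integrable_comp hT hd.abs g).add hd.abs) fun y => ?_
        have := abs_sub ((f - φ) (T g y)) ((f - φ) y)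
        simp only [Pi.sub_apply] at this ⊢
        refine le_trans (le_of_eq ?_) this
        congr 1
        ring
    _ = ∫ y, |(f - φ) y| ∂ν + ∫ y, |(f - φ) y| ∂ν := by
        rw [integral_add (integrable_comp hT hd.abs g) hd.abs,
          integral_comp hT hd.abs.aestronglyMeasurable g]
    _ ≤ ε := by linarith

lemma integral_abs_le_norm_L2 (f : Lp ℝ 2 ν) : ∫ y, |f y| ∂ν ≤ ‖f‖ := by
  rw [integral_abs_eq ((Lp.memLp f).integrable (by norm_num)), Lp.norm_def]
  refine ENNReal.toReal_mono (Lp.eLpNorm_ne_top f) ?_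
  exact eLpNorm_le_eLpNorm_of_exponent_le (by norm_num) (Lp.aestronglyMeasurable f)

lemma integrable_L2 (f : Lp ℝ 2 ν) : Integrable f ν :=
  (Lp.memLp f).integrable (by norm_num)

lemma convAvg_L2 [Countable G] (hT : MPAction ν T) (hF : IsFolner F) {M : ℝ}
    (hM : 0 < M) (hTemp : TempelmanWith F M) (f : Lp ℝ 2 ν) : ConvAvg ν T F f := by
  set U : G → Lp ℝ 2 ν →ₗᵢ[ℝ] Lp ℝ 2 ν := fun g =>
    Lp.compMeasurePreservingₗᵢ ℝ (T g) (hT.mp g) with hU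
  have hUae : ∀ g φ, (U g φ : Y → ℝ) =ᵐ[ν] fun y => φ (T g y) := fun g φ =>
    Lp.coeFn_compMeasurePreserving φ (hT.mp g)
  set S : Submodule ℝ (Lp ℝ 2 ν) := Submodule.span ℝ {c | ∃ g φ, c = U g φ - φ} with hS
  have hSconv : ∀ c ∈ S, ConvAvg ν T F c := by
    intro c hc
    induction hc using Submodule.span_induction with
    | mem x hx =>
      obtain ⟨g, φ, rfl⟩ := hx
      refine (ConvAvg.coboundary hT hF hM hTemp (integrable_L2 φ) g).congr hT ?_
      filter_upwards [Lp.coeFn_sub (U g φ) φ, hUae g φ] with y h1 h2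
      rw [h1, Pi.sub_apply, h2]
    | zero =>
      refine (ConvAvg.of_invariant hT hF.1 (integrable_zero Y ℝ ν) fun g => ?_).congr hT
        (Lp.coeFn_zero ℝ 2 ν).symm
      exact Eventually.of_forall fun y => rfl
    | add x y _ _ hx hy =>
      exact (hx.add (integrable_L2 x) (integrable_L2 y) hy).congr hT (Lp.coeFn_add x y).symm
    | smul a x _ hx =>
      exact (hx.const_smul a).congr hT (Lp.coeFn_smul a x).symm
  have hKconv : ∀ c ∈ S.topologicalClosure, ConvAvg ν T F c := by
    intro c hc
    refine ConvAvg.of_approx hT hF hM hTemp (integrable_L2 c) fun ε hε => ?_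
    have hc' : c ∈ closure (S : Set (Lp ℝ 2 ν)) := hc
    obtain ⟨b, hb, hd⟩ := Metric.mem_closure_iff.1 hc' ε hε
    refine ⟨b, integrable_L2 b, hSconv b hb, ?_⟩
    rw [dist_eq_norm] at hd
    refine le_trans (le_of_eq (integral_congr_ae ?_))
      ((integral_abs_le_norm_L2 (c - b)).trans hd.le)
    filter_upwards [Lp.coeFn_sub c b] with y h1
    rw [h1, Pi.sub_apply]
  have : CompleteSpace S.topologicalClosure :=
    S.isClosed_topologicalClosure.completeSpace_coe
  obtain ⟨c, hc, z, hz, hfz⟩ := S.topologicalClosure.exists_add_mem_mem_orthogonal f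
  have hzinv : ∀ g, U g z = z := by
    intro g
    have h1 : inner ℝ (U g z - z) z = 0 :=
      hz _ (S.le_topologicalClosure (Submodule.subset_span ⟨g, z, rfl⟩))
    have h2 : ‖U g z - z‖ ^ 2 = 0 := by
      rw [inner_sub_left, real_inner_self_eq_norm_sq] at h1
      rw [norm_sub_sq_real, (U g).norm_map]
      linarith
    exact sub_eq_zero.1 (norm_eq_zero.1 (pow_eq_zero_iff two_ne_zero |>.1 h2))
  have hzconv : ConvAvg ν T F z := by
    refine ConvAvg.of_invariant hT hF.1 (integrable_L2 z) fun g => ?_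
    have := hUae g z
    rw [hzinv g] at this
    exact this.symm
  rw [hfz]
  exact ((hKconv c hc).add (integrable_L2 c) (integrable_L2 z) hzconv).congr hT
    (Lp.coeFn_add c z).symm

/-- The pointwise ergodic theorem along Tempelman Følner sequences. -/
theorem convAvg_of_integrable [Countable G] (hT : MPAction ν T) (hF : IsFolner F) {M : ℝ}
    (hM : 0 < M) (hTemp : TempelmanWith F M) {f : Y → ℝ} (hf : Integrable f ν) :
    ConvAvg ν T F f := by
  refine ConvAvg.of_approx hT hF hM hTemp hf fun ε hε => ?_
  obtain ⟨φ, hφi, ⟨C, hC⟩, hφ⟩ := exists_bounded_approx hf hε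
  have hφ2 : MemLp φ 2 ν :=
    MemLp.of_bound hφi.aestronglyMeasurable C (Eventually.of_forall hC)
  exact ⟨φ, hφi, (convAvg_L2 hT hF hM hTemp (hφ2.toLp φ)).congr hT hφ2.coeFn_toLp, hφ⟩

end Pointwise

section Superadditive

variable {G : Type*} [Group G] [DecidableEq G] {Y : Type*} [MeasurableSpace Y]

/-- A Tempelman Følner sequence whose terms tile `G` along the ranges of injective
endomorphisms `φ n`, and whose late terms are approximated by products
`F m * φ m (F n)` for `m ∈ 𝒩`. -/
structure TilingSystem (F : ℕ → Finset G) (φ : ℕ → G →* G) (M : ℝ) (𝒩 : Set ℕ) : Prop where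
  folner : IsFolner F
  pos : 0 < M
  tempelman : TempelmanWith F M
  injective : ∀ n, Function.Injective (φ n)
  tiles : ∀ n, TilesWith (F n) (Set.range (φ n))
  infinite : 𝒩.Infinite
  approx : ∀ m ∈ 𝒩, ∀ δ : ℝ, 0 < δ → ∀ᶠ p in atTop, ∃ n₁ n₂ : ℕ,
    F p ⊆ F m * (F n₁).image (φ m) ∧ F m * (F n₂).image (φ m) ⊆ F p ∧
    (((F n₁).card : ℝ) - ((F n₂).card : ℝ)) / ((F p).card : ℝ) < δ

variable {ν : Measure Y} [IsProbabilityMeasure ν] {T : G → Y → Y} {s : Finset G → Y → ℝ}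
  {F : ℕ → Finset G} {φ : ℕ → G →* G} {M : ℝ} {𝒩 : Set ℕ} {L : ℝ}

omit [IsProbabilityMeasure ν] in
lemma SuperFamily.integral_nonneg (h : SuperFamily ν T s) (E : Finset G) :
    0 ≤ ∫ y, s E y ∂ν :=
  integral_nonneg_of_ae (h.superAt.mono fun _ hy => hy.nonneg E)

omit [IsProbabilityMeasure ν] in
lemma SuperFamily.interior_mul_integral_le (hT : MPAction ν T) (h : SuperFamily ν T s)
    {K : Finset G} {C : Set G} (hK : TilesWith K C) (E : Finset G) :
    (interior (K * K⁻¹) E).card * ∫ y, s K y ∂ν ≤ K.card * ∫ y, s E y ∂ν := by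
  obtain ⟨D, -, hd, hDE, hcard⟩ := hK.exists_centers E
  have hI : ∀ c ∈ D, Integrable (fun y => s K (T c y)) ν :=
    fun c _ => integrable_comp hT (h.integrable K) c
  have h1 : ∫ y, ∑ c ∈ D, s K (T c y) ∂ν ≤ ∫ y, s E y ∂ν :=
    integral_mono_ae (integrable_finsetSum _ hI) (h.integrable E)
      (h.superAt.mono fun y hy => hy.sum_le_of_tile hd hDE)
  rw [integral_finsetSum _ hI, Finset.sum_congr rfl fun c _ =>
    integral_comp hT (h.integrable K).aestronglyMeasurable c, Finset.sum_const,
    nsmul_eq_mul] at h1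
  calc ((interior (K * K⁻¹) E).card : ℝ) * ∫ y, s K y ∂ν
      ≤ (K.card * D.card : ℝ) * ∫ y, s K y ∂ν := by
        gcongr
        · exact h.integral_nonneg K
        · exact_mod_cast hcard
    _ = K.card * (D.card * ∫ y, s K y ∂ν) := by ring
    _ ≤ _ := by gcongr

/-- Existence of the rate of a bounded super-additive family. -/
lemma SuperFamily.exists_rate (hT : MPAction ν T) (h : SuperFamily ν T s)
    (hL : ∀ E y, s E y ≤ L * E.card) (hF : IsFolner F) (hFt : ∀ n, ∃ C, TilesWith (F n) C) :
    ∃ γ : ℝ, Tendsto (fun n => (∫ y, s (F n) y ∂ν) / (F n).card) atTop (𝓝 γ) ∧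
      ∀ K : Finset G, Tiles K → ∫ y, s K y ∂ν ≤ γ * K.card := by
  set r : ℕ → ℝ := fun n => (∫ y, s (F n) y ∂ν) / (F n).card with hr
  have hbdd : BddAbove (Set.range r) := by
    refine ⟨L, ?_⟩
    rintro _ ⟨n, rfl⟩
    rw [hr, div_le_iff₀ (card_pos' hF n)]
    have := integral_mono (h.integrable (F n)) (integrable_const (L * (F n).card)) (hL (F n))
    simpa using this
  have hlow : ∀ K : Finset G, Tiles K → ∀ n,
      ((interior (K * K⁻¹) (F n)).card : ℝ) / (F n).card * ((∫ y, s K y ∂ν) / K.card) ≤ r n := by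
    rintro K ⟨hK0, C, hK⟩ n
    have hKpos : (0 : ℝ) < K.card := by exact_mod_cast hK0.card_pos
    have := h.interior_mul_integral_le hT hK (F n)
    rw [hr, div_mul_div_comm, div_le_div_iff₀ (mul_pos (card_pos' hF n) hKpos) (card_pos' hF n)]
    nlinarith [card_pos' hF n]
  have hlim : ∀ K : Finset G, Tendsto (fun n => ((interior (K * K⁻¹) (F n)).card : ℝ) / (F n).card
      * ((∫ y, s K y ∂ν) / K.card)) atTop (𝓝 ((∫ y, s K y ∂ν) / K.card)) := by
    intro K
    simpa using (tendsto_interior hF (K * K⁻¹)).mul_const ((∫ y, s K y ∂ν) / K.card)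
  refine ⟨⨆ n, r n, ?_, fun K hK => ?_⟩
  · refine tendsto_order.2 ⟨fun a ha => ?_, fun a ha => ?_⟩
    · obtain ⟨n₀, hn₀⟩ := exists_lt_of_lt_ciSup ha
      filter_upwards [(hlim (F n₀)).eventually (lt_mem_nhds hn₀)] with n hn
      exact hn.trans_le (hlow (F n₀) ⟨hF.1 n₀, hFt n₀⟩ n)
    · exact Eventually.of_forall fun n => (le_ciSup hbdd n).trans_lt ha
  · have hKpos : (0 : ℝ) < K.card := by exact_mod_cast hK.1.card_pos
    rw [← div_le_iff₀ hKpos]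
    exact le_of_tendsto' (hlim K) fun n => (hlow K hK n).trans (le_ciSup hbdd n)

/-- The conditional average of the tile `K`, over the action restricted along `φ`. -/
noncomputable def tileAvg (ν : Measure Y) (T : G → Y → Y) (s : Finset G → Y → ℝ)
    (K : Finset G) (φ : G →* G) (y : Y) : ℝ :=
  (ν[s K | invSigma fun g => T (φ g)]) y / K.card

lemma TilingSystem.tendsto_avg [Countable G] (sys : TilingSystem F φ M 𝒩) (hT : MPAction ν T)
    {f : Y → ℝ} (hf : Integrable f ν) (m : ℕ) :
    ∀ᵐ y ∂ν, Tendsto (fun n => (∑ g ∈ F n, f (T (φ m g) y)) / (F n).card) atTop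
      (𝓝 ((ν[f | invSigma fun g => T (φ m g)]) y)) :=
  convAvg_of_integrable (hT.comp (φ m)) sys.folner sys.pos sys.tempelman hf

lemma TilingSystem.lower_bound [Countable G] [Infinite G] (sys : TilingSystem F φ M 𝒩)
    (hT : MPAction ν T) (h : SuperFamily ν T s) {m : ℕ} (hm : m ∈ 𝒩) :
    ∀ᵐ y ∂ν, ∃ w : ℕ → ℝ, Tendsto w atTop (𝓝 (tileAvg ν T s (F m) (φ m) y)) ∧
      ∀ᶠ p in atTop, w p ≤ s (F p) y / (F p).card := by
  obtain ⟨k₁, k₂, hk, -, hr₂, -, ht₂⟩ := exists_approx_seq sys.folner (sys.folner.1 m)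
    (sys.injective m) (sys.tiles m) (sys.approx m hm)
  filter_upwards [sys.tendsto_avg hT (h.integrable (F m)) m, h.superAt] with y hy hs
  refine ⟨_, ((hy.comp ht₂).mul hr₂), hk.mono fun p hp => ?_⟩
  have h1 := (hs.sum_tile_le (sys.injective m) (sys.tiles m) (F (k₂ p))).trans (hs.mono hp.2)
  have h2 := card_pos' sys.folner (k₂ p)
  have h3 := card_pos' sys.folner p
  simp only [Function.comp_apply]
  rw [div_mul_div_cancel₀ h2.ne']
  gcongr

lemma TilingSystem.upper_bound [Countable G] [Infinite G] (sys : TilingSystem F φ M 𝒩)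
    (hT : MPAction ν T) (h : SuperFamily ν T s) {m : ℕ} (hm : m ∈ 𝒩) {ε : ℝ} :
    ∀ᵐ y ∂ν, (∀ k, defect T s (F m) (φ m) (F k) y ≤ ε * (F m).card * (F k).card) →
      ∃ w : ℕ → ℝ, Tendsto w atTop (𝓝 (tileAvg ν T s (F m) (φ m) y + ε)) ∧
      ∀ᶠ p in atTop, s (F p) y / (F p).card ≤ w p := by
  obtain ⟨k₁, k₂, hk, hr₁, -, ht₁, -⟩ := exists_approx_seq sys.folner (sys.folner.1 m)
    (sys.injective m) (sys.tiles m) (sys.approx m hm)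
  filter_upwards [sys.tendsto_avg hT (h.integrable (F m)) m, h.superAt] with y hy hs hd
  have hmp := card_pos' sys.folner m
  have hlim := ((hy.comp ht₁).add_const (ε * (F m).card)).mul hr₁
  rw [add_mul, mul_assoc, mul_inv_cancel₀ hmp.ne', mul_one] at hlim
  refine ⟨_, hlim, hk.mono fun p hp => ?_⟩
  have h1 := hs.mono hp.1
  have h2 := card_pos' sys.folner (k₁ p)
  have h3 := card_pos' sys.folner p
  have h4 := hd (k₁ p)
  simp only [defect] at h4
  simp only [Function.comp_apply]
  rw [add_mul, div_mul_div_cancel₀ h2.ne', ← mul_div_assoc, ← add_div]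
  gcongr
  linarith

lemma TilingSystem.measure_defect_le (sys : TilingSystem F φ M 𝒩)
    (hT : MPAction ν T) (h : SuperFamily ν T s) {γ : ℝ}
    (hγ : ∀ K : Finset G, Tiles K → ∫ y, s K y ∂ν ≤ γ * K.card) (m : ℕ) {ε : ℝ} (hε : 0 < ε) :
    ν.real {y | ∃ k, ε * (F m).card * (F k).card < defect T s (F m) (φ m) (F k) y}
      ≤ M / ε * (γ - (∫ y, s (F m) y ∂ν) / (F m).card) := by
  have hmp := card_pos' sys.folner m
  have hd := h.defect hT (sys.injective m) (sys.tiles m)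
  have := maximal_inequality (hT.comp (φ m)) hd sys.folner sys.pos sys.tempelman
    (γ := γ * (F m).card - ∫ y, s (F m) y ∂ν) (fun n => ?_) (mul_pos hε hmp)
  · refine this.trans (le_of_eq ?_)
    field_simp
  · rw [integral_defect hT h, sub_mul]
    have h1 := hγ (F m * (F n).image (φ m)) ⟨(sys.folner.1 m).mul ((sys.folner.1 n).image _), _,
      (sys.tiles m).mul_image_s17 (sys.injective m) (sys.tiles n)⟩
    rw [(sys.tiles m).card_mul (sys.injective m)] at h1
    push_cast at h1
    nlinarith

lemma TilingSystem.frequently (sys : TilingSystem F φ M 𝒩) :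
    ∃ᶠ m in atTop, m ∈ 𝒩 :=
  Nat.frequently_atTop_iff_infinite.2 sys.infinite

lemma TilingSystem.exists_limit [Countable G] [Infinite G] (sys : TilingSystem F φ M 𝒩)
    (hT : MPAction ν T) (h : SuperFamily ν T s) (hL : ∀ E y, s E y ≤ L * E.card) :
    ∀ᵐ y ∂ν, ∃ l, Tendsto (fun p => s (F p) y / (F p).card) atTop (𝓝 l) := by
  obtain ⟨γ, hγ, hγK⟩ := h.exists_rate hT hL sys.folner fun n => ⟨_, sys.tiles n⟩
  have hgood : ∀ j : ℕ, ∀ᵐ y ∂ν, ∃ m ∈ 𝒩, ∀ k,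
      defect T s (F m) (φ m) (F k) y ≤ 1 / (j + 1 : ℝ) * (F m).card * (F k).card := by
    intro j
    have hε : (0 : ℝ) < 1 / (j + 1 : ℝ) := by positivity
    have h0 : Tendsto (fun m => M / (1 / (j + 1 : ℝ)) * (γ - (∫ y, s (F m) y ∂ν) / (F m).card))
        atTop (𝓝 0) := by
      simpa using (hγ.const_sub γ).const_mul (M / (1 / (j + 1 : ℝ)))
    rw [ae_iff, ← measureReal_eq_zero_iff]
    refine le_antisymm (le_of_forall_pos_lt_add fun δ hδ => ?_) measureReal_nonneg
    obtain ⟨m, hm, hmδ⟩ := (sys.frequently.and_eventually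
      (h0.eventually (gt_mem_nhds hδ))).exists
    rw [zero_add]
    refine lt_of_le_of_lt ?_ hmδ
    refine le_trans (measureReal_mono ?_) (sys.measure_defect_le hT h hγK m hε)
    intro y hy
    simp only [Set.mem_ofPred_eq, not_exists, not_and, not_forall, not_le] at hy ⊢
    exact hy m hm
  have hlow : ∀ᵐ y ∂ν, ∀ m ∈ 𝒩, ∃ w : ℕ → ℝ,
      Tendsto w atTop (𝓝 (tileAvg ν T s (F m) (φ m) y)) ∧
      ∀ᶠ p in atTop, w p ≤ s (F p) y / (F p).card :=
    (ae_ball_iff (Set.to_countable 𝒩)).2 fun m hm => sys.lower_bound hT h hm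
  have hupp : ∀ᵐ y ∂ν, ∀ j : ℕ, ∀ m ∈ 𝒩,
      (∀ k, defect T s (F m) (φ m) (F k) y ≤ 1 / (j + 1 : ℝ) * (F m).card * (F k).card) →
      ∃ w : ℕ → ℝ, Tendsto w atTop (𝓝 (tileAvg ν T s (F m) (φ m) y + 1 / (j + 1 : ℝ))) ∧
      ∀ᶠ p in atTop, s (F p) y / (F p).card ≤ w p :=
    ae_all_iff.2 fun j => (ae_ball_iff (Set.to_countable 𝒩)).2 fun m hm =>
      sys.upper_bound hT h hm
  filter_upwards [ae_all_iff.2 hgood, hlow, hupp] with y hg hl hu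
  refine cauchySeq_tendsto_of_complete (Metric.cauchySeq_iff'.2 fun ε hε => ?_)
  obtain ⟨j, hj⟩ := exists_nat_one_div_lt (show 0 < ε / 3 by positivity)
  obtain ⟨m, hm, hmd⟩ := hg j
  obtain ⟨w₁, hw₁, hw₁'⟩ := hl m hm
  obtain ⟨w₂, hw₂, hw₂'⟩ := hu j m hm hmd
  set a := tileAvg ν T s (F m) (φ m) y
  have h1 := hw₁.eventually (lt_mem_nhds (show a - ε / 3 < a by linarith))
  have h2 := hw₂.eventually (gt_mem_nhds
    (show a + 1 / (j + 1 : ℝ) < a + 2 * (ε / 3) by linarith))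
  obtain ⟨N, hN⟩ := eventually_atTop.1 (((hw₁'.and hw₂').and (h1.and h2)))
  refine ⟨N, fun n hn => ?_⟩
  have h3 := hN n hn
  have h4 := hN N le_rfl
  rw [Real.dist_eq, abs_lt]
  constructor <;> linarith [h3.1.1, h3.1.2, h3.2.1, h3.2.2, h4.1.1, h4.1.2, h4.2.1, h4.2.2]

/-- `f` is the pointwise limit of `s (F p) / |F p|`, together with the relations between
the integrals and conditional averages of `s` and `f` that come with the convergence. -/
structure IsErgodicLimit (ν : Measure Y) (T : G → Y → Y) (s : Finset G → Y → ℝ)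
    (F : ℕ → Finset G) (φ : ℕ → G →* G) (𝒩 : Set ℕ) (f : Y → ℝ) : Prop where
  measurable : Measurable f
  integrable : Integrable f ν
  tendsto : ∀ᵐ y ∂ν, Tendsto (fun p => s (F p) y / (F p).card) atTop (𝓝 (f y))
  integral_tendsto :
    Tendsto (fun p => (∫ y, s (F p) y ∂ν) / (F p).card) atTop (𝓝 (∫ y, f y ∂ν))
  integral_tile_le : ∀ K : Finset G, Tiles K → ∫ y, s K y ∂ν ≤ (∫ y, f y ∂ν) * K.card
  tileAvg_le : ∀ m ∈ 𝒩, ∀ᵐ y ∂ν, tileAvg ν T s (F m) (φ m) y ≤ f y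

/-- The pointwise ergodic theorem for bounded super-additive families. -/
theorem TilingSystem.superadditive [Countable G] [Infinite G] (sys : TilingSystem F φ M 𝒩)
    (hT : MPAction ν T) (h : SuperFamily ν T s) (hL : ∀ E y, s E y ≤ L * E.card) :
    ∃ f : Y → ℝ, IsErgodicLimit ν T s F φ 𝒩 f := by
  obtain ⟨γ, hγ, hγK⟩ := h.exists_rate hT hL sys.folner fun n => ⟨_, sys.tiles n⟩
  obtain ⟨f, hfm, hf⟩ := measurable_limit_of_tendsto_metrizable_ae
    (fun p => ((h.integrable (F p)).aestronglyMeasurable.aemeasurable.div_const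
      ((F p).card : ℝ))) (sys.exists_limit hT h hL)
  have hbd : ∀ p, ∀ᵐ y ∂ν, ‖s (F p) y / (F p).card‖ ≤ L := by
    intro p
    filter_upwards [h.superAt] with y hy
    have hp := card_pos' sys.folner p
    rw [Real.norm_of_nonneg (div_nonneg (hy.nonneg _) hp.le), div_le_iff₀ hp]
    exact hL _ _
  have hfi : Integrable f ν := by
    refine Integrable.of_bound hfm.aestronglyMeasurable L ?_
    filter_upwards [hf, ae_all_iff.2 hbd] with y h1 h2
    exact le_of_tendsto' h1.norm h2
  have hlim : Tendsto (fun p => (∫ y, s (F p) y ∂ν) / (F p).card) atTop (𝓝 (∫ y, f y ∂ν)) := by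
    have := tendsto_integral_of_dominated_convergence (fun _ => L)
      (fun p => ((h.integrable (F p)).div_const ((F p).card : ℝ)).aestronglyMeasurable)
      (integrable_const L) hbd hf
    simpa only [integral_div] using this
  have hγf := tendsto_nhds_unique hγ hlim
  rw [hγf] at hγK
  refine ⟨f, hfm, hfi, hf, hlim, hγK, fun m hm => ?_⟩
  filter_upwards [sys.lower_bound hT h hm, hf] with y ⟨w, hw, hw'⟩ h2
  exact le_of_tendsto_of_tendsto hw h2 hw'

omit [IsProbabilityMeasure ν] [DecidableEq G] in
lemma integral_tileAvg [IsFiniteMeasure ν] (K : Finset G) (φ : G →* G) :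
    ∫ y, tileAvg ν T s K φ y ∂ν = (∫ y, s K y ∂ν) / K.card := by
  unfold tileAvg
  rw [integral_div, integral_condExp (invSigma_le fun g => T (φ g))]

omit [IsProbabilityMeasure ν] [DecidableEq G] in
lemma integrable_tileAvg (K : Finset G) (φ : G →* G) :
    Integrable (tileAvg ν T s K φ) ν := integrable_condExp.div_const _

omit [DecidableEq G] in
lemma tileAvg_apply (ν : Measure Y) (T : G → Y → Y) (s : Finset G → Y → ℝ) (K : Finset G)
    (φ : G →* G) (g : G) (y : Y) : tileAvg ν T s K φ (T (φ g) y) = tileAvg ν T s K φ y := by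
  unfold tileAvg
  rw [condExp_invSigma_apply ν (fun g => T (φ g)) (s K) g y]

end Superadditive

section Invariance

variable {G : Type*} [Group G] {Y : Type*} [MeasurableSpace Y] {ν : Measure Y}
  {T : G → Y → Y}

lemma integral_abs_comp_sub_le (hT : MPAction ν T) {f b : Y → ℝ} (hf : Integrable f ν)
    (hb : Integrable b ν) (g : G) (h₁ : ∀ᵐ y ∂ν, b y ≤ f y) (h₂ : ∀ᵐ y ∂ν, b (T g y) ≤ f y) :
    ∫ y, |f (T g y) - f y| ∂ν ≤ 2 * (∫ y, f y ∂ν - ∫ y, b y ∂ν) := by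
  have hfg := integrable_comp hT hf g
  have hbg := integrable_comp hT hb g
  have h3 : ∀ᵐ y ∂ν, |f (T g y) - f y| ≤ (f (T g y) - b (T g y)) + (f y - b (T g y)) := by
    filter_upwards [(hT.mp g).quasiMeasurePreserving.ae h₁, h₂] with y h4 h5
    rw [abs_le]
    constructor <;> linarith
  refine (integral_mono_ae (hfg.sub hf).abs ((hfg.sub hbg).add (hf.sub hbg)) h3).trans
    (le_of_eq ?_)
  have h4 := integral_add (hfg.sub hbg) (hf.sub hbg)
  have h5 := integral_sub hfg hbg
  have h6 := integral_sub hf hbg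
  have h7 := integral_comp hT hf.aestronglyMeasurable g
  have h8 := integral_comp hT hb.aestronglyMeasurable g
  simp only [Pi.add_apply, Pi.sub_apply] at h4 h5 h6 ⊢
  linarith

lemma ae_comp_eq_of_integral_abs_le (hT : MPAction ν T) {f : Y → ℝ} (hf : Integrable f ν) (g : G)
    (h : ∀ ε > 0, ∫ y, |f (T g y) - f y| ∂ν ≤ ε) : ∀ᵐ y ∂ν, f (T g y) = f y := by
  have h0 : ∫ y, |f (T g y) - f y| ∂ν = 0 :=
    le_antisymm (le_of_forall_pos_le_add fun ε hε => by simpa using h ε hε)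
      (integral_nonneg fun _ => abs_nonneg _)
  have h1 := (integral_eq_zero_iff_of_nonneg (fun _ => abs_nonneg _)
    ((integrable_comp hT hf g).sub hf).abs).1 h0
  filter_upwards [h1] with y hy
  exact sub_eq_zero.1 (abs_eq_zero.1 hy)

variable [DecidableEq G] [IsProbabilityMeasure ν] {s : Finset G → Y → ℝ}
  {F : ℕ → Finset G} {φ : ℕ → G →* G} {M : ℝ} {𝒩 : Set ℕ} {L : ℝ} {f : Y → ℝ}

omit [DecidableEq G] [IsProbabilityMeasure ν] in
lemma IsErgodicLimit.eventually_gap (hf : IsErgodicLimit ν T s F φ 𝒩 f) {ε : ℝ} (hε : 0 < ε) :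
    ∀ᶠ m in atTop, 2 * (∫ y, f y ∂ν - (∫ y, s (F m) y ∂ν) / (F m).card) ≤ ε := by
  have h := (hf.integral_tendsto.const_sub (∫ y, f y ∂ν)).const_mul 2
  rw [sub_self, mul_zero] at h
  exact h.eventually (ge_mem_nhds hε)

lemma IsErgodicLimit.ae_comp_eq_of_tileAvg (hf : IsErgodicLimit ν T s F φ 𝒩 f)
    (sys : TilingSystem F φ M 𝒩) (hT : MPAction ν T) (g : G) (ψ : ℕ → G →* G)
    (h₁ : ∀ m ∈ 𝒩, ∀ᵐ y ∂ν, tileAvg ν T s (F m) (ψ m) y ≤ f y)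
    (h₂ : ∀ m ∈ 𝒩, ∀ᵐ y ∂ν, tileAvg ν T s (F m) (ψ m) (T g y) ≤ f y) :
    ∀ᵐ y ∂ν, f (T g y) = f y := by
  refine ae_comp_eq_of_integral_abs_le hT hf.integrable g fun ε hε => ?_
  obtain ⟨m, hm, hmε⟩ := (sys.frequently.and_eventually (hf.eventually_gap hε)).exists
  refine le_trans ?_ hmε
  have := integral_abs_comp_sub_le hT hf.integrable (integrable_tileAvg (F m) (ψ m)) g
    (h₁ m hm) (h₂ m hm)
  rwa [integral_tileAvg] at this

omit [DecidableEq G] in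
/-- Invariance when the tiling subgroups of late terms generate `G` as products. -/
lemma IsErgodicLimit.invariant_of_mul (hf : IsErgodicLimit ν T s F φ 𝒩 f) (hT : MPAction ν T)
    (hH : ∀ N : ℕ, ∃ p ∈ 𝒩, ∃ m ∈ 𝒩, N ≤ p ∧ N ≤ m ∧
      Set.range (φ m) * Set.range (φ p) = Set.univ) (g : G) :
    ∀ᵐ y ∂ν, f (T g y) = f y := by
  have key : ∀ m ∈ 𝒩, ∀ h, ∫ y, |f (T (φ m h) y) - f y| ∂ν
      ≤ 2 * (∫ y, f y ∂ν - (∫ y, s (F m) y ∂ν) / (F m).card) := by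
    intro m hm h
    have := integral_abs_comp_sub_le hT hf.integrable (integrable_tileAvg (F m) (φ m)) (φ m h)
      (hf.tileAvg_le m hm) (by simpa only [tileAvg_apply] using hf.tileAvg_le m hm)
    rwa [integral_tileAvg] at this
  refine ae_comp_eq_of_integral_abs_le hT hf.integrable g fun ε hε => ?_
  obtain ⟨N, hN⟩ := eventually_atTop.1 (hf.eventually_gap (half_pos hε))
  obtain ⟨p, hp, m, hm, hNp, hNm, hHH⟩ := hH N
  obtain ⟨_, ⟨h, rfl⟩, _, ⟨k, rfl⟩, hg⟩ := Set.mem_mul.1 (hHH ▸ Set.mem_univ g)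
  have hi : ∀ g, Integrable (fun y => |f (T g y) - f y|) ν := fun g =>
    ((integrable_comp hT hf.integrable g).sub hf.integrable).abs
  have hi₁ := integrable_comp hT (hi (φ m h)) (φ p k)
  have h1 := (key m hm h).trans (hN m hNm)
  have h2 := (key p hp k).trans (hN p hNp)
  rw [← integral_comp hT (hi (φ m h)).aestronglyMeasurable (φ p k)] at h1
  refine le_trans (integral_mono (hi g) (hi₁.add (hi (φ p k))) fun y => ?_) ?_
  · simp only [Pi.add_apply]
    rw [← hg, hT.mul]
    exact abs_sub_le _ _ _
  · refine (integral_add hi₁ (hi (φ p k))).le.trans ?_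
    linarith

omit [IsProbabilityMeasure ν] in
/-- At a point where `s` is bi-invariant, the average of `s K` at a translate of the point is
controlled by `s`. -/
lemma SuperAt.sum_comp_le {y : Y} (h : SuperAt T s y) (hT : MPAction ν T)
    (hL : ∀ E y, s E y ≤ L * E.card)
    (hbi : ∀ (E : Finset G) g, s (E.image (g * ·)) y = s (E.image (· * g)) y)
    {K : Finset G} {ψ : G →* G} (hψ : Function.Injective ψ) (hK : TilesWith K (Set.range ψ))
    (g : G) {E P : Finset G} (hEP : K * E.image ψ ⊆ P) :
    ∑ e ∈ E, s K (T (ψ e) (T g y)) ≤ s P y + (P \ interior {g} P).card * (L * K.card) := by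
  set A := E.filter fun e => ∀ k ∈ K, g * (k * ψ e) ∈ P with hA
  have hAsum : ∑ e ∈ A, s K (T (ψ e) (T g y)) ≤ s P y := by
    have h1 : ∀ e ∈ A, s K (T (ψ e) (T g y)) = s ((K.image (· * ψ e)).image (g * ·)) y := by
      intro e _
      rw [hbi, Finset.image_image, ← hT.mul, ← h.equivariant]
      congr 2
      funext x
      simp [mul_assoc]
    rw [Finset.sum_congr rfl h1]
    refine h.sum_le A _ P ?_ ?_
    · intro e he e' he' hne
      have := hK.pairwiseDisjoint_s17 E
        (Finset.mem_coe.2 (Finset.mem_image_of_mem ψ (Finset.mem_filter.1 he).1))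
        (Finset.mem_coe.2 (Finset.mem_image_of_mem ψ (Finset.mem_filter.1 he').1))
        (fun heq => hne (hψ heq))
      exact (Finset.disjoint_image (mul_right_injective g)).2 this
    · intro e he x hx
      obtain ⟨_, hx', rfl⟩ := Finset.mem_image.1 hx
      obtain ⟨k, hk, rfl⟩ := Finset.mem_image.1 hx'
      exact (Finset.mem_filter.1 he).2 k hk
  have hcard : (E \ A).card ≤ (P \ interior {g} P).card := by
    have hex : ∀ e, ∃ k, e ∈ E \ A → k ∈ K ∧ g * (k * ψ e) ∉ P := by
      intro e
      by_cases he : e ∈ E \ A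
      · have h2 := Finset.mem_sdiff.1 he
        have h3 : ¬ ∀ k ∈ K, g * (k * ψ e) ∈ P := fun h =>
          h2.2 (Finset.mem_filter.2 ⟨h2.1, h⟩)
        push Not at h3
        exact h3.imp fun k hk _ => hk
      · exact ⟨1, fun h => absurd h he⟩
    choose k hk using hex
    refine Finset.card_le_card_of_injOn (fun e => k e * ψ e) ?_ ?_
    · intro e he
      have h2 := hk e he
      refine Finset.mem_coe.2 (Finset.mem_sdiff.2 ⟨hEP (Finset.mul_mem_mul h2.1
        (Finset.mem_image_of_mem ψ (Finset.mem_sdiff.1 he).1)), fun h3 => h2.2 ?_⟩)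
      exact (mem_interior.1 h3).2 g (Finset.mem_singleton_self g)
    · intro e he e' he' heq
      exact hψ (hK.eq_of_mul_eq (hk e he).1 (hk e' he').1 ⟨e, rfl⟩ ⟨e', rfl⟩ heq)
  have hrest : ∑ e ∈ E \ A, s K (T (ψ e) (T g y)) ≤ (E \ A).card * (L * K.card) := by
    rw [← nsmul_eq_mul]
    exact Finset.sum_le_card_nsmul _ _ _ fun e _ => hL _ _
  have hLK : 0 ≤ L * K.card := (h.nonneg K).trans (hL K y)
  rw [← Finset.sum_sdiff (show A ⊆ E from Finset.filter_subset _ E)]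
  have : ((E \ A).card : ℝ) * (L * K.card) ≤ (P \ interior {g} P).card * (L * K.card) := by
    gcongr
  linarith

/-- Invariance under bi-invariance. -/
lemma IsErgodicLimit.invariant_of_biinvariant [Countable G] [Infinite G]
    (hf : IsErgodicLimit ν T s F φ 𝒩 f)
    (sys : TilingSystem F φ M 𝒩) (hT : MPAction ν T) (h : SuperFamily ν T s)
    (hL : ∀ E y, s E y ≤ L * E.card)
    (hbi : ∀ᵐ y ∂ν, ∀ (E : Finset G) g, s (E.image (g * ·)) y = s (E.image (· * g)) y) (g : G) :
    ∀ᵐ y ∂ν, f (T g y) = f y := by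
  refine hf.ae_comp_eq_of_tileAvg sys hT g φ hf.tileAvg_le fun m hm => ?_
  obtain ⟨k₁, k₂, hk, -, hr₂, -, ht₂⟩ := exists_approx_seq sys.folner (sys.folner.1 m)
    (sys.injective m) (sys.tiles m) (sys.approx m hm)
  filter_upwards [(hT.mp g).quasiMeasurePreserving.ae (sys.tendsto_avg hT (h.integrable (F m)) m),
    h.superAt, hbi, hf.tendsto] with y hy hs hb hlim
  have h1 := (hy.comp ht₂).mul hr₂
  have h2 := hlim.add ((tendsto_sdiff_interior sys.folner {g}).mul_const (L * (F m).card))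
  rw [zero_mul, add_zero] at h2
  refine le_of_tendsto_of_tendsto h1 h2 (hk.mono fun p hp => ?_)
  have h3 := hs.sum_comp_le hT hL hb (sys.injective m) (sys.tiles m) g hp.2
  have h4 := card_pos' sys.folner (k₂ p)
  have h5 := card_pos' sys.folner p
  simp only [Function.comp_apply]
  rw [div_mul_div_cancel₀ h4.ne', div_mul_eq_mul_div, ← add_div]
  gcongr

omit [Group G] in
/-- A monotone supermodular function is dominated by an additive one with the same value on `P`. -/
lemma exists_additive_majorant {v : Finset G → ℝ} (h₀ : v ∅ = 0)
    (hmono : ∀ E E', E ⊆ E' → v E ≤ v E')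
    (hsm : ∀ E E', v E + v E' ≤ v (E ∩ E') + v (E ∪ E')) (P : Finset G) :
    ∃ c : G → ℝ, (∀ x, 0 ≤ c x) ∧ (∀ E ⊆ P, v E ≤ ∑ x ∈ E, c x) ∧ ∑ x ∈ P, c x = v P := by
  induction P using Finset.induction_on with
  | empty =>
    refine ⟨fun _ => 0, fun _ => le_rfl, fun E hE => ?_, by simp [h₀]⟩
    simp [Finset.subset_empty.1 hE, h₀]
  | insert a P ha ih =>
    obtain ⟨c, hc0, hcE, hcP⟩ := ih
    have hsum : ∀ E : Finset G, a ∉ E →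
        ∑ x ∈ E, Function.update c a (v (insert a P) - v P) x = ∑ x ∈ E, c x := by
      intro E hE
      refine Finset.sum_congr rfl fun x hx => Function.update_of_ne ?_ _ _
      rintro rfl
      exact hE hx
    refine ⟨Function.update c a (v (insert a P) - v P), fun x => ?_, fun E hE => ?_, ?_⟩
    · by_cases hx : x = a
      · subst hx
        simpa using hmono _ _ (Finset.subset_insert x P)
      · simpa [hx] using hc0 x
    · by_cases haE : a ∈ E
      · have h1 := hcE (E.erase a) (by rwa [← Finset.subset_insert_iff])
        have h2 := hsm E P
        have h3 : E ∩ P = E.erase a := by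
          ext x
          have := @hE x
          simp only [Finset.mem_inter, Finset.mem_erase, Finset.mem_insert] at this ⊢
          constructor
          · exact fun hx => ⟨fun h => ha (h ▸ hx.2), hx.1⟩
          · exact fun hx => ⟨hx.2, (this hx.2).resolve_left hx.1⟩
        have h4 : E ∪ P = insert a P :=
          subset_antisymm (Finset.union_subset hE (Finset.subset_insert a P))
            (Finset.insert_subset (Finset.mem_union_left _ haE) Finset.subset_union_right)
        rw [h3, h4] at h2
        rw [← Finset.add_sum_erase _ _ haE, hsum _ (Finset.notMem_erase a E),
          Function.update_self]
        linarith
      · rw [hsum E haE]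
        exact hcE E ((Finset.subset_insert_iff_of_notMem haE).1 hE)
    · rw [Finset.sum_insert ha, hsum P ha, Function.update_self, hcP]
      ring

lemma sum_interior_le {v : Finset G → ℝ} (h₀ : v ∅ = 0)
    (hmono : ∀ E E', E ⊆ E' → v E ≤ v E')
    (hsm : ∀ E E', v E + v E' ≤ v (E ∩ E') + v (E ∪ E')) (K P : Finset G) :
    ∑ g ∈ interior K P, v (K.image (· * g)) ≤ K.card * v P := by
  obtain ⟨c, hc0, hcE, hcP⟩ := exists_additive_majorant h₀ hmono hsm P
  calc ∑ g ∈ interior K P, v (K.image (· * g))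
      ≤ ∑ g ∈ interior K P, ∑ k ∈ K, c (k * g) := by
        refine Finset.sum_le_sum fun g hg => ?_
        refine (hcE _ ?_).trans (le_of_eq ?_)
        · intro x hx
          obtain ⟨k, hk, rfl⟩ := Finset.mem_image.1 hx
          exact (mem_interior.1 hg).2 k hk
        · exact Finset.sum_image fun _ _ _ _ h => mul_right_cancel h
    _ = ∑ k ∈ K, ∑ g ∈ interior K P, c (k * g) := Finset.sum_comm
    _ ≤ ∑ k ∈ K, v P := by
        refine Finset.sum_le_sum fun k hk => ?_
        rw [← hcP, ← Finset.sum_image (f := c) (g := fun g => k * g)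
          fun _ _ _ _ h => mul_left_cancel h]
        refine Finset.sum_le_sum_of_subset_of_nonneg ?_ fun x _ _ => hc0 x
        intro x hx
        obtain ⟨g, hg, rfl⟩ := Finset.mem_image.1 hx
        exact (mem_interior.1 hg).2 k hk
    _ = K.card * v P := by simp

omit [MeasurableSpace Y] in
lemma SuperAt.sum_interior_trunc_le {y : Y} (h : SuperAt T s y) (h₀ : s ∅ y = 0)
    (hsm : ∀ E E', s E y + s E' y ≤ s (E ∩ E') y + s (E ∪ E') y) (hL : 0 ≤ L)
    (K P : Finset G) :
    ∑ g ∈ interior K P, FolnerErgodic.trunc L s K (T g y) ≤ K.card * FolnerErgodic.trunc L s P y := by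
  have h1 := sum_interior_le (v := fun E => s E y) h₀ (fun E E' hE => h.mono hE) hsm K P
  simp only [h.equivariant] at h1
  rw [FolnerErgodic.trunc, mul_min_of_nonneg _ _ (Nat.cast_nonneg _)]
  refine le_min (le_trans (Finset.sum_le_sum fun g _ => min_le_left _ _) h1) ?_
  refine (Finset.sum_le_card_nsmul _ _ _ fun g _ => trunc_le L s K _).trans ?_
  rw [nsmul_eq_mul]
  have : ((interior K P).card : ℝ) ≤ P.card := by
    exact_mod_cast Finset.card_le_card (interior_subset K P)
  calc ((interior K P).card : ℝ) * (L * K.card) ≤ P.card * (L * K.card) := by gcongr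
    _ = _ := by ring

/-- Invariance when all averages of a tile over a set are controlled by the family. -/
lemma IsErgodicLimit.invariant_of_sum_interior_le [Countable G]
    (hf : IsErgodicLimit ν T s F φ 𝒩 f)
    (sys : TilingSystem F φ M 𝒩) (hT : MPAction ν T) (h : SuperFamily ν T s)
    (hL : ∀ E y, s E y ≤ L * E.card)
    (hsum : ∀ᵐ y ∂ν, ∀ K P, ∑ g ∈ interior K P, s K (T g y) ≤ K.card * s P y) (g : G) :
    ∀ᵐ y ∂ν, f (T g y) = f y := by
  have key : ∀ m, ∀ᵐ y ∂ν, tileAvg ν T s (F m) (MonoidHom.id G) y ≤ f y := by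
    intro m
    have hm := card_pos' sys.folner m
    filter_upwards [convAvg_of_integrable hT sys.folner sys.pos sys.tempelman
      (h.integrable (F m)), hsum, hf.tendsto] with y hy hs hlim
    have h1 := (hlim.add ((tendsto_sdiff_interior sys.folner (F m)).mul_const L)).const_mul
      ((F m).card : ℝ)
    rw [zero_mul, add_zero] at h1
    rw [tileAvg, div_le_iff₀' hm]
    refine le_of_tendsto_of_tendsto' hy h1 fun p => ?_
    have h5 := card_pos' sys.folner p
    rw [avg, div_mul_eq_mul_div, ← add_div, ← mul_div_assoc]
    gcongr
    rw [← Finset.sum_sdiff (interior_subset (F m) (F p)), mul_add, add_comm]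
    refine add_le_add (hs _ _) ((Finset.sum_le_card_nsmul _ _ _ fun g _ => hL _ _).trans
      (le_of_eq ?_))
    rw [nsmul_eq_mul]
    ring
  refine hf.ae_comp_eq_of_tileAvg sys hT g (fun _ => MonoidHom.id G) (fun m _ => key m)
    fun m _ => ?_
  filter_upwards [key m] with y hy
  have := tileAvg_apply ν T s (F m) (MonoidHom.id G) g y
  rw [MonoidHom.id_apply] at this
  rwa [this]

end Invariance

section ExtendedReal

lemma tendsto_iSup_of_tendsto_min {u f : ℕ → ℝ} (hu : ∀ n, 0 ≤ u n)
    (h : ∀ L : ℕ, Tendsto (fun n => min (u n) L) atTop (𝓝 (f L))) :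
    Tendsto (fun n => (u n : EReal)) atTop (𝓝 (⨆ L, (f L : EReal))) := by
  refine tendsto_order.2 ⟨fun a ha => ?_, fun a ha => ?_⟩
  · obtain ⟨L, hL⟩ := lt_iSup_iff.1 ha
    filter_upwards [(EReal.tendsto_coe.2 (h L)).eventually (lt_mem_nhds hL)] with n hn
    exact hn.trans_le (EReal.coe_le_coe_iff.2 (min_le_left _ _))
  · have h0 : (0 : EReal) ≤ ⨆ L, (f L : EReal) := by
      refine le_iSup_of_le 0 ?_
      exact_mod_cast ge_of_tendsto' (h 0) fun n => le_min (hu n) (Nat.cast_nonneg 0)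
    generalize hσ : (⨆ L, (f L : EReal)) = σ at ha h0
    lift σ to ℝ using ⟨ha.ne_top, (lt_of_lt_of_le EReal.bot_lt_zero h0).ne'⟩
    obtain ⟨L, hL⟩ := exists_nat_gt σ
    have hfL : (f L : EReal) ≤ σ := hσ ▸ le_iSup (fun L => (f L : EReal)) L
    have hfL' : f L < L := (EReal.coe_le_coe_iff.1 hfL).trans_lt hL
    filter_upwards [(h L).eventually (gt_mem_nhds hfL'),
      (EReal.tendsto_coe.2 (h L)).eventually (gt_mem_nhds (hfL.trans_lt ha))] with n h1 h2
    rwa [min_eq_left ((min_lt_iff.1 h1).resolve_right (lt_irrefl _)).le] at h2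

lemma tendsto_sub_iSup {u w f : ℕ → ℝ} {a : ℝ} (hu : ∀ n, 0 ≤ u n)
    (h : ∀ L : ℕ, Tendsto (fun n => min (u n) L) atTop (𝓝 (f L))) (hw : Tendsto w atTop (𝓝 a)) :
    Tendsto (fun n => ((w n - u n : ℝ) : EReal)) atTop (𝓝 ((a : EReal) - ⨆ L, (f L : EReal))) := by
  have h1 := (continuous_neg.tendsto _).comp (tendsto_iSup_of_tendsto_min hu h)
  have h2 := (EReal.continuousAt_add (p := ((a : EReal), -⨆ L, (f L : EReal)))
    (Or.inl (EReal.coe_ne_top a)) (Or.inl (EReal.coe_ne_bot a))).tendsto.comp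
    ((EReal.tendsto_coe.2 hw).prodMk_nhds h1)
  exact h2

lemma erealPosPart_le {x : EReal} {r : ℝ} (h : x ≤ r) :
    erealPosPart x ≤ ENNReal.ofReal r := by
  have hx : x ≠ ⊤ := (h.trans_lt (EReal.coe_lt_top r)).ne
  rw [erealPosPart, if_neg hx]
  induction x with
  | bot => simp
  | coe x => exact ENNReal.ofReal_le_ofReal (EReal.coe_le_coe_iff.1 h)
  | top => exact absurd rfl hx

lemma le_erealPosPart {x : EReal} {r : ℝ} (h : r ≤ x) :
    ENNReal.ofReal r ≤ erealPosPart x := by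
  rw [erealPosPart]
  split_ifs with hx
  · exact le_top
  · refine ENNReal.ofReal_le_ofReal ?_
    simpa using EReal.toReal_le_toReal h (EReal.coe_ne_bot r) hx

variable {Y : Type*} [MeasurableSpace Y] {ν : Measure Y}

lemma ofReal_integral_le_lintegral {f : Y → ℝ} (hf : Integrable f ν) :
    ENNReal.ofReal (∫ y, f y ∂ν) ≤ ∫⁻ y, ENNReal.ofReal (f y) ∂ν := by
  rw [integral_eq_lintegral_pos_part_sub_lintegral_neg_part hf]
  refine (ENNReal.ofReal_le_ofReal (sub_le_self _ ENNReal.toReal_nonneg)).trans ?_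
  exact ENNReal.ofReal_toReal_le

/-- An extended real valued function with integrable upper bound, lying below integrable functions
with arbitrarily negative integrals, has integral `⊥`. -/
lemma erealIntegral_eq_bot {D : Y → EReal} {f₀ : Y → ℝ} (h₀ : Integrable f₀ ν)
    (hD₀ : ∀ᵐ y ∂ν, D y ≤ f₀ y)
    (h : ∀ r : ℝ, ∃ b : Y → ℝ, Integrable b ν ∧ (∀ᵐ y ∂ν, D y ≤ b y) ∧ ∫ y, b y ∂ν ≤ r) :
    erealIntegral ν D = ⊥ := by
  have htop : ∫⁻ y, erealPosPart (-(D y)) ∂ν = ⊤ := by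
    refine ENNReal.eq_top_of_forall_nnreal_le fun r => ?_
    obtain ⟨b, hb, hDb, hbr⟩ := h (-r)
    calc (r : ℝ≥0∞) = ENNReal.ofReal r := by simp
      _ ≤ ENNReal.ofReal (∫ y, -b y ∂ν) := by
        refine ENNReal.ofReal_le_ofReal ?_
        rw [integral_neg]
        linarith
      _ ≤ ∫⁻ y, ENNReal.ofReal (-b y) ∂ν := ofReal_integral_le_lintegral hb.neg
      _ ≤ _ := by
        refine lintegral_mono_ae (hDb.mono fun y hy => le_erealPosPart ?_)
        rw [EReal.coe_neg]
        exact EReal.neg_le_neg_iff.2 hy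
  have hfin : ∫⁻ y, erealPosPart (D y) ∂ν ≠ ⊤ := by
    refine ne_top_of_le_ne_top ?_ (lintegral_mono_ae (hD₀.mono fun y hy => erealPosPart_le hy))
    exact ((lintegral_ofReal_le_lintegral_enorm f₀).trans_lt h₀.2).ne
  rw [erealIntegral, htop, EReal.coe_ennreal_top, EReal.sub_top]

end ExtendedReal

section Supplement

variable {G : Type*} [Group G] [DecidableEq G] {Y : Type*} [MulAction G Y]

/-- The super-additive family complementary to a sub-additive family `d`. -/
noncomputable def supplement (d : Finset G → Y → ℝ) (E : Finset G) (y : Y) : ℝ :=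
  if E = ∅ then 0 else ∑ h ∈ E, d {1} (h • y) - d E y

/-- At the point `y`, the family `d` is equivariant and sub-additive. -/
structure SubAt (d : Finset G → Y → ℝ) (y : Y) : Prop where
  equivariant : ∀ E : Finset G, E.Nonempty → ∀ g, d (E.image (· * g)) y = d E (g • y)
  sub : ∀ E E' : Finset G, E.Nonempty → E'.Nonempty → Disjoint E E' →
    d (E ∪ E') y ≤ d E y + d E' y

variable {d : Finset G → Y → ℝ} {y : Y}

lemma supplement_empty (d : Finset G → Y → ℝ) (y : Y) : supplement d ∅ y = 0 := if_pos rfl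

lemma supplement_of_nonempty {E : Finset G} (hE : E.Nonempty) (d : Finset G → Y → ℝ) (y : Y) :
    supplement d E y = ∑ h ∈ E, d {1} (h • y) - d E y := if_neg hE.ne_empty

lemma SubAt.singleton (h : SubAt d y) (g : G) : d {g} y = d {1} (g • y) := by
  have := h.equivariant {1} (Finset.singleton_nonempty 1) g
  simpa using this

lemma SubAt.supplement (h : SubAt d y) : SuperAt (fun g y => g • y) (supplement d) y := by
  have hsuper : ∀ E E', Disjoint E E' → FolnerErgodic.supplement d E y
      + FolnerErgodic.supplement d E' y ≤ FolnerErgodic.supplement d (E ∪ E') y := by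
    intro E E' hd
    rcases E.eq_empty_or_nonempty with rfl | hE
    · simp [supplement_empty]
    rcases E'.eq_empty_or_nonempty with rfl | hE'
    · simp [supplement_empty]
    rw [supplement_of_nonempty hE, supplement_of_nonempty hE',
      supplement_of_nonempty (hE.mono Finset.subset_union_left), Finset.sum_union hd]
    linarith [h.sub E E' hE hE' hd]
  refine ⟨fun E => ?_, hsuper, fun E g => ?_⟩
  · induction E using Finset.induction_on with
    | empty => simp [supplement_empty]
    | insert a E ha ih =>
      refine le_trans ?_ (hsuper {a} E (Finset.disjoint_singleton_left.2 ha))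
      rw [supplement_of_nonempty (Finset.singleton_nonempty a), Finset.sum_singleton,
        h.singleton]
      simpa using ih
  · rcases E.eq_empty_or_nonempty with rfl | hE
    · simp [supplement_empty]
    rw [supplement_of_nonempty hE, supplement_of_nonempty (hE.image _), h.equivariant E hE,
      Finset.sum_image fun _ _ _ _ hab => mul_right_cancel hab]
    simp [mul_smul]

lemma SubAt.supplement_biinvariant (h : SubAt d y)
    (hbi : ∀ E : Finset G, E.Nonempty → ∀ g,
      d (E.image (g * ·)) y = d (E.image (· * g)) y) (E : Finset G) (g : G) :
    FolnerErgodic.supplement d (E.image (g * ·)) y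
      = FolnerErgodic.supplement d (E.image (· * g)) y := by
  rcases E.eq_empty_or_nonempty with rfl | hE
  · simp
  rw [supplement_of_nonempty (hE.image _), supplement_of_nonempty (hE.image _), hbi E hE g,
    Finset.sum_image fun _ _ _ _ hab => mul_left_cancel hab,
    Finset.sum_image fun _ _ _ _ hab => mul_right_cancel hab]
  congr 1
  refine Finset.sum_congr rfl fun e _ => ?_
  have := hbi {e} (Finset.singleton_nonempty e) g
  rwa [Finset.image_singleton, Finset.image_singleton, h.singleton, h.singleton] at this

lemma supplement_supermodular (h₀ : d ∅ y = 0)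
    (hs : ∀ E E' : Finset G, d (E ∩ E') y + d (E ∪ E') y ≤ d E y + d E' y) (E E' : Finset G) :
    supplement d E y + supplement d E' y ≤ supplement d (E ∩ E') y + supplement d (E ∪ E') y := by
  have h1 : ∀ E, supplement d E y = ∑ h ∈ E, d {1} (h • y) - d E y := by
    intro E
    rcases E.eq_empty_or_nonempty with rfl | hE
    · simp [supplement_empty, h₀]
    · exact supplement_of_nonempty hE d y
  simp only [h1]
  have := Finset.sum_union_inter (s₁ := E) (s₂ := E') (f := fun h => d {1} (h • y))
  linarith [hs E E']

end Supplement

section Assembly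

variable {G : Type*} [Group G] [DecidableEq G] {Y : Type*} [MeasurableSpace Y]
  [MulAction G Y] {ν : Measure Y}

omit [DecidableEq G] in
lemma mpAction_smul (hact : ∀ g : G, MeasurePreserving (fun y : Y => g • y) ν ν) :
    MPAction ν fun (g : G) (y : Y) => g • y where
  mp := hact
  one := one_smul G
  mul := mul_smul

variable {d : Finset G → Y → ℝ}

lemma superFamily_supplement (hact : ∀ g : G, MeasurePreserving (fun y : Y => g • y) ν ν)
    (hint : ∀ E : Finset G, E.Nonempty → Integrable (d E) ν) (hd : ∀ᵐ y ∂ν, SubAt d y) :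
    SuperFamily ν (fun g y => g • y) (supplement d) where
  integrable E := by
    rcases E.eq_empty_or_nonempty with rfl | hE
    · exact (integrable_zero Y ℝ ν).congr
        (Eventually.of_forall fun y => (supplement_empty d y).symm)
    · refine Integrable.congr ((integrable_finsetSum E fun g _ =>
        integrable_comp (mpAction_smul hact) (hint {1} (Finset.singleton_nonempty 1)) g).sub
        (hint E hE)) (Eventually.of_forall fun y => ?_)
      exact (supplement_of_nonempty hE d y).symm
  superAt := hd.mono fun _ hy => hy.supplement

lemma integral_supplement (hact : ∀ g : G, MeasurePreserving (fun y : Y => g • y) ν ν)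
    (hint : ∀ E : Finset G, E.Nonempty → Integrable (d E) ν) {E : Finset G} (hE : E.Nonempty) :
    ∫ y, supplement d E y ∂ν = E.card * ∫ y, d {1} y ∂ν - ∫ y, d E y ∂ν := by
  have h1 := hint {1} (Finset.singleton_nonempty 1)
  have hT := mpAction_smul hact
  simp_rw [supplement_of_nonempty hE]
  rw [integral_sub (integrable_finsetSum E fun g _ => integrable_comp hT h1 g) (hint E hE),
    integral_finsetSum E fun g _ => integrable_comp hT h1 g,
    Finset.sum_congr rfl fun g _ => integral_comp hT h1.aestronglyMeasurable g]
  simp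

omit [MulAction G Y] in
lemma SuperFamily.tendsto_integral_trunc {T : G → Y → Y} {s : Finset G → Y → ℝ}
    (h : SuperFamily ν T s) {E : Finset G} (hE : E.Nonempty) :
    Tendsto (fun L : ℕ => ∫ y, FolnerErgodic.trunc L s E y ∂ν) atTop (𝓝 (∫ y, s E y ∂ν)) := by
  have hEpos : (0 : ℝ) < E.card := by exact_mod_cast hE.card_pos
  refine tendsto_integral_of_dominated_convergence (s E)
    (fun L => (h.integrable E).aestronglyMeasurable.inf aestronglyMeasurable_const)
    (h.integrable E) (fun L => ?_) (Eventually.of_forall fun y => ?_)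
  · filter_upwards [h.superAt] with y hy
    rw [Real.norm_of_nonneg ((hy.trunc (Nat.cast_nonneg L)).nonneg E)]
    exact min_le_left _ _
  · refine tendsto_const_nhds.congr' ?_
    obtain ⟨N, hN⟩ := exists_nat_ge (s E y / E.card)
    filter_upwards [eventually_ge_atTop N] with L hL
    refine (min_eq_left ?_).symm
    rw [← div_le_iff₀ hEpos]
    exact hN.trans (by exact_mod_cast hL)

end Assembly

end FolnerErgodic

/-- Theorem 5.4 of the paper: same as the pointwise sub-additive ergodic theorem but with
`ν(𝐃) = -∞`: there is a measurable function `d : Y → [-∞, ∞)` with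
`lim_n d_{F_n}(y)/|F_n| = d(y)` a.e. and `∫ d dν = -∞`; moreover under (i) bi-invariance,
(ii) strong sub-additivity, or (iii) the condition `G_{F_m} G_{F_p} = G` for large
`p, m ∈ 𝒩`, the limit function `d` is `G`-invariant. -/
theorem pointwise_subadditive_ergodic_theorem_bot
    {G : Type*} [Group G] [Countable G] [Infinite G] [DecidableEq G]
    {Y : Type*} [MeasurableSpace Y] [MulAction G Y]
    (ν : Measure Y) [IsProbabilityMeasure ν]
    (hact : ∀ g : G, MeasurePreserving (fun y => g • y) ν ν)
    (d : Finset G → Y → ℝ)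
    (hint : ∀ F : Finset G, F.Nonempty → Integrable (d F) ν)
    (hinv : ∀ F : Finset G, F.Nonempty → ∀ g : G,
      ∀ᵐ y ∂ν, d (F.image (· * g)) y = d F (g • y))
    (hsub : ∀ E F : Finset G, E.Nonempty → F.Nonempty → Disjoint E F →
      ∀ᵐ y ∂ν, d (E ∪ F) y ≤ d E y + d F y)
    (hνD : (⨅ T ∈ {T : Finset G | Tiles T},
      (((T.card : ℝ)⁻¹ * ∫ y, d T y ∂ν : ℝ) : EReal)) = ⊥)
    (F : ℕ → Finset G) (hF : IsFolner F)
    (H : ℕ → Subgroup G) (π : ∀ n, G ≃* H n)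
    (htile : ∀ n, TilesWith (F n) ((H n : Set G)))
    (M : ℝ) (hM : 0 < M) (hTemp : TempelmanWith F M)
    (𝒩 : Set ℕ) (h𝒩 : 𝒩.Infinite)
    (happrox : ∀ m ∈ 𝒩, ∀ δ : ℝ, 0 < δ → ∀ᶠ p in atTop, ∃ n₁ n₂ : ℕ,
      F p ⊆ F m * ((F n₁).image fun x => ((π m x : G))) ∧
      F m * ((F n₂).image fun x => ((π m x : G))) ⊆ F p ∧
      (((F n₁).card : ℝ) - ((F n₂).card : ℝ)) / ((F p).card : ℝ) < δ) :
    ∃ dlim : Y → EReal, Measurable dlim ∧ (∀ y, dlim y < ⊤) ∧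
      (∀ᵐ y ∂ν, Tendsto (fun n => ((d (F n) y / ((F n).card : ℝ) : ℝ) : EReal))
        atTop (𝓝 (dlim y))) ∧
      erealIntegral ν dlim = ⊥ ∧
      (((∀ E : Finset G, E.Nonempty → ∀ g : G,
          ∀ᵐ y ∂ν, d (E.image (g * ·)) y = d (E.image (· * g)) y) ∨
        ((∀ y, d ∅ y = 0) ∧ ∀ E E' : Finset G,
          ∀ᵐ y ∂ν, d (E ∩ E') y + d (E ∪ E') y ≤ d E y + d E' y) ∨
        (∀ N : ℕ, ∃ p ∈ 𝒩, ∃ m ∈ 𝒩, N ≤ p ∧ N ≤ m ∧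
          (H m : Set G) * (H p : Set G) = Set.univ)) →
        ∀ g : G, ∀ᵐ y ∂ν, dlim (g • y) = dlim y) := by
  have hT := FolnerErgodic.mpAction_smul hact
  set T : G → Y → Y := fun g y => g • y with hTdef
  set s := FolnerErgodic.supplement d with hs
  set φ : ℕ → G →* G := fun n => (H n).subtype.comp (π n).toMonoidHom with hφ
  have hrange : ∀ n, Set.range (φ n) = (H n : Set G) := fun n => by
    ext x
    constructor
    · rintro ⟨g, rfl⟩
      exact (π n g).2
    · intro hx
      exact ⟨(π n).symm ⟨x, hx⟩, by simp [hφ]⟩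
  have sys : FolnerErgodic.TilingSystem F φ M 𝒩 :=
    { folner := hF
      pos := hM
      tempelman := hTemp
      injective := fun n => Subtype.val_injective.comp (π n).injective
      tiles := fun n => by rw [hrange]; exact htile n
      infinite := h𝒩
      approx := happrox }
  have hd : ∀ᵐ y ∂ν, FolnerErgodic.SubAt d y := by
    have h1 : ∀ᵐ y ∂ν, ∀ E : Finset G, E.Nonempty → ∀ g, d (E.image (· * g)) y = d E (g • y) :=
      ae_all_iff.2 fun E => by
        by_cases hE : E.Nonempty
        · exact (ae_all_iff.2 (hinv E hE)).mono fun y hy _ => hy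
        · exact Eventually.of_forall fun y h => absurd h hE
    have h2 : ∀ᵐ y ∂ν, ∀ E E' : Finset G, E.Nonempty → E'.Nonempty → Disjoint E E' →
        d (E ∪ E') y ≤ d E y + d E' y :=
      ae_all_iff.2 fun E => ae_all_iff.2 fun E' => by
        by_cases h : E.Nonempty ∧ E'.Nonempty ∧ Disjoint E E'
        · exact (hsub E E' h.1 h.2.1 h.2.2).mono fun y hy _ _ _ => hy
        · exact Eventually.of_forall fun y h1 h2 h3 => absurd ⟨h1, h2, h3⟩ h
    filter_upwards [h1, h2] with y h3 h4 using ⟨h3, h4⟩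
  have hsf : FolnerErgodic.SuperFamily ν T s := FolnerErgodic.superFamily_supplement hact hint hd
  have htf : ∀ L : ℕ, FolnerErgodic.SuperFamily ν T (FolnerErgodic.trunc L s) :=
    fun L => hsf.trunc (Nat.cast_nonneg L)
  choose f hf using fun L : ℕ => sys.superadditive hT (htf L) (FolnerErgodic.trunc_le L s)
  have hd1 := hint {1} (Finset.singleton_nonempty 1)
  set f₀ : Y → ℝ := ν[d {1} | FolnerErgodic.invSigma T] with hf₀
  have hf₀i : Integrable f₀ ν := integrable_condExp
  have hf₀int : ∫ y, f₀ y ∂ν = ∫ y, d {1} y ∂ν :=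
    integral_condExp (FolnerErgodic.invSigma_le T)
  have hf₀lim := FolnerErgodic.convAvg_of_integrable hT hF hM hTemp hd1
  have hfnonneg : ∀ᵐ y ∂ν, 0 ≤ f 0 y := by
    filter_upwards [(hf 0).tendsto, (htf 0).superAt] with y h1 h2
    exact ge_of_tendsto' h1 fun n => div_nonneg (h2.nonneg _) (Nat.cast_nonneg _)
  have hle : ∀ (L : ℕ) y, (f₀ y : EReal) - ⨆ L, (f L y : EReal) ≤ ((f₀ y - f L y : ℝ) : EReal) := by
    intro L y
    rw [EReal.coe_sub]
    exact EReal.sub_le_sub le_rfl (le_iSup (fun L => (f L y : EReal)) L)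
  refine ⟨fun y => (f₀ y : EReal) - ⨆ L, (f L y : EReal), ?_, fun y => ?_, ?_, ?_, ?_⟩
  · exact (FolnerErgodic.measurable_condExp_invSigma ν T (d {1})).coe_real_ereal.sub
      (Measurable.iSup fun L => (hf L).measurable.coe_real_ereal)
  · exact (hle 0 y).trans_lt (EReal.coe_lt_top _)
  · filter_upwards [hd, hf₀lim, ae_all_iff.2 fun L => (hf L).tendsto] with y hy hw hfy
    have hsy := hy.supplement
    refine (FolnerErgodic.tendsto_sub_iSup (u := fun n => s (F n) y / (F n).card)
      (fun n => div_nonneg (hsy.nonneg _) (Nat.cast_nonneg _)) (fun L => ?_) hw).congr fun n => ?_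
    · refine (hfy L).congr fun n => ?_
      have hn := FolnerErgodic.card_pos' hF n
      rw [FolnerErgodic.trunc, ← min_div_div_right hn.le, mul_div_cancel_right₀ _ hn.ne']
    · rw [hs, FolnerErgodic.supplement_of_nonempty (hF.1 n), FolnerErgodic.avg, ← sub_div,
        sub_sub_cancel]
  · refine FolnerErgodic.erealIntegral_eq_bot hf₀i ?_ fun r => ?_
    · filter_upwards [hfnonneg] with y hy
      refine (hle 0 y).trans (EReal.coe_le_coe_iff.2 ?_)
      linarith
    · have hlt : (⨅ K ∈ {K : Finset G | Tiles K},
          (((K.card : ℝ)⁻¹ * ∫ y, d K y ∂ν : ℝ) : EReal)) < (r : EReal) := by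
        rw [hνD]
        exact EReal.bot_lt_coe r
      simp only [iInf_lt_iff] at hlt
      obtain ⟨K, hK, hKr⟩ := hlt
      rw [EReal.coe_lt_coe_iff, inv_mul_eq_div] at hKr
      have hKpos : (0 : ℝ) < K.card := by exact_mod_cast hK.1.card_pos
      have hlim := (hsf.tendsto_integral_trunc hK.1).div_const (K.card : ℝ)
      rw [hs, FolnerErgodic.integral_supplement hact hint hK.1, sub_div,
        mul_div_cancel_left₀ _ hKpos.ne', ← hs] at hlim
      obtain ⟨L, hL⟩ := (hlim.eventually (lt_mem_nhds
        (show (∫ y, d {1} y ∂ν) - r < _ from sub_lt_sub_left hKr _))).exists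
      refine ⟨fun y => f₀ y - f L y, hf₀i.sub (hf L).integrable,
        Eventually.of_forall (hle L), ?_⟩
      rw [integral_sub hf₀i (hf L).integrable, hf₀int]
      have := (div_le_iff₀ hKpos).2 ((hf L).integral_tile_le K hK)
      linarith
  · intro hcases g
    suffices h : ∀ L : ℕ, ∀ᵐ y ∂ν, f L (T g y) = f L y by
      filter_upwards [ae_all_iff.2 h] with y hy
      have h1 : f₀ (T g y) = f₀ y := FolnerErgodic.condExp_invSigma_apply ν T (d {1}) g y
      change (f₀ (T g y) : EReal) - ⨆ L, (f L (T g y) : EReal) = _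
      simp only [h1, hy]
    intro L
    rcases hcases with hbi | ⟨h₀, hss⟩ | hmul
    · refine (hf L).invariant_of_biinvariant sys hT (htf L) (FolnerErgodic.trunc_le L s) ?_ g
      have h1 : ∀ᵐ y ∂ν, ∀ E : Finset G, E.Nonempty → ∀ g,
          d (E.image (g * ·)) y = d (E.image (· * g)) y := ae_all_iff.2 fun E => by
        by_cases hE : E.Nonempty
        · exact (ae_all_iff.2 (hbi E hE)).mono fun y hy _ => hy
        · exact Eventually.of_forall fun y h => absurd h hE
      filter_upwards [hd, h1] with y h2 h3 E g
      rw [FolnerErgodic.trunc, FolnerErgodic.trunc, hs, h2.supplement_biinvariant h3,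
        Finset.card_image_of_injective _ (mul_left_injective g),
        Finset.card_image_of_injective _ (mul_right_injective g)]
    · refine (hf L).invariant_of_sum_interior_le sys hT (htf L) (FolnerErgodic.trunc_le L s) ?_ g
      filter_upwards [hd, ae_all_iff.2 fun E => ae_all_iff.2 fun E' => hss E E'] with y h1 h2 K P
      exact h1.supplement.sum_interior_trunc_le (FolnerErgodic.supplement_empty d y)
        (FolnerErgodic.supplement_supermodular (h₀ y) h2) (Nat.cast_nonneg L) K P
    · refine (hf L).invariant_of_mul hT (fun N => ?_) g
      obtain ⟨p, hp, m, hm, hNp, hNm, h⟩ := hmul N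
      exact ⟨p, hp, m, hm, hNp, hNm, by rw [hrange, hrange]; exact h⟩
end
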